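/- Let P(x) = x^d − a ∈ ℤ[x] with d ≥ 2, gcd(d, a) = 1, and a squarefree with a ≠ ±1. Then there exist constants c > 0 and x₀, depending only on d and a, such that for all x ≥ x₀, (1/π(x)) · Σ_{p ≤ x, P has no root mod p} (p − G_P(p)) ≥ c · (log log log x)/(log log log log x), where the sum is over primes p ≤ x such that P(m) ≢ 0 (mod p) for all integers m. -/

import Mathlib

section
open Polynomial Finset
open scoped Classical

/-- `Fprod P n = ∏_{i=1}^n P(i)`. -/
noncomputable def Fprod (P : Polynomial ℤ) (n : ℕ) : ℤ := ∏ i ∈ Finset.Icc 1 n, P.eval (i : ℤ)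

/-- `Gval P p = #{F_P(n) mod p : 1 ≤ n ≤ p}`. -/
noncomputable def Gval (P : Polynomial ℤ) (p : ℕ) : ℕ :=
  ((Finset.Icc 1 p).image (fun n => ((Fprod P n : ZMod p)))).card

end

section
open Complex MeasureTheory Set Filter Topology Asymptotics

noncomputable def riesz (a : ℕ → ℝ) (r : ℕ) (v : ℝ) : ℝ :=
  ∑ n ∈ Finset.Ico 1 ⌈Real.exp v⌉₊, a n * (v - Real.log n) ^ r

structure RieszRegular (a L : ℕ → ℝ) (r : ℕ) (c Q : ℝ) : Prop where
  nonneg : ∀ n, 0 ≤ a n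
  log_nonneg : ∀ n, 0 ≤ L n
  one : a 1 = 1
  conv : ∀ n : ℕ, a n * Real.log n = ∑ p ∈ n.divisorsAntidiagonal, L p.1 * a p.2
  two_le : 2 ≤ Q
  inv_le : 1 / Q ≤ c
  le : c ≤ Q
  factorial_le : (r.factorial : ℝ) ≤ Q
  pow_le : (5 : ℝ) ^ (r + 1) ≤ Q
  bound : ∀ v : ℝ, 0 < v → |riesz a r v - c * Real.exp v| ≤ Q * Real.exp ((1 - 1 / Q) * v)

namespace RieszRegular
variable {a L : ℕ → ℝ} {r : ℕ} {c Q : ℝ}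

theorem sum_le (h : RieszRegular a L r c Q) (N : ℕ) (hN : 1 ≤ N) :
    ∑ n ∈ Finset.Icc 1 N, a n ≤ (2 * Q * Real.exp 1) * N := by
  have hN0 : (0 : ℝ) < N := by exact_mod_cast hN
  have hQ : 0 < Q := by linarith [h.two_le]
  have hlog : 0 ≤ Real.log N := Real.log_nonneg (by exact_mod_cast hN)
  have hb := h.bound (Real.log N + 1) (by linarith)
  have hexp : Real.exp (Real.log N + 1) = Real.exp 1 * N := by
    rw [Real.exp_add, Real.exp_log hN0, mul_comm]
  have h1 : ∑ n ∈ Finset.Icc 1 N, a n ≤ riesz a r (Real.log N + 1) := by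
    unfold riesz
    calc ∑ n ∈ Finset.Icc 1 N, a n
        ≤ ∑ n ∈ Finset.Icc 1 N, a n * (Real.log N + 1 - Real.log n) ^ r := by
          refine Finset.sum_le_sum fun n hn => ?_
          rw [Finset.mem_Icc] at hn
          have : Real.log n ≤ Real.log N :=
            Real.log_le_log (by exact_mod_cast hn.1) (by exact_mod_cast hn.2)
          exact le_mul_of_one_le_right (h.nonneg n) (one_le_pow₀ (by linarith))
      _ ≤ _ := by
          refine Finset.sum_le_sum_of_subset_of_nonneg ?_ ?_
          · intro n hn
            rw [Finset.mem_Icc] at hn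
            rw [Finset.mem_Ico]
            refine ⟨hn.1, ?_⟩
            rw [Nat.lt_ceil, hexp]
            have : (n : ℝ) ≤ N := by exact_mod_cast hn.2
            have := Real.add_one_lt_exp (x := 1) one_ne_zero
            nlinarith
          · intro n hn _
            rw [Finset.mem_Ico, Nat.lt_ceil] at hn
            have := (Real.log_lt_iff_lt_exp (by exact_mod_cast hn.1)).mpr hn.2
            exact mul_nonneg (h.nonneg n) (pow_nonneg (by linarith) _)
  have h2 : Real.exp ((1 - 1 / Q) * (Real.log N + 1)) ≤ Real.exp (Real.log N + 1) := by
    apply Real.exp_le_exp.mpr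
    have : 0 < 1 / Q := by positivity
    nlinarith
  have h3 := (abs_le.mp hb).2
  rw [hexp] at *
  have : c * (Real.exp 1 * N) ≤ Q * (Real.exp 1 * N) :=
    mul_le_mul_of_nonneg_right h.le (by positivity)
  have : Q * Real.exp ((1 - 1 / Q) * (Real.log N + 1)) ≤ Q * (Real.exp 1 * N) :=
    mul_le_mul_of_nonneg_left h2 hQ.le
  linarith

theorem lseriesSummable (h : RieszRegular a L r c Q) {s : ℂ} (hs : 1 < s.re) :
    LSeriesSummable (fun n => (a n : ℂ)) s := by
  refine LSeriesSummable_of_sum_norm_bigO_and_nonneg (r := 1) ?_ h.nonneg zero_le_one hs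
  refine Asymptotics.IsBigO.of_bound (2 * Q * Real.exp 1) ?_
  filter_upwards [eventually_ge_atTop 1] with N hN
  have := h.sum_le N hN
  rw [Real.norm_of_nonneg (Finset.sum_nonneg fun n _ => h.nonneg n), Real.rpow_one,
    Real.norm_of_nonneg (Nat.cast_nonneg N)]
  exact this

theorem log_one_eq (h : RieszRegular a L r c Q) : L 1 = 0 := by
  have := h.conv 1
  simpa [h.one] using this.symm

theorem log_le (h : RieszRegular a L r c Q) {n : ℕ} (hn : n ≠ 0) : L n ≤ a n * Real.log n := by
  rw [h.conv n]
  have : L n = L (n, 1).1 * a (n, 1).2 := by simp [h.one]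
  rw [this]
  refine Finset.single_le_sum (f := fun p : ℕ × ℕ => L p.1 * a p.2)
    (fun p _ => mul_nonneg (h.log_nonneg _) (h.nonneg _)) ?_
  simp [hn]

end RieszRegular

end

section
open Complex MeasureTheory Set Filter Topology Asymptotics

noncomputable def laplaceKernel (r : ℕ) (s : ℂ) : ℝ → ℂ :=
  (Ioi (0 : ℝ)).indicator fun v => (v : ℂ) ^ r * cexp (-(s * v))

theorem integral_laplaceKernel_ofReal (r : ℕ) {σ : ℝ} (hs : 0 < σ) :
    ∫ v, laplaceKernel r σ v = r.factorial / (σ : ℂ) ^ (r + 1) := by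
  unfold laplaceKernel
  rw [integral_indicator measurableSet_Ioi]
  have := Complex.integral_cpow_mul_exp_neg_mul_Ioi (a := (r : ℂ) + 1) (r := σ)
    (by simp; positivity) hs
  simp only [add_sub_cancel_right, cpow_natCast] at this
  rw [this, Complex.Gamma_nat_eq_factorial]
  have h2 : ((r : ℂ) + 1) = ((r + 1 : ℕ) : ℂ) := by push_cast; ring
  rw [h2, cpow_natCast, one_div, inv_pow, div_eq_mul_inv, mul_comm]

theorem measurable_laplaceKernel (r : ℕ) (s : ℂ) : Measurable (laplaceKernel r s) :=
  Measurable.indicator (by fun_prop) measurableSet_Ioi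

theorem integrable_laplaceKernel (r : ℕ) {s : ℂ} (hs : 0 < s.re) :
    Integrable (laplaceKernel r s) := by
  have h : Integrable (laplaceKernel r (s.re : ℂ)) := by
    apply Integrable.of_integral_ne_zero
    rw [integral_laplaceKernel_ofReal r hs]
    have : (s.re : ℂ) ≠ 0 := by exact_mod_cast hs.ne'
    exact div_ne_zero (by exact_mod_cast r.factorial_ne_zero) (pow_ne_zero _ this)
  refine h.mono (measurable_laplaceKernel r s).aestronglyMeasurable (Eventually.of_forall fun v => ?_)
  unfold laplaceKernel
  by_cases hv : v ∈ Ioi (0 : ℝ)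
  · simp [indicator_of_mem hv, norm_exp]
  · simp [indicator_of_notMem hv]

theorem tendsto_pow_mul_cexp (r : ℕ) {s : ℂ} (hs : 0 < s.re) :
    Tendsto (fun v : ℝ => (v : ℂ) ^ r * cexp (-(s * v))) atTop (𝓝 0) := by
  rw [tendsto_zero_iff_norm_tendsto_zero]
  have := Real.tendsto_pow_mul_exp_neg_atTop_nhds_zero r
  have h2 := (this.comp (tendsto_id.const_mul_atTop hs)).const_mul ((s.re ^ r)⁻¹)
  rw [mul_zero] at h2
  refine h2.congr' ?_
  filter_upwards [eventually_ge_atTop 0] with v hv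
  simp only [norm_mul, norm_pow, norm_real, norm_exp, Function.comp, id]
  rw [Real.norm_of_nonneg hv]
  simp
  rw [mul_pow]
  field_simp

theorem integral_laplaceKernel (r : ℕ) {s : ℂ} (hs : 0 < s.re) :
    ∫ v, laplaceKernel r s v = r.factorial / s ^ (r + 1) := by
  have hs0 : s ≠ 0 := by rintro rfl; simp at hs
  have hd (k : ℕ) (v : ℝ) : HasDerivAt (fun v : ℝ => (v : ℂ) ^ k * cexp (-(s * v)))
      ((k : ℂ) * (v : ℂ) ^ (k - 1) * cexp (-(s * v)) + (v : ℂ) ^ k * (cexp (-(s * v)) * -s)) v := by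
    have h1 : HasDerivAt (fun v : ℝ => (v : ℂ)) 1 v := Complex.ofRealCLM.hasDerivAt
    have h2 := (h1.pow k).mul ((h1.const_mul s).neg.cexp)
    exact h2.congr_deriv (by simp)
  have hi (k : ℕ) : IntegrableOn (fun v : ℝ => (v : ℂ) ^ k * cexp (-(s * v))) (Ioi 0) :=
    (integrable_indicator_iff measurableSet_Ioi).mp (integrable_laplaceKernel k hs)
  have hrec : ∀ k : ℕ, ∫ v, laplaceKernel k s v = k.factorial / s ^ (k + 1) := by
    intro k
    induction k with
    | zero =>
      have := integral_Ioi_of_hasDerivAt_of_tendsto' (fun v _ => hd 0 v)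
        (a := 0) (by simpa [IntegrableOn] using ((hi 0).mul_const (-s))) (tendsto_pow_mul_cexp 0 hs)
      unfold laplaceKernel
      rw [integral_indicator measurableSet_Ioi]
      simp only [CharP.cast_eq_zero, zero_mul, zero_add, pow_zero, one_mul] at this ⊢
      rw [integral_mul_const] at this
      simp at this ⊢
      field_simp
      linear_combination this
    | succ k ih =>
      have h1 : IntegrableOn (fun v : ℝ => ((k : ℂ) + 1) * ((v : ℂ) ^ k * cexp (-(s * v)))) (Ioi 0) :=
        (hi k).const_mul _
      have h2 : IntegrableOn (fun v : ℝ => (-s) * ((v : ℂ) ^ (k + 1) * cexp (-(s * v)))) (Ioi 0) :=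
        (hi (k + 1)).const_mul _
      have h3 : (fun v : ℝ => ((k + 1 : ℕ) : ℂ) * (v : ℂ) ^ (k + 1 - 1) * cexp (-(s * v)) +
          (v : ℂ) ^ (k + 1) * (cexp (-(s * v)) * -s)) = fun v : ℝ =>
          ((k : ℂ) + 1) * ((v : ℂ) ^ k * cexp (-(s * v))) +
          (-s) * ((v : ℂ) ^ (k + 1) * cexp (-(s * v))) := by
        funext v; push_cast; simp; ring
      have := integral_Ioi_of_hasDerivAt_of_tendsto' (fun v _ => hd (k + 1) v)
        (a := 0) (by rw [h3]; exact h1.add h2) (tendsto_pow_mul_cexp (k + 1) hs)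
      rw [h3, integral_add h1 h2, integral_const_mul, integral_const_mul] at this
      unfold laplaceKernel at ih ⊢
      rw [integral_indicator measurableSet_Ioi] at ih ⊢
      rw [ih] at this
      have h4 : s * ∫ v in Ioi (0 : ℝ), (v : ℂ) ^ (k + 1) * cexp (-(s * v)) =
          ((k : ℂ) + 1) * (k.factorial / s ^ (k + 1)) := by
        simp at this
        linear_combination -this
      rw [Nat.factorial_succ]
      field_simp at h4 ⊢
      push_cast
      rw [← h4]
      ring
  exact hrec r

theorem term_mul_laplaceKernel (a : ℕ → ℝ) (r : ℕ) (s : ℂ) (v : ℝ) (n : ℕ) (hn : 1 ≤ n) :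
    LSeries.term (fun n => (a n : ℂ)) s n * laplaceKernel r s (v - Real.log n) =
      if (n : ℝ) < Real.exp v then
        ((a n * (v - Real.log n) ^ r : ℝ) : ℂ) * cexp (-(s * v)) else 0 := by
  have hn0 : (0 : ℝ) < n := by exact_mod_cast hn
  have hn1 : (n : ℂ) ≠ 0 := by exact_mod_cast hn0.ne'
  unfold laplaceKernel
  rw [LSeries.term_of_ne_zero (by omega)]
  by_cases h : (n : ℝ) < Real.exp v
  · have h' := (Real.log_lt_iff_lt_exp hn0).mpr h
    rw [if_pos h, indicator_of_mem (by simpa using h')]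
    have : cexp (-(s * ((v - Real.log n : ℝ) : ℂ))) = cexp (-(s * v)) * (n : ℂ) ^ s := by
      rw [cpow_def_of_ne_zero hn1, ← Complex.exp_add]
      congr 1
      push_cast [Complex.natCast_log]
      ring
    rw [this]
    have : (n : ℂ) ^ s ≠ 0 := by simp [cpow_eq_zero_iff, hn1]
    field_simp
    push_cast
    ring
  · have h' : ¬ (0 < v - Real.log n) := by
      rw [sub_pos, Real.log_lt_iff_lt_exp hn0]; exact h
    rw [if_neg h, indicator_of_notMem (by simpa using h'), mul_zero]

theorem tsum_term_mul_laplaceKernel (a : ℕ → ℝ) (r : ℕ) (s : ℂ) (v : ℝ) :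
    ∑' n, LSeries.term (fun n => (a n : ℂ)) s n * laplaceKernel r s (v - Real.log n) =
      (Ioi (0 : ℝ)).indicator (fun v => (riesz a r v : ℂ) * cexp (-(s * v))) v := by
  have h0 : ∀ n ∉ Finset.Ico 1 ⌈Real.exp v⌉₊,
      LSeries.term (fun n => (a n : ℂ)) s n * laplaceKernel r s (v - Real.log n) = 0 := by
    intro n hn
    rcases Nat.eq_zero_or_pos n with rfl | hn0
    · simp
    · rw [term_mul_laplaceKernel a r s v n hn0, if_neg]
      rw [Finset.mem_Ico, Nat.lt_ceil] at hn
      tauto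
  rw [tsum_eq_sum h0]
  have h1 : ∑ n ∈ Finset.Ico 1 ⌈Real.exp v⌉₊,
      LSeries.term (fun n => (a n : ℂ)) s n * laplaceKernel r s (v - Real.log n) =
      (riesz a r v : ℂ) * cexp (-(s * v)) := by
    unfold riesz
    push_cast
    rw [Finset.sum_mul]
    refine Finset.sum_congr rfl fun n hn => ?_
    rw [Finset.mem_Ico, Nat.lt_ceil] at hn
    rw [term_mul_laplaceKernel a r s v n hn.1, if_pos hn.2]
    push_cast
    rfl
  rw [h1]
  by_cases hv : 0 < v
  · rw [indicator_of_mem (by simpa using hv)]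
  · rw [indicator_of_notMem (by simpa using hv)]
    have : ⌈Real.exp v⌉₊ ≤ 1 := by
      rw [Nat.ceil_le]; simp; linarith
    unfold riesz
    rw [Finset.Ico_eq_empty_of_le this]
    simp

theorem riesz_laplace (a : ℕ → ℝ) (r : ℕ) {s : ℂ} (hs : 0 < s.re)
    (hsum : LSeriesSummable (fun n => (a n : ℂ)) s) :
    ∫ v in Ioi (0 : ℝ), (riesz a r v : ℂ) * cexp (-(s * v)) =
      r.factorial / s ^ (r + 1) * LSeries (fun n => (a n : ℂ)) s := by
  set F : ℕ → ℝ → ℂ := fun n v =>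
    LSeries.term (fun n => (a n : ℂ)) s n * laplaceKernel r s (v - Real.log n) with hF
  have hint : ∀ n, Integrable (F n) := fun n =>
    ((integrable_laplaceKernel r hs).comp_sub_right _).const_mul _
  have hnorm : ∀ n, ∫ v, ‖F n v‖ =
      ‖LSeries.term (fun n => (a n : ℂ)) s n‖ * ∫ v, ‖laplaceKernel r s v‖ := by
    intro n
    simp only [hF, norm_mul]
    rw [integral_const_mul, integral_sub_right_eq_self (fun v => ‖laplaceKernel r s v‖)]
  have hS : Summable fun n => ∫ v, ‖F n v‖ := by
    simp only [hnorm]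
    exact hsum.norm.mul_right _
  have key := hasSum_integral_of_summable_integral_norm hint hS
  have hts : (fun v => ∑' n, F n v) =
      (Ioi (0 : ℝ)).indicator (fun v => (riesz a r v : ℂ) * cexp (-(s * v))) := by
    funext v
    exact tsum_term_mul_laplaceKernel a r s v
  rw [hts, integral_indicator measurableSet_Ioi] at key
  rw [← key.tsum_eq]
  simp only [hF]
  simp_rw [integral_const_mul]
  have : ∀ n : ℕ, ∫ v, laplaceKernel r s (v - Real.log n) = r.factorial / s ^ (r + 1) := by
    intro n
    rw [integral_sub_right_eq_self (laplaceKernel r s), integral_laplaceKernel r hs]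
  simp_rw [this]
  rw [tsum_mul_right, LSeries, mul_comm]

theorem measurable_riesz (a : ℕ → ℝ) (r : ℕ) : Measurable (riesz a r) := by
  have : riesz a r = (fun p : ℕ × ℝ => ∑ n ∈ Finset.Ico 1 p.1, a n * (p.2 - Real.log n) ^ r) ∘
      fun v => (⌈Real.exp v⌉₊, v) := rfl
  rw [this]
  refine Measurable.comp ?_ ((Nat.measurable_ceil.comp Real.measurable_exp).prodMk measurable_id)
  refine measurable_from_prod_countable_right fun N => ?_
  dsimp only
  exact Finset.measurable_fun_sum _ fun n _ => by fun_prop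

end

section
open Complex MeasureTheory Set Filter Topology Asymptotics

theorem integrableOn_pow_mul_exp_neg (k : ℕ) {ε : ℝ} (hε : 0 < ε) :
    IntegrableOn (fun v : ℝ => v ^ k * Real.exp (-(ε * v))) (Ioi 0) := by
  have := ((integrable_indicator_iff measurableSet_Ioi).mp
    (integrable_laplaceKernel k (s := (ε : ℂ)) (by simpa using hε))).norm
  refine IntegrableOn.congr_fun this (fun v hv => ?_) measurableSet_Ioi
  simp [norm_exp, abs_of_pos (mem_Ioi.mp hv)]

section Laplace
variable {g : ℝ → ℝ} {K β : ℝ}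

theorem laplace_norm_le (hb : ∀ v, 0 < v → |g v| ≤ K * Real.exp (β * v)) (s : ℂ) {v : ℝ}
    (hv : 0 < v) : ‖(g v : ℂ) * cexp (-(s * v))‖ ≤ K * Real.exp (-((s.re - β) * v)) := by
  rw [norm_mul, norm_real, norm_exp, Real.norm_eq_abs]
  calc |g v| * Real.exp (-(s * v)).re ≤ K * Real.exp (β * v) * Real.exp (-(s * v)).re :=
        mul_le_mul_of_nonneg_right (hb v hv) (Real.exp_pos _).le
    _ = _ := by rw [mul_assoc, ← Real.exp_add]; congr 2; simp; ring

theorem laplace_integrable (hg : Measurable g) (hb : ∀ v, 0 < v → |g v| ≤ K * Real.exp (β * v))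
    {s : ℂ} (hs : β < s.re) :
    IntegrableOn (fun v : ℝ => (g v : ℂ) * cexp (-(s * v))) (Ioi 0) := by
  have h0 := (integrableOn_pow_mul_exp_neg 0 (sub_pos.mpr hs)).const_mul K
  simp only [pow_zero, one_mul] at h0
  refine Integrable.mono' h0 (by fun_prop) ?_
  filter_upwards [ae_restrict_mem measurableSet_Ioi] with v hv
  exact laplace_norm_le hb s hv

theorem norm_laplace_le (hb : ∀ v, 0 < v → |g v| ≤ K * Real.exp (β * v))
    {s : ℂ} (hs : β < s.re) :
    ‖∫ v in Ioi (0 : ℝ), (g v : ℂ) * cexp (-(s * v))‖ ≤ K / (s.re - β) := by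
  have h0 := (integrableOn_pow_mul_exp_neg 0 (sub_pos.mpr hs)).const_mul K
  simp only [pow_zero, one_mul] at h0
  refine (norm_integral_le_of_norm_le h0 ?_).trans_eq ?_
  · filter_upwards [ae_restrict_mem measurableSet_Ioi] with v hv
    exact laplace_norm_le hb s hv
  · rw [integral_const_mul]
    have : ∫ v in Ioi (0 : ℝ), Real.exp (-((s.re - β) * v)) = 1 / (s.re - β) := by
      have := integral_exp_neg_mul_rpow (p := 1) (b := s.re - β) one_pos (sub_pos.mpr hs)
      simp_rw [← neg_mul, neg_sub]
      simpa [Real.rpow_neg_one, show (1 : ℝ) + 1 = 2 by norm_num] using this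
    rw [this, mul_one_div]

theorem laplace_differentiableAt (hg : Measurable g)
    (hb : ∀ v, 0 < v → |g v| ≤ K * Real.exp (β * v)) {s : ℂ} (hs : β < s.re) :
    DifferentiableAt ℂ (fun s : ℂ => ∫ v in Ioi (0 : ℝ), (g v : ℂ) * cexp (-(s * v))) s := by
  set ε := (s.re - β) / 2 with hε
  have hε0 : 0 < ε := by linarith
  have hre : ∀ z ∈ Metric.ball s ε, ε ≤ z.re - β := by
    intro z hz
    rw [Metric.mem_ball, dist_eq_norm] at hz
    have := (abs_le.mp ((Complex.abs_re_le_norm (z - s)).trans hz.le)).1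
    simp at this
    linarith
  have hK : 0 ≤ K := by
    have := (abs_nonneg _).trans (hb 1 one_pos)
    exact nonneg_of_mul_nonneg_left this (Real.exp_pos _)
  refine (hasDerivAt_integral_of_dominated_loc_of_deriv_le (μ := volume.restrict (Ioi (0 : ℝ)))
    (F := fun z v => (g v : ℂ) * cexp (-(z * v)))
    (bound := fun v => K * (v ^ 1 * Real.exp (-(ε * v))))
    (F' := fun z v => (g v : ℂ) * (cexp (-(z * v)) * -(v : ℂ)))
    (Metric.ball_mem_nhds s hε0) ?_ (laplace_integrable hg hb hs) (by fun_prop) ?_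
    ((integrableOn_pow_mul_exp_neg 1 hε0).const_mul K) ?_).2.differentiableAt
  · exact Eventually.of_forall fun z => by fun_prop
  · filter_upwards [ae_restrict_mem measurableSet_Ioi] with v hv z hz
    rw [← mul_assoc, norm_mul, norm_neg, norm_real, Real.norm_of_nonneg (le_of_lt hv)]
    have h1 := laplace_norm_le hb z hv
    have h2 : Real.exp (-((z.re - β) * v)) ≤ Real.exp (-(ε * v)) := by
      apply Real.exp_le_exp.mpr
      have := mul_le_mul_of_nonneg_right (hre z hz) (le_of_lt (mem_Ioi.mp hv))
      linarith
    have hv' : 0 ≤ v := le_of_lt hv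
    calc _ ≤ K * Real.exp (-((z.re - β) * v)) * v := mul_le_mul_of_nonneg_right h1 hv'
      _ ≤ K * Real.exp (-(ε * v)) * v := by gcongr
      _ = _ := by ring
  · filter_upwards with v z _
    have h1 : HasDerivAt (fun z : ℂ => -(z * v)) (-(v : ℂ)) z :=
      ((hasDerivAt_id z).mul_const (v : ℂ)).neg.congr_deriv (by simp)
    exact h1.cexp.const_mul _
end Laplace

namespace RieszRegular
variable {a L : ℕ → ℝ} {r : ℕ} {c Q : ℝ}

noncomputable def err (a : ℕ → ℝ) (r : ℕ) (c : ℝ) (s : ℂ) : ℂ :=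
  ∫ v in Ioi (0 : ℝ), ((riesz a r v - c * Real.exp v : ℝ) : ℂ) * cexp (-(s * v))

theorem meas_err (a : ℕ → ℝ) (r : ℕ) (c : ℝ) :
    Measurable fun v => riesz a r v - c * Real.exp v :=
  (measurable_riesz a r).sub (by fun_prop)

theorem differentiableAt_err (h : RieszRegular a L r c Q) {s : ℂ} (hs : 1 - 1 / Q < s.re) :
    DifferentiableAt ℂ (err a r c) s :=
  laplace_differentiableAt (meas_err a r c) h.bound hs

theorem norm_err_le (h : RieszRegular a L r c Q) {s : ℂ} (hs : 1 - 1 / (2 * Q) ≤ s.re) :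
    ‖err a r c s‖ ≤ 2 * Q ^ 2 := by
  have hQ := h.two_le
  have hQ0 : 0 < Q := by linarith
  have h1 : 1 / (2 * Q) ≤ s.re - (1 - 1 / Q) := by
    have : 1 / Q = 2 * (1 / (2 * Q)) := by field_simp
    linarith
  have h0 : 0 < 1 / (2 * Q) := by positivity
  refine (norm_laplace_le h.bound (by linarith)).trans ?_
  calc Q / (s.re - (1 - 1 / Q)) ≤ Q / (1 / (2 * Q)) := by gcongr
    _ = _ := by field_simp

theorem lseries_eq (h : RieszRegular a L r c Q) {s : ℂ} (hs : 1 < s.re) :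
    r.factorial / s ^ (r + 1) * LSeries (fun n => (a n : ℂ)) s = c / (s - 1) + err a r c s := by
  have hQ := h.two_le
  have hQ0 : 0 < 1 / Q := by positivity
  rw [← riesz_laplace a r (by linarith) (h.lseriesSummable hs)]
  have h1 := laplace_integrable (meas_err a r c) h.bound (s := s) (by linarith)
  have hc : ∀ v : ℝ, 0 < v → |c * Real.exp v| ≤ |c| * Real.exp (1 * v) := by
    intro v _
    rw [abs_mul, one_mul, abs_of_pos (Real.exp_pos v)]
  have h2 := laplace_integrable (by fun_prop) hc hs
  have h3 : (fun v : ℝ => (riesz a r v : ℂ) * cexp (-(s * v))) = fun v : ℝ =>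
      ((c * Real.exp v : ℝ) : ℂ) * cexp (-(s * v)) +
      ((riesz a r v - c * Real.exp v : ℝ) : ℂ) * cexp (-(s * v)) := by
    funext v; push_cast; ring
  rw [h3, integral_add h2 h1]
  congr 1
  have h4 := integral_laplaceKernel 0 (s := s - 1) (by simpa using hs)
  unfold laplaceKernel at h4
  rw [integral_indicator measurableSet_Ioi] at h4
  simp only [pow_zero, one_mul, Nat.factorial_zero, Nat.cast_one, zero_add, pow_one] at h4
  rw [← mul_one_div, ← h4, ← integral_const_mul]
  congr 1
  funext v
  push_cast
  rw [mul_assoc, ← Complex.exp_add]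
  congr 2
  ring
end RieszRegular

end

section
open Complex MeasureTheory Set Filter Topology Asymptotics

theorem LSeries_term_ofReal (f : ℕ → ℝ) (σ t : ℝ) {n : ℕ} (hn : n ≠ 0) :
    LSeries.term (fun n => (f n : ℂ)) (σ + t * I) n =
      ((f n * (n : ℝ) ^ (-σ) : ℝ) : ℂ) * cexp (((-(t * Real.log n) : ℝ) : ℂ) * I) := by
  have hn1 : (n : ℂ) ≠ 0 := by exact_mod_cast hn
  rw [LSeries.term_of_ne_zero hn, div_eq_mul_inv, ← cpow_neg, neg_add, cpow_add _ _ hn1]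
  push_cast
  rw [ofReal_cpow (Nat.cast_nonneg n), mul_assoc]
  congr 2
  · simp
  · rw [cpow_def_of_ne_zero hn1]
    congr 1
    ring

theorem LSeries_term_re (f : ℕ → ℝ) (σ t : ℝ) {n : ℕ} (hn : n ≠ 0) :
    (LSeries.term (fun n => (f n : ℂ)) (σ + t * I) n).re =
      f n * (n : ℝ) ^ (-σ) * Real.cos (t * Real.log n) := by
  rw [LSeries_term_ofReal f σ t hn, re_ofReal_mul, exp_ofReal_mul_I_re, Real.cos_neg]

theorem LSeries_three_four_one {f : ℕ → ℝ} (hf : ∀ n, 0 ≤ f n) {σ : ℝ} (t : ℝ)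
    (hs : LSeriesSummable (fun n => (f n : ℂ)) σ) :
    0 ≤ 3 * (LSeries (fun n => (f n : ℂ)) σ).re + 4 * (LSeries (fun n => (f n : ℂ)) (σ + t * I)).re
      + (LSeries (fun n => (f n : ℂ)) (σ + 2 * t * I)).re := by
  have h0 := (hasSum_re hs.hasSum)
  have h1 := (hasSum_re (hs.of_re_le_re (s' := σ + t * I) (by simp)).hasSum)
  have h2 := (hasSum_re (hs.of_re_le_re (s' := σ + 2 * t * I) (by simp)).hasSum)
  have h := ((h0.mul_left 3).add (h1.mul_left 4)).add h2
  refine h.nonneg fun n => ?_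
  rcases eq_or_ne n 0 with rfl | hn
  · simp
  have e0 := LSeries_term_re f σ 0 hn
  have e2 := LSeries_term_re f σ (2 * t) hn
  simp only [ofReal_zero, zero_mul, add_zero, Real.cos_zero, mul_one] at e0
  push_cast at e2
  rw [e0, LSeries_term_re f σ t hn, e2, mul_assoc 2 t, Real.cos_two_mul]
  have : 0 ≤ f n * (n : ℝ) ^ (-σ) := mul_nonneg (hf n) (by positivity)
  nlinarith [mul_nonneg this (sq_nonneg (1 + Real.cos (t * Real.log n)))]

namespace RieszRegular
variable {a L : ℕ → ℝ} {r : ℕ} {c Q : ℝ}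

theorem abscissa_le (h : RieszRegular a L r c Q) :
    LSeries.abscissaOfAbsConv (fun n => (a n : ℂ)) ≤ 1 :=
  LSeries.abscissaOfAbsConv_le_of_forall_lt_LSeriesSummable
    fun y hy => h.lseriesSummable (by simpa using hy)

theorem summable_div_log (h : RieszRegular a L r c Q) {s : ℂ} (hs : 1 < s.re) :
    LSeriesSummable (fun n => ((L n / Real.log n : ℝ) : ℂ)) s := by
  refine (h.lseriesSummable hs).norm.of_norm_bounded (fun n => ?_)
  rcases eq_or_ne n 0 with rfl | hn
  · simp
  refine LSeries.norm_term_le _ ?_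
  rw [norm_real, norm_real, Real.norm_of_nonneg (h.nonneg n), Real.norm_eq_abs, abs_of_nonneg
    (div_nonneg (h.log_nonneg n) (Real.log_natCast_nonneg n))]
  refine div_le_of_le_mul₀ (Real.log_natCast_nonneg n) (h.nonneg n) (h.log_le hn)

theorem abscissa_div_log_le (h : RieszRegular a L r c Q) :
    LSeries.abscissaOfAbsConv (fun n => ((L n / Real.log n : ℝ) : ℂ)) ≤ 1 :=
  LSeries.abscissaOfAbsConv_le_of_forall_lt_LSeriesSummable
    fun y hy => h.summable_div_log (by simpa using hy)

theorem logMul_div_log (h : RieszRegular a L r c Q) {n : ℕ} (hn : n ≠ 0) :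
    LSeries.logMul (fun n => ((L n / Real.log n : ℝ) : ℂ)) n = L n := by
  unfold LSeries.logMul
  rcases eq_or_ne n 1 with rfl | hn1
  · simp [h.log_one_eq]
  · have : Real.log n ≠ 0 :=
      (Real.log_pos (by exact_mod_cast (by omega : 1 < n))).ne'
    rw [← natCast_log, ← ofReal_mul]
    congr 1
    field_simp

theorem lt_of_abscissa {f : ℕ → ℂ} (h : LSeries.abscissaOfAbsConv f ≤ 1) {s : ℂ} (hs : 1 < s.re) :
    LSeries.abscissaOfAbsConv f < s.re :=
  h.trans_lt (by exact_mod_cast hs)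

theorem summable_log (h : RieszRegular a L r c Q) {s : ℂ} (hs : 1 < s.re) :
    LSeriesSummable (fun n => (L n : ℂ)) s :=
  (LSeriesSummable_congr s fun {_} hn => h.logMul_div_log hn).mp
    (LSeriesSummable_logMul_of_lt_re (lt_of_abscissa h.abscissa_div_log_le hs))

theorem hasDerivAt_primeSeries (h : RieszRegular a L r c Q) {s : ℂ} (hs : 1 < s.re) :
    HasDerivAt (LSeries fun n => ((L n / Real.log n : ℝ) : ℂ)) (-LSeries (fun n => (L n : ℂ)) s) s := by
  have := LSeries_hasDerivAt (lt_of_abscissa h.abscissa_div_log_le hs)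
  rwa [LSeries_congr (fun {_} hn => h.logMul_div_log hn) s] at this

theorem hasDerivAt_series (h : RieszRegular a L r c Q) {s : ℂ} (hs : 1 < s.re) :
    HasDerivAt (LSeries fun n => (a n : ℂ))
      (-(LSeries (fun n => (L n : ℂ)) s * LSeries (fun n => (a n : ℂ)) s)) s := by
  have := LSeries_hasDerivAt (lt_of_abscissa h.abscissa_le hs)
  rw [← LSeries_convolution' (h.summable_log hs) (h.lseriesSummable hs)]
  rwa [LSeries_congr (g := LSeries.convolution (fun n => (L n : ℂ)) fun n => (a n : ℂ))
    (fun {n} _ => ?_) s] at this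
  rw [LSeries.convolution_def, LSeries.logMul, ← natCast_log, ← ofReal_mul, mul_comm, h.conv n]
  push_cast
  rfl

theorem series_eq_exp (h : RieszRegular a L r c Q) {s : ℂ} (hs : 1 < s.re) :
    LSeries (fun n => (a n : ℂ)) s =
      cexp (LSeries (fun n => ((L n / Real.log n : ℝ) : ℂ)) s) := by
  set Z := LSeries fun n => (a n : ℂ)
  set P := LSeries fun n => ((L n / Real.log n : ℝ) : ℂ)
  have hd : ∀ z : ℂ, 1 < z.re → HasDerivAt (fun z => Z z * cexp (-P z)) 0 z := by
    intro z hz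
    refine ((h.hasDerivAt_series hz).mul (h.hasDerivAt_primeSeries hz).neg.cexp).congr_deriv ?_
    simp only [Pi.neg_apply]
    ring
  have hopen : IsOpen {z : ℂ | 1 < z.re} := isOpen_lt continuous_const continuous_re
  have hconv : Convex ℝ {z : ℂ | 1 < z.re} := convex_halfSpace_re_gt 1
  have hconst : ∀ z : ℂ, 1 < z.re → Z z * cexp (-P z) = Z s * cexp (-P s) := by
    intro z hz
    refine hopen.is_const_of_deriv_eq_zero hconv.isPreconnected
      (fun w hw => (hd w hw).differentiableAt.differentiableWithinAt)
      (fun w hw => (hd w hw).deriv) hz hs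
  have hlim : Tendsto (fun x : ℝ => Z x * cexp (-P x)) atTop (𝓝 1) := by
    have h1 : Tendsto (fun x : ℝ => Z x) atTop (𝓝 1) := by
      have := LSeries.tendsto_atTop (f := fun n => (a n : ℂ))
        (h.abscissa_le.trans_lt (by decide))
      simpa [h.one] using this
    have h2 : Tendsto (fun x : ℝ => P x) atTop (𝓝 0) := by
      have := LSeries.tendsto_atTop (f := fun n => ((L n / Real.log n : ℝ) : ℂ))
        (h.abscissa_div_log_le.trans_lt (by decide))
      simp only [Nat.cast_one, Real.log_one, div_zero, ofReal_zero] at this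
      exact this
    simpa using h1.mul (h2.neg.cexp)
  have hev : (fun x : ℝ => Z x * cexp (-P x)) =ᶠ[atTop] fun _ => Z s * cexp (-P s) := by
    filter_upwards [eventually_gt_atTop 1] with x hx
    exact hconst x (by simpa using hx)
  have := tendsto_nhds_unique (tendsto_const_nhds.congr' hev.symm) hlim
  rw [Complex.exp_neg] at this
  field_simp [Complex.exp_ne_zero] at this
  exact this

theorem series_three_four_one (h : RieszRegular a L r c Q) {σ : ℝ} (hσ : 1 < σ) (t : ℝ) :
    1 ≤ ‖LSeries (fun n => (a n : ℂ)) σ‖ ^ 3 * ‖LSeries (fun n => (a n : ℂ)) (σ + t * I)‖ ^ 4 *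
      ‖LSeries (fun n => (a n : ℂ)) (σ + 2 * t * I)‖ := by
  have hs : 1 < (σ : ℂ).re := by simpa using hσ
  rw [h.series_eq_exp hs, h.series_eq_exp (s := σ + t * I) (by simpa using hσ),
    h.series_eq_exp (s := σ + 2 * t * I) (by simpa using hσ), norm_exp, norm_exp, norm_exp,
    ← Real.exp_nat_mul, ← Real.exp_nat_mul, ← Real.exp_add, ← Real.exp_add]
  apply Real.one_le_exp
  exact_mod_cast LSeries_three_four_one
    (fun n => div_nonneg (h.log_nonneg n) (Real.log_natCast_nonneg n)) t (h.summable_div_log hs)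

end RieszRegular

end

section
open Complex MeasureTheory Set Filter Topology Asymptotics

namespace RieszRegular
variable {a L : ℕ → ℝ} {r : ℕ} {c Q : ℝ}

noncomputable def reg (a : ℕ → ℝ) (r : ℕ) (c : ℝ) (s : ℂ) : ℂ := c + (s - 1) * err a r c s

theorem one_lt (h : RieszRegular a L r c Q) : 1 < Q := by linarith [h.two_le]

theorem differentiableAt_reg (h : RieszRegular a L r c Q) {s : ℂ} (hs : 1 - 1 / Q < s.re) :
    DifferentiableAt ℂ (reg a r c) s :=
  (((differentiableAt_id).sub_const _).mul (h.differentiableAt_err hs)).const_add _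

theorem differentiableOn_reg (h : RieszRegular a L r c Q) :
    DifferentiableOn ℂ (reg a r c) {s | 1 - 1 / Q < s.re} :=
  fun _ hs => (h.differentiableAt_reg hs).differentiableWithinAt

theorem differentiableAt_deriv_reg (h : RieszRegular a L r c Q) {s : ℂ}
    (hs : 1 - 1 / Q < s.re) : DifferentiableAt ℂ (deriv (reg a r c)) s :=
  (h.differentiableOn_reg.deriv (isOpen_lt continuous_const continuous_re)).differentiableAt
    ((isOpen_lt continuous_const continuous_re).mem_nhds hs)

theorem norm_reg_le (h : RieszRegular a L r c Q) {s : ℂ} (hs : 1 - 1 / (2 * Q) ≤ s.re)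
    (hs1 : ‖s - 1‖ ≤ 7) : ‖reg a r c s‖ ≤ Q ^ 6 := by
  have hQ := h.two_le
  have hc : 0 < c := lt_of_lt_of_le (by positivity) h.inv_le
  calc ‖reg a r c s‖ ≤ ‖(c : ℂ)‖ + ‖s - 1‖ * ‖err a r c s‖ := by
        unfold reg; exact (norm_add_le _ _).trans (by rw [norm_mul])
    _ ≤ Q + 7 * (2 * Q ^ 2) := by
        rw [norm_real, Real.norm_of_nonneg hc.le]
        gcongr
        · exact h.le
        · exact h.norm_err_le hs
    _ ≤ Q ^ 6 := by
        have h2 : 4 ≤ Q ^ 2 := by nlinarith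
        have h4 : 16 ≤ Q ^ 4 := by nlinarith
        nlinarith [sq_nonneg Q, mul_nonneg (sq_nonneg Q) (sub_nonneg.mpr h4)]

theorem re_norm_of_mem_sphere {z s : ℂ} {R : ℝ} (hz : z ∈ Metric.closedBall s R) :
    s.re - R ≤ z.re ∧ ‖z - 1‖ ≤ ‖s - 1‖ + R := by
  rw [mem_closedBall_iff_norm] at hz
  constructor
  · have := (abs_le.mp ((Complex.abs_re_le_norm (z - s)).trans hz)).1
    simp at this
    linarith
  · calc ‖z - 1‖ = ‖(s - 1) + (z - s)‖ := by ring_nf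
      _ ≤ _ := (norm_add_le _ _).trans (by gcongr)

theorem norm_deriv_reg_le (h : RieszRegular a L r c Q) {s : ℂ} (hs : 1 - 1 / (4 * Q) ≤ s.re)
    (hs1 : ‖s - 1‖ ≤ 6) : ‖deriv (reg a r c) s‖ ≤ Q ^ 9 := by
  have hQ := h.two_le
  have h0 : 0 < 1 / (4 * Q) := by positivity
  have h1 : 1 / (2 * Q) = 1 / (4 * Q) + 1 / (4 * Q) := by field_simp; norm_num
  have h2 : 1 / Q = 1 / (2 * Q) + 1 / (2 * Q) := by field_simp; norm_num
  have h3 : 1 / (4 * Q) ≤ 1 := by rw [div_le_one (by positivity)]; linarith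
  have := norm_deriv_le_of_forall_mem_sphere_norm_le (c := s) (f := reg a r c) (C := Q ^ 6) h0 ?_ ?_
  · refine this.trans ?_
    rw [div_div_eq_mul_div, div_one]
    nlinarith [pow_pos (by linarith : 0 < Q) 7, pow_pos (by linarith : 0 < Q) 8]
  · refine DifferentiableOn.diffContOnCl_ball (U := Metric.closedBall s (1 / (4 * Q))) ?_ le_rfl
    intro z hz
    have := (re_norm_of_mem_sphere hz).1
    exact (h.differentiableAt_reg (by linarith)).differentiableWithinAt
  · intro z hz
    have := re_norm_of_mem_sphere (Metric.sphere_subset_closedBall hz)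
    exact h.norm_reg_le (by linarith) (by linarith)

theorem norm_deriv_deriv_reg_le (h : RieszRegular a L r c Q) {s : ℂ} (hs : 1 ≤ s.re)
    (hs1 : ‖s - 1‖ ≤ 5) : ‖deriv (deriv (reg a r c)) s‖ ≤ Q ^ 12 := by
  have hQ := h.two_le
  have h0 : 0 < 1 / (4 * Q) := by positivity
  have h1 : 1 / (2 * Q) = 1 / (4 * Q) + 1 / (4 * Q) := by field_simp; norm_num
  have h2 : 1 / Q = 1 / (2 * Q) + 1 / (2 * Q) := by field_simp; norm_num
  have h3 : 1 / (4 * Q) ≤ 1 := by rw [div_le_one (by positivity)]; linarith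
  have := norm_deriv_le_of_forall_mem_sphere_norm_le (c := s) (f := deriv (reg a r c))
    (C := Q ^ 9) h0 ?_ ?_
  · refine this.trans ?_
    rw [div_div_eq_mul_div, div_one]
    nlinarith [pow_pos (by linarith : 0 < Q) 10, pow_pos (by linarith : 0 < Q) 11]
  · refine DifferentiableOn.diffContOnCl_ball (U := Metric.closedBall s (1 / (4 * Q))) ?_ le_rfl
    intro z hz
    have := (re_norm_of_mem_sphere hz).1
    exact (h.differentiableAt_deriv_reg (by linarith)).differentiableWithinAt
  · intro z hz
    have := re_norm_of_mem_sphere (Metric.sphere_subset_closedBall hz)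
    exact h.norm_deriv_reg_le (by linarith) (by linarith)

theorem series_mul_eq (h : RieszRegular a L r c Q) {s : ℂ} (hs : 1 < s.re) :
    LSeries (fun n => (a n : ℂ)) s * (r.factorial * (s - 1)) = reg a r c s * s ^ (r + 1) := by
  have hs0 : s ≠ 0 := by rintro rfl; simp at hs; linarith
  have hs1 : s - 1 ≠ 0 := by
    intro h0
    rw [sub_eq_zero] at h0
    simp [h0] at hs
  have := h.lseries_eq hs
  unfold reg
  field_simp at this
  linear_combination this

theorem series_ne_zero (h : RieszRegular a L r c Q) {s : ℂ} (hs : 1 < s.re) :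
    LSeries (fun n => (a n : ℂ)) s ≠ 0 := by
  rw [h.series_eq_exp hs]
  exact Complex.exp_ne_zero _

theorem norm_series_mul_le (h : RieszRegular a L r c Q) {s : ℂ} (hs : 1 < s.re) (h5 : ‖s‖ ≤ 5) :
    ‖LSeries (fun n => (a n : ℂ)) s‖ * ‖s - 1‖ ≤ ‖reg a r c s‖ * Q := by
  have e := congrArg norm (h.series_mul_eq hs)
  simp only [norm_mul, norm_natCast, norm_pow] at e
  have h1 : (1 : ℝ) ≤ r.factorial := by exact_mod_cast r.factorial_pos
  have h2 : ‖s‖ ^ (r + 1) ≤ Q := (pow_le_pow_left₀ (norm_nonneg _) h5 _).trans h.pow_le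
  calc ‖LSeries (fun n => (a n : ℂ)) s‖ * ‖s - 1‖
      ≤ ‖LSeries (fun n => (a n : ℂ)) s‖ * (r.factorial * ‖s - 1‖) := by
        gcongr
        exact le_mul_of_one_le_left (norm_nonneg _) h1
    _ = ‖reg a r c s‖ * ‖s‖ ^ (r + 1) := e
    _ ≤ _ := by gcongr

theorem norm_reg_pow_ge (h : RieszRegular a L r c Q) {σ t : ℝ} (hσ : 1 < σ) (hσ2 : σ ≤ 2)
    (ht : |t| ≤ 2) :
    (σ - 1) ^ 3 * |t| ^ 5 ≤ Q ^ 32 * ‖reg a r c (σ + t * I)‖ ^ 4 := by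
  have hQ := h.two_le
  have key := h.series_three_four_one hσ t
  have n5 : ∀ y : ℝ, |y| ≤ 4 → ‖(σ : ℂ) + y * I‖ ≤ 5 ∧ ‖(σ : ℂ) + y * I - 1‖ ≤ 7 := by
    intro y hy
    have hI : ‖(y : ℂ) * I‖ ≤ 4 := by simpa using hy
    have hs : ‖(σ : ℂ) + y * I‖ ≤ 6 := by
      refine (norm_add_le _ _).trans ?_
      rw [norm_real, Real.norm_of_nonneg (by linarith)]
      linarith
    refine ⟨?_, (norm_sub_le _ _).trans (by simp; linarith)⟩
    rw [Complex.norm_def, Real.sqrt_le_left (by norm_num), Complex.normSq_apply]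
    simp
    have := abs_le.mp hy
    nlinarith
  have inv1 : 0 < Q⁻¹ * 2⁻¹ := by positivity
  have b0 := h.norm_reg_le (s := (σ : ℂ) + (0 : ℝ) * I) (by simp; linarith) (n5 0 (by simp)).2
  have b2 := h.norm_reg_le (s := (σ : ℂ) + (2 * t : ℝ) * I) (by simp; linarith)
    (n5 (2 * t) (by rw [abs_mul]; norm_num; linarith)).2
  have z0 := h.norm_series_mul_le (s := (σ : ℂ) + (0 : ℝ) * I) (by simpa using hσ)
    (n5 0 (by simp)).1
  have z1 := h.norm_series_mul_le (s := (σ : ℂ) + t * I) (by simpa using hσ)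
    (n5 t (by linarith)).1
  have z2 := h.norm_series_mul_le (s := (σ : ℂ) + (2 * t : ℝ) * I) (by simpa using hσ)
    (n5 (2 * t) (by rw [abs_mul]; norm_num; linarith)).1
  have d0 : σ - 1 ≤ ‖(σ : ℂ) + (0 : ℝ) * I - 1‖ := by
    have := Complex.abs_re_le_norm ((σ : ℂ) + (0 : ℝ) * I - 1)
    simp only [ofReal_zero, zero_mul, add_zero, sub_re, ofReal_re, one_re] at this ⊢
    exact (le_abs_self _).trans this
  have d1 : |t| ≤ ‖(σ : ℂ) + t * I - 1‖ := by
    have := Complex.abs_im_le_norm ((σ : ℂ) + t * I - 1)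
    simpa using this
  have d2 : |t| ≤ ‖(σ : ℂ) + (2 * t : ℝ) * I - 1‖ := by
    have := Complex.abs_im_le_norm ((σ : ℂ) + (2 * t : ℝ) * I - 1)
    simp [abs_mul] at this
    push_cast
    linarith [abs_nonneg t]
  simp only [ofReal_zero, zero_mul, add_zero] at b0 z0 d0
  simp only [ofReal_mul, ofReal_ofNat] at b2 z2 d2
  set A0 := ‖LSeries (fun n => (a n : ℂ)) σ‖
  set A1 := ‖LSeries (fun n => (a n : ℂ)) (σ + t * I)‖
  set A2 := ‖LSeries (fun n => (a n : ℂ)) (σ + 2 * t * I)‖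
  have hA0 : 0 ≤ A0 := norm_nonneg _
  have hA1 : 0 ≤ A1 := norm_nonneg _
  have hA2 : 0 ≤ A2 := norm_nonneg _
  have y0 : A0 * (σ - 1) ≤ Q ^ 7 := by
    calc A0 * (σ - 1) ≤ A0 * ‖(σ : ℂ) - 1‖ := by gcongr
      _ ≤ _ := z0
      _ ≤ Q ^ 6 * Q := by gcongr
      _ = _ := by ring
  have y2 : A2 * |t| ≤ Q ^ 7 := by
    calc A2 * |t| ≤ A2 * ‖(σ : ℂ) + 2 * t * I - 1‖ := by gcongr
      _ ≤ _ := z2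
      _ ≤ Q ^ 6 * Q := by gcongr
      _ = _ := by ring
  have y1 : A1 * |t| ≤ ‖reg a r c (σ + t * I)‖ * Q :=
    (mul_le_mul_of_nonneg_left d1 hA1).trans z1
  have hσ0 : 0 ≤ σ - 1 := by linarith
  calc (σ - 1) ^ 3 * |t| ^ 5 ≤ (σ - 1) ^ 3 * |t| ^ 5 * (A0 ^ 3 * A1 ^ 4 * A2) :=
        le_mul_of_one_le_right (by positivity) key
    _ = (A0 * (σ - 1)) ^ 3 * (A1 * |t|) ^ 4 * (A2 * |t|) := by ring
    _ ≤ (Q ^ 7) ^ 3 * (‖reg a r c (σ + t * I)‖ * Q) ^ 4 * Q ^ 7 := by gcongr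
    _ = _ := by ring

end RieszRegular

end

section
open Complex MeasureTheory Set Filter Topology Asymptotics

namespace RieszRegular
variable {a L : ℕ → ℝ} {r : ℕ} {c Q : ℝ}

theorem norm_sub_one_le {σ t : ℝ} (hσ : 1 ≤ σ) (hσ2 : σ ≤ 2) (ht : |t| ≤ 2) :
    ‖(σ : ℂ) + t * I - 1‖ ≤ 3 := by
  have : (σ : ℂ) + t * I - 1 = ((σ - 1 : ℝ) : ℂ) + t * I := by push_cast; ring
  rw [this]
  refine (norm_add_le _ _).trans ?_
  rw [norm_real, norm_mul, norm_real, norm_I, mul_one, Real.norm_eq_abs, Real.norm_eq_abs,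
    abs_of_nonneg (by linarith)]
  linarith

theorem le_norm_reg (h : RieszRegular a L r c Q) {σ t : ℝ} (hσ : 1 < σ)
    (hσ2 : σ ≤ 1 + (Q ^ 102)⁻¹) (ht : |t| ≤ 2) :
    (Q ^ 93)⁻¹ ≤ ‖reg a r c (σ + t * I)‖ := by
  have hQ := h.two_le
  have hQ0 : 0 < Q := by linarith
  have hp : ∀ k : ℕ, 0 < Q ^ k := fun k => by positivity
  have hinv : ∀ {i j : ℕ}, i ≤ j → (Q ^ j)⁻¹ ≤ (Q ^ i)⁻¹ := fun hij =>
    inv_anti₀ (hp _) (pow_le_pow_right₀ (by linarith) hij)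
  have hsucc : ∀ k : ℕ, 2 * (Q ^ (k + 1))⁻¹ ≤ (Q ^ k)⁻¹ := fun k => by
    rw [pow_succ, mul_inv]
    have : Q⁻¹ ≤ 1 / 2 := by rw [inv_le_comm₀ hQ0 (by norm_num)]; norm_num; exact hQ
    have := mul_le_mul_of_nonneg_left this (inv_nonneg.mpr (hp k).le)
    linarith
  have h1 : (Q ^ 0)⁻¹ = (1 : ℝ) := by simp
  have hσ3 : σ ≤ 2 := by have := hinv (Nat.zero_le 102); linarith
  by_cases hsmall : |t| ≤ (Q ^ 6)⁻¹
  · have hn : ‖(σ : ℂ) + t * I - 1‖ ≤ (Q ^ 5)⁻¹ := by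
      have : (σ : ℂ) + t * I - 1 = ((σ - 1 : ℝ) : ℂ) + t * I := by push_cast; ring
      rw [this]
      refine (norm_add_le _ _).trans ?_
      rw [norm_real, norm_mul, norm_real, norm_I, mul_one, Real.norm_eq_abs, Real.norm_eq_abs,
        abs_of_nonneg (by linarith)]
      have := hsucc 5
      have := hinv (show 6 ≤ 102 by norm_num)
      linarith
    have he := h.norm_err_le (s := (σ : ℂ) + t * I) (by
      have : 0 < Q⁻¹ * 2⁻¹ := by positivity
      simp; linarith)
    have hc : 1 / Q ≤ ‖(c : ℂ)‖ := by
      rw [norm_real]; exact h.inv_le.trans (le_abs_self c)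
    have h2 : ‖(c : ℂ)‖ ≤ ‖reg a r c (σ + t * I)‖ + (Q ^ 5)⁻¹ * (2 * Q ^ 2) := by
      have : (c : ℂ) = reg a r c (σ + t * I) - ((σ : ℂ) + t * I - 1) * err a r c (σ + t * I) := by
        unfold reg; ring
      calc ‖(c : ℂ)‖ ≤ ‖reg a r c (σ + t * I)‖ +
            ‖((σ : ℂ) + t * I - 1) * err a r c (σ + t * I)‖ := by
            conv_lhs => rw [this]
            exact norm_sub_le _ _
        _ ≤ _ := by rw [norm_mul]; gcongr
    have h3 : (Q ^ 5)⁻¹ * (2 * Q ^ 2) = 2 * (Q ^ 3)⁻¹ := by field_simp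
    have h4 : 1 / Q = (Q ^ 1)⁻¹ := by simp
    have h5 := hsucc 1
    have h6 := hsucc 2
    have h7 := hinv (show 2 ≤ 93 by norm_num)
    norm_num at h5 h6
    have h8 := hsucc 2
    have h9 : 2 * (Q ^ 3)⁻¹ ≤ (Q ^ 2)⁻¹ := h8
    have h10 : 2 * (Q ^ 2)⁻¹ ≤ (Q ^ 1)⁻¹ := hsucc 1
    linarith
  · push Not at hsmall
    set σ₀ := 1 + (Q ^ 102)⁻¹ with hσ₀
    have hσ₀1 : 1 < σ₀ := by have := inv_pos.mpr (hp 102); linarith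
    have hσ₀2 : σ₀ ≤ 2 := by have := hinv (Nat.zero_le 102); linarith
    have hpow := h.norm_reg_pow_ge hσ₀1 hσ₀2 ht
    have hB0 : (Q ^ 92)⁻¹ ≤ ‖reg a r c (σ₀ + t * I)‖ := by
      refine le_of_pow_le_pow_left₀ (n := 4) (by norm_num) (norm_nonneg _) ?_
      have e1 : (σ₀ - 1) ^ 3 * ((Q ^ 6)⁻¹) ^ 5 ≤ (σ₀ - 1) ^ 3 * |t| ^ 5 := by
        have : 0 ≤ σ₀ - 1 := by linarith
        gcongr
      have e2 : σ₀ - 1 = (Q ^ 102)⁻¹ := by rw [hσ₀, add_sub_cancel_left]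
      have e3 := e1.trans hpow
      rw [e2] at e3
      have e4 : ((Q ^ 92)⁻¹) ^ 4 = (Q ^ 32)⁻¹ * (((Q ^ 102)⁻¹) ^ 3 * ((Q ^ 6)⁻¹) ^ 5) := by
        simp only [← inv_pow, ← pow_mul, ← pow_add]
      rw [e4, inv_mul_le_iff₀ (hp 32)]
      exact e3
    have hconv : Convex ℝ ({s : ℂ | 1 ≤ s.re} ∩ Metric.closedBall 1 6) :=
      (convex_halfSpace_re_ge 1).inter (convex_closedBall _ _)
    have hmv := hconv.norm_image_sub_le_of_norm_deriv_le (𝕜 := ℂ) (f := reg a r c) (C := Q ^ 9)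
      (x := (σ₀ : ℂ) + t * I) (y := (σ : ℂ) + t * I) ?_ ?_ ?_ ?_
    · have e1 : (σ : ℂ) + t * I - (σ₀ + t * I) = ((σ - σ₀ : ℝ) : ℂ) := by push_cast; ring
      rw [e1, norm_real, Real.norm_eq_abs] at hmv
      have e2 : |σ - σ₀| ≤ (Q ^ 102)⁻¹ := by
        rw [abs_le]
        constructor <;> linarith [inv_pos.mpr (hp 102)]
      have e3 : Q ^ 9 * (Q ^ 102)⁻¹ = (Q ^ 93)⁻¹ := by field_simp
      have e4 := mul_le_mul_of_nonneg_left e2 (hp 9).le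
      have e5 := norm_sub_norm_le (reg a r c (σ₀ + t * I)) (reg a r c (σ + t * I))
      rw [norm_sub_rev] at e5
      have e6 := hsucc 92
      norm_num at e6
      linarith
    · intro s hs
      have : 0 < 1 / Q := by positivity
      exact h.differentiableAt_reg (by have := hs.1; simp only [mem_ofPred_eq] at this; linarith)
    · intro s hs
      refine h.norm_deriv_reg_le ?_ (by simpa [dist_eq_norm] using hs.2)
      have : 0 < 1 / (4 * Q) := by positivity
      have h := hs.1
      simp only [mem_ofPred_eq] at h
      linarith
    · refine ⟨by simpa using hσ₀1.le, ?_⟩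
      rw [mem_closedBall_iff_norm]
      linarith [norm_sub_one_le hσ₀1.le hσ₀2 ht]
    · refine ⟨by simpa using hσ.le, ?_⟩
      rw [mem_closedBall_iff_norm]
      linarith [norm_sub_one_le hσ.le hσ3 ht]

noncomputable def rem (a : ℕ → ℝ) (r : ℕ) (c : ℝ) (s : ℂ) : ℂ :=
  -(deriv (reg a r c) s / reg a r c s) - (r + 1) / s

theorem reg_ne_zero (h : RieszRegular a L r c Q) {s : ℂ} (hs : 1 < s.re) :
    reg a r c s ≠ 0 := by
  have hs1 : s - 1 ≠ 0 := by
    intro h0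
    rw [sub_eq_zero] at h0
    simp [h0] at hs
  intro h0
  have := h.series_mul_eq hs
  rw [h0, zero_mul] at this
  exact mul_ne_zero (h.series_ne_zero hs)
    (mul_ne_zero (by exact_mod_cast r.factorial_ne_zero) hs1) this

theorem log_series_eq (h : RieszRegular a L r c Q) {s : ℂ} (hs : 1 < s.re) :
    LSeries (fun n => (L n : ℂ)) s = 1 / (s - 1) + rem a r c s := by
  have hQ := h.two_le
  have hQ0 : 0 < 1 / Q := by positivity
  have hs0 : s ≠ 0 := by rintro rfl; simp at hs; linarith
  have hs1 : s - 1 ≠ 0 := by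
    intro h0
    rw [sub_eq_zero] at h0
    simp [h0] at hs
  have hR := h.reg_ne_zero hs
  have hZ := h.series_ne_zero hs
  have hf : (r.factorial : ℂ) ≠ 0 := by exact_mod_cast r.factorial_ne_zero
  have d1 : HasDerivAt (fun s => LSeries (fun n => (a n : ℂ)) s * (r.factorial * (s - 1))) _ s :=
    (h.hasDerivAt_series hs).mul (((hasDerivAt_id s).sub_const 1).const_mul (r.factorial : ℂ))
  have d2 : HasDerivAt (fun s => reg a r c s * s ^ (r + 1)) _ s :=
    (h.differentiableAt_reg (by linarith)).hasDerivAt.mul (hasDerivAt_pow (r + 1) s)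
  have heq : (fun s => LSeries (fun n => (a n : ℂ)) s * (r.factorial * (s - 1))) =ᶠ[𝓝 s]
      fun s => reg a r c s * s ^ (r + 1) := by
    filter_upwards [(isOpen_lt continuous_const continuous_re).mem_nhds hs] with z hz
    exact h.series_mul_eq hz
  have e := d1.unique (d2.congr_of_eventuallyEq heq)
  have e0 := h.series_mul_eq hs
  simp only [mul_one, Nat.add_sub_cancel, Nat.cast_add, Nat.cast_one] at e
  unfold rem
  set Z := LSeries (fun n => (a n : ℂ)) s
  set B := reg a r c s
  set B' := deriv (reg a r c) s
  set Λ := LSeries (fun n => (L n : ℂ)) s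
  have hpw : s ^ (r + 1) ≠ 0 := pow_ne_zero _ hs0
  have hZB : Z = B * s ^ (r + 1) / (r.factorial * (s - 1)) := by
    field_simp
    linear_combination e0
  rw [hZB] at e
  have hpw' : s ^ (r + 1) = s ^ r * s := pow_succ s r
  have hsr : s ^ r ≠ 0 := pow_ne_zero _ hs0
  rw [hpw'] at e
  field_simp at e
  field_simp
  linear_combination -e

theorem norm_rem_le (h : RieszRegular a L r c Q) {σ t : ℝ} (hσ : 1 < σ)
    (hσ2 : σ ≤ 1 + (Q ^ 102)⁻¹) (ht : |t| ≤ 2) :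
    ‖rem a r c (σ + t * I)‖ ≤ Q ^ 210 ∧
    ∃ d, HasDerivAt (rem a r c) d (σ + t * I) ∧ ‖d‖ ≤ Q ^ 210 := by
  have hQ := h.two_le
  have hQ0 : 0 < Q := by linarith
  have hp : ∀ k : ℕ, 0 < Q ^ k := fun k => by positivity
  have hσ3 : σ ≤ 2 := by
    have : (Q ^ 102)⁻¹ ≤ 1 := inv_le_one_of_one_le₀ (one_le_pow₀ (by linarith))
    linarith
  have hB := h.le_norm_reg hσ hσ2 ht
  have hn := norm_sub_one_le hσ.le hσ3 ht
  have hre : 1 < ((σ : ℂ) + t * I).re := by simpa using hσ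
  set s := (σ : ℂ) + t * I
  have hq1 : 0 < 1 / Q := by positivity
  have hq4 : 0 < 1 / (4 * Q) := by positivity
  have hB1 := h.norm_deriv_reg_le (s := s) (by linarith) (by linarith)
  have hB2 := h.norm_deriv_deriv_reg_le (s := s) (by linarith) (by linarith)
  have hs1 : 1 ≤ ‖s‖ := hre.le.trans ((le_abs_self _).trans (Complex.abs_re_le_norm s))
  have hs0 : s ≠ 0 := by intro h0; rw [h0, norm_zero] at hs1; linarith
  have hR := h.reg_ne_zero hre
  have hr : ‖(r : ℂ) + 1‖ ≤ Q := by
    have : (r : ℝ) + 1 ≤ 5 ^ (r + 1) := by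
      exact_mod_cast (Nat.lt_pow_self (n := r + 1) (by norm_num : 1 < 5)).le
    have e : (r : ℂ) + 1 = ((r + 1 : ℝ) : ℂ) := by push_cast; ring
    rw [e, norm_real, Real.norm_of_nonneg (by positivity)]
    exact this.trans h.pow_le
  have hquot : ∀ (z : ℂ) (k : ℕ), ‖z‖ ≤ Q ^ k → ‖z / reg a r c s‖ ≤ Q ^ (k + 93) := by
    intro z k hz
    rw [norm_div, div_le_iff₀ (norm_pos_iff.mpr hR), pow_add]
    rw [inv_le_iff_one_le_mul₀ (hp 93)] at hB
    calc ‖z‖ ≤ Q ^ k := hz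
      _ ≤ Q ^ k * (Q ^ 93 * ‖reg a r c s‖) := le_mul_of_one_le_right (hp k).le (by linarith)
      _ = _ := by ring
  have hdiv : ∀ z : ℂ, ‖z / s‖ ≤ ‖z‖ := fun z => by
    rw [norm_div]; exact div_le_self (norm_nonneg _) hs1
  have hmono : ∀ {i j : ℕ}, i ≤ j → Q ^ i ≤ Q ^ j := fun hij =>
    pow_le_pow_right₀ (by linarith) hij
  have htwo : ∀ k : ℕ, 2 * Q ^ k ≤ Q ^ (k + 1) := fun k => by
    rw [pow_succ]; nlinarith [hp k]
  refine ⟨?_, ?_⟩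
  · calc ‖rem a r c s‖ ≤ ‖deriv (reg a r c) s / reg a r c s‖ + ‖((r : ℂ) + 1) / s‖ := by
          unfold rem
          refine (norm_sub_le _ _).trans ?_
          rw [norm_neg]
      _ ≤ Q ^ (9 + 93) + Q ^ 1 := by
          gcongr
          · exact hquot _ _ hB1
          · rw [pow_one]; exact (hdiv _).trans hr
      _ ≤ Q ^ 210 := by
          have := hmono (show 1 ≤ 102 by norm_num)
          have := htwo 102
          have := hmono (show 102 + 1 ≤ 210 by norm_num)
          norm_num at *
          linarith
  · have d1 := (h.differentiableAt_deriv_reg (s := s) (by linarith)).hasDerivAt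
    have d0 := (h.differentiableAt_reg (s := s) (by linarith)).hasDerivAt
    have d2 := (d1.div d0 hR).neg.sub ((hasDerivAt_inv hs0).const_mul ((r : ℂ) + 1))
    refine ⟨_, d2, ?_⟩
    have e : -((deriv (deriv (reg a r c)) s * reg a r c s - deriv (reg a r c) s * deriv (reg a r c) s)
        / reg a r c s ^ 2) - ((r : ℂ) + 1) * -(s ^ 2)⁻¹ =
        -(deriv (deriv (reg a r c)) s / reg a r c s) +
        (deriv (reg a r c) s / reg a r c s) ^ 2 + ((r : ℂ) + 1) / s / s := by
      field_simp
      ring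
    rw [e]
    calc _ ≤ ‖deriv (deriv (reg a r c)) s / reg a r c s‖ +
          ‖deriv (reg a r c) s / reg a r c s‖ ^ 2 + ‖((r : ℂ) + 1) / s / s‖ := by
          refine (norm_add_le _ _).trans ?_
          gcongr
          refine (norm_add_le _ _).trans ?_
          rw [norm_neg, norm_pow]
      _ ≤ Q ^ (12 + 93) + (Q ^ (9 + 93)) ^ 2 + Q ^ 1 := by
          gcongr
          · exact hquot _ _ hB2
          · exact hquot _ _ hB1
          · rw [pow_one]; exact (hdiv _).trans ((hdiv _).trans hr)
      _ ≤ Q ^ 210 := by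
          rw [← pow_mul]
          have h1 := hmono (show 1 ≤ 204 by norm_num)
          have h2 := hmono (show 105 ≤ 204 by norm_num)
          have h3 := htwo 204
          have h4 := htwo 205
          have h5 := hmono (show 206 ≤ 210 by norm_num)
          norm_num at h1 h2 h3 h4 h5 ⊢
          linarith [hp 204]

end RieszRegular

end

section
open Complex MeasureTheory Set Filter Topology Asymptotics

/-- The Fejér kernel `2 (sin v / v)^2`. -/
noncomputable def fejer (v : ℝ) : ℝ := 2 * Real.sinc v ^ 2

theorem fejer_nonneg (v : ℝ) : 0 ≤ fejer v := by unfold fejer; positivity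

theorem continuous_fejer : Continuous fejer := by
  unfold fejer; exact (Real.continuous_sinc.pow 2).const_mul 2

theorem fejer_le_two (v : ℝ) : fejer v ≤ 2 := by
  unfold fejer
  have := (sq_le_one_iff_abs_le_one _).mpr (Real.abs_sinc_le_one v)
  linarith

theorem integral_fejer_cos (v : ℝ) :
    2 * ∫ t in (0 : ℝ)..2, (1 - t / 2) * Real.cos (t * v) = fejer v := by
  unfold fejer
  rcases eq_or_ne v 0 with rfl | hv
  · have : ∀ t : ℝ, (1 - t / 2) * Real.cos (t * 0) = 1 - t / 2 := fun t => by simp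
    simp_rw [this]
    rw [intervalIntegral.integral_sub (by simp) (by apply Continuous.intervalIntegrable; fun_prop)]
    simp
    norm_num
  · have hd : ∀ t ∈ uIcc (0 : ℝ) 2,
        HasDerivAt (fun t => (1 - t / 2) * Real.sin (t * v) / v - Real.cos (t * v) / (2 * v ^ 2))
        ((1 - t / 2) * Real.cos (t * v)) t := by
      intro t _
      have h1 : HasDerivAt (fun t : ℝ => t * v) v t := by
        simpa using (hasDerivAt_id t).mul_const v
      have h2 : HasDerivAt (fun t : ℝ => 1 - t / 2) (-(1 / 2)) t := by
        simpa using ((hasDerivAt_id t).div_const 2).const_sub 1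
      refine (((h2.mul h1.sin).div_const v).sub (h1.cos.div_const (2 * v ^ 2))).congr_deriv ?_
      field_simp
      ring
    rw [intervalIntegral.integral_eq_sub_of_hasDerivAt hd
      (by apply Continuous.intervalIntegrable; fun_prop), Real.sinc_of_ne_zero hv]
    rw [ Real.cos_two_mul, div_pow, Real.sin_sq]
    simp
    field_simp
    ring

theorem fejer_bound (v : ℝ) : fejer v ≤ 4 / (1 + v ^ 2) := by
  rw [le_div_iff₀ (by positivity)]
  have h1 := fejer_le_two v
  have h2 : fejer v * v ^ 2 ≤ 2 := by
    unfold fejer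
    rcases eq_or_ne v 0 with rfl | hv
    · simp
    · rw [Real.sinc_of_ne_zero hv]
      field_simp
      nlinarith [Real.sin_sq_le_one v]
  linarith

namespace RieszRegular
variable {a L : ℕ → ℝ} {r : ℕ} {c Q : ℝ}

theorem differentiableOn_rem (h : RieszRegular a L r c Q) :
    DifferentiableOn ℂ (rem a r c) {s | 1 < s.re} := by
  intro s hs
  have hs : 1 < s.re := hs
  have hQ := h.two_le
  have hq1 : 0 < 1 / Q := by positivity
  have hs0 : s ≠ 0 := by rintro rfl; simp at hs; linarith
  have d1 := h.differentiableAt_deriv_reg (s := s) (by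
    have : 0 < 1 / (4 * Q) := by positivity
    linarith)
  have d0 := h.differentiableAt_reg (s := s) (by linarith)
  unfold rem
  exact (((d1.div d0 (h.reg_ne_zero hs)).neg).sub
    ((differentiableAt_const _).div differentiableAt_id hs0)).differentiableWithinAt

/-- The weight `(1 - t / 2) e^{i t y}` of the Fejér kernel. -/
noncomputable def wt (y t : ℝ) : ℂ := ((1 - t / 2 : ℝ) : ℂ) * cexp (((t * y : ℝ) : ℂ) * I)

theorem continuous_wt (y : ℝ) : Continuous (wt y) := by
  unfold wt; fun_prop

theorem wt_re (y t : ℝ) : (wt y t).re = (1 - t / 2) * Real.cos (t * y) := by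
  rw [wt, re_ofReal_mul, exp_ofReal_mul_I_re]

theorem norm_wt_le {y t : ℝ} (h0 : 0 ≤ t) (h2 : t ≤ 2) : ‖wt y t‖ ≤ 1 := by
  rw [wt, norm_mul, norm_exp_ofReal_mul_I, mul_one, norm_real, Real.norm_eq_abs, abs_le]
  constructor <;> linarith

theorem integral_wt_re (y : ℝ) : 2 * (∫ t in (0 : ℝ)..2, wt y t).re = fejer y := by
  rw [← integral_fejer_cos]
  congr 1
  have h := (reCLM.intervalIntegral_comp_comm (a := 0) (b := 2) (μ := volume)
    ((continuous_wt y).intervalIntegrable 0 2))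
  simp only [reCLM_apply] at h
  rw [← h]
  exact intervalIntegral.integral_congr fun t _ => wt_re y t

theorem wt_mul_exp (y z t : ℝ) : wt y t * cexp (((-(t * z) : ℝ) : ℂ) * I) = wt (y - z) t := by
  unfold wt
  rw [mul_assoc, ← Complex.exp_add]
  congr 2
  push_cast
  ring

theorem term_eq (L : ℕ → ℝ) {σ : ℝ} (hσ : 1 < σ) (t : ℝ) (m : ℕ) :
    LSeries.term (fun n => (L n : ℂ)) (σ + t * I) m =
      ((L m * (m : ℝ) ^ (-σ) : ℝ) : ℂ) * cexp (((-(t * Real.log m) : ℝ) : ℂ) * I) := by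
  rcases eq_or_ne m 0 with rfl | hm
  · simp [Real.zero_rpow (show -σ ≠ 0 by linarith)]
  · exact LSeries_term_ofReal L σ t hm

theorem summable_weights (h : RieszRegular a L r c Q) {σ : ℝ} (hσ : 1 < σ) :
    Summable fun m : ℕ => L m * (m : ℝ) ^ (-σ) := by
  have h1 := (h.summable_log (s := ((σ : ℂ) + (0 : ℝ) * I)) (by simpa using hσ))
  have := Complex.hasSum_re h1.hasSum
  refine this.summable.congr fun m => ?_
  rw [term_eq L hσ]
  simp

theorem weights_nonneg (h : RieszRegular a L r c Q) (σ : ℝ) (m : ℕ) :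
    0 ≤ L m * (m : ℝ) ^ (-σ) :=
  mul_nonneg (h.log_nonneg m) (Real.rpow_nonneg (Nat.cast_nonneg m) _)

theorem hasSum_integral_wt (h : RieszRegular a L r c Q) {σ lam : ℝ} (hσ : 1 < σ) (u : ℝ) :
    HasSum (fun m : ℕ => ((L m * (m : ℝ) ^ (-σ) : ℝ) : ℂ) *
        ∫ t in (0 : ℝ)..2, wt ((u - Real.log m) / lam) t)
      (∫ t in (0 : ℝ)..2, wt (u / lam) t * LSeries (fun n => (L n : ℂ)) (σ + (t / lam : ℝ) * I)) := by
  simp_rw [← intervalIntegral.integral_const_mul]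
  have hterm : ∀ (m : ℕ) (t : ℝ), ((L m * (m : ℝ) ^ (-σ) : ℝ) : ℂ) * wt ((u - Real.log m) / lam) t =
      wt (u / lam) t * LSeries.term (fun n => (L n : ℂ)) (σ + (t / lam : ℝ) * I) m := by
    intro m t
    rw [term_eq L hσ, mul_left_comm, sub_div, ← wt_mul_exp]
    congr 5
    ring
  refine intervalIntegral.hasSum_integral_of_dominated_convergence
    (fun m _ => L m * (m : ℝ) ^ (-σ)) (fun m => ?_) (fun m => ?_) ?_ ?_ ?_
  · exact ((continuous_wt _).const_mul _).aestronglyMeasurable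
  · refine Eventually.of_forall fun t ht => ?_
    rw [uIoc_of_le (by norm_num)] at ht
    rw [norm_mul, norm_real, Real.norm_of_nonneg (h.weights_nonneg σ m)]
    exact mul_le_of_le_one_right (h.weights_nonneg σ m) (norm_wt_le ht.1.le ht.2)
  · exact Eventually.of_forall fun t _ => h.summable_weights hσ
  · simp
  · refine Eventually.of_forall fun t _ => ?_
    simp_rw [hterm]
    exact (h.summable_log (by simpa using hσ)).hasSum.mul_left _

theorem integral_exp_neg_complex {s : ℂ} (hs : 0 < s.re) :
    ∫ v in Ioi (0 : ℝ), cexp (-(s * v)) = 1 / s := by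
  have := integral_exp_mul_complex_Ioi (a := -s) (by simpa using hs) 0
  simp only [neg_mul] at this
  rw [this]
  simp

theorem integral_wt_div {σ lam : ℝ} (hσ : 1 < σ) (u : ℝ) :
    ∫ t in (0 : ℝ)..2, wt (u / lam) t * (1 / ((σ : ℂ) + (t / lam : ℝ) * I - 1)) =
      ∫ v in Ioi (0 : ℝ), ((Real.exp (-((σ - 1) * v)) : ℝ) : ℂ) *
        ∫ t in (0 : ℝ)..2, wt ((u - v) / lam) t := by
  have hre : ∀ t : ℝ, 0 < ((σ : ℂ) + (t / lam : ℝ) * I - 1).re := fun t => by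
    simp; linarith
  have hker : ∀ t v : ℝ, wt (u / lam) t * cexp (-(((σ : ℂ) + (t / lam : ℝ) * I - 1) * v)) =
      ((Real.exp (-((σ - 1) * v)) : ℝ) : ℂ) * wt ((u - v) / lam) t := by
    intro t v
    rw [sub_div, ← wt_mul_exp, mul_left_comm, ofReal_exp, ← Complex.exp_add]
    congr 2
    push_cast; ring
  have e1 : ∀ t : ℝ, wt (u / lam) t * (1 / ((σ : ℂ) + (t / lam : ℝ) * I - 1)) =
      ∫ v in Ioi (0 : ℝ), ((Real.exp (-((σ - 1) * v)) : ℝ) : ℂ) * wt ((u - v) / lam) t := by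
    intro t
    rw [← integral_exp_neg_complex (hre t), ← integral_const_mul]
    simp_rw [hker]
  simp_rw [e1]
  simp_rw [← intervalIntegral.integral_const_mul,
    intervalIntegral.integral_of_le (show (0 : ℝ) ≤ 2 by norm_num)]
  rw [integral_integral_swap]
  have hi : Integrable (fun p : ℝ × ℝ => (1 : ℝ) * Real.exp (-((σ - 1) * p.2)))
      ((volume.restrict (Ioc (0 : ℝ) 2)).prod (volume.restrict (Ioi (0 : ℝ)))) := by
    have h0 := integrableOn_pow_mul_exp_neg 0 (ε := σ - 1) (by linarith)
    simp only [pow_zero, one_mul] at h0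
    exact Integrable.mul_prod (f := fun _ : ℝ => (1 : ℝ)) (integrable_const 1) h0
  refine hi.mono' ?_ ?_
  · unfold wt
    apply Continuous.aestronglyMeasurable
    unfold Function.uncurry
    fun_prop
  · rw [Measure.prod_restrict]
    filter_upwards [ae_restrict_mem (measurableSet_Ioc.prod measurableSet_Ioi)] with p hp
    simp only [Function.uncurry]
    rw [norm_mul, norm_real, Real.norm_of_nonneg (Real.exp_pos _).le, mul_comm]
    gcongr
    exact norm_wt_le hp.1.1.le hp.1.2

theorem norm_integral_wt_rem_le (h : RieszRegular a L r c Q) {σ lam u : ℝ} (hσ : 1 < σ)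
    (hσ2 : σ ≤ 1 + (Q ^ 102)⁻¹) (hl : 1 ≤ lam) (hu : 0 < u) :
    ‖∫ t in (0 : ℝ)..2, wt (u / lam) t * rem a r c (σ + (t / lam : ℝ) * I)‖ ≤
      4 * lam * Q ^ 210 / u := by
  have hl0 : 0 < lam := by linarith
  have hQ := h.two_le
  have hQ0 : 0 < Q ^ 210 := by positivity
  have hpath : ∀ t : ℝ, HasDerivAt (fun t : ℝ => (σ : ℂ) + (t / lam : ℝ) * I) ((lam : ℂ)⁻¹ * I) t := by
    intro t
    have : HasDerivAt (fun t : ℝ => ((t / lam : ℝ) : ℂ)) ((lam : ℂ)⁻¹) t := by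
      have := ((hasDerivAt_id t).div_const lam).ofReal_comp
      simpa using this
    exact (this.mul_const I).const_add (σ : ℂ)
  have hre : ∀ t : ℝ, (σ : ℂ) + (t / lam : ℝ) * I ∈ {s : ℂ | 1 < s.re} := fun t => by simpa using hσ
  have hopen : IsOpen {s : ℂ | 1 < s.re} := isOpen_lt continuous_const continuous_re
  set R : ℝ → ℂ := fun t => rem a r c (σ + (t / lam : ℝ) * I) with hR
  have hRd : ∀ t : ℝ, HasDerivAt R (deriv (rem a r c) (σ + (t / lam : ℝ) * I) * ((lam : ℂ)⁻¹ * I)) t :=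
    fun t => HasDerivAt.comp (h₂ := rem a r c) (h := fun t : ℝ => (σ : ℂ) + (t / lam : ℝ) * I) t
      (h.differentiableOn_rem.differentiableAt (hopen.mem_nhds (hre t))).hasDerivAt (hpath t)
  have hcpath : Continuous fun t : ℝ => (σ : ℂ) + (t / lam : ℝ) * I :=
    continuous_iff_continuousAt.mpr fun t => (hpath t).continuousAt
  have hRc : Continuous fun t : ℝ => deriv (rem a r c) (σ + (t / lam : ℝ) * I) :=
    (h.differentiableOn_rem.deriv hopen).continuousOn.comp_continuous hcpath hre
  set E : ℝ → ℂ := fun t => cexp (((t * (u / lam) : ℝ) : ℂ) * I) / ((u / lam : ℝ) * I) with hE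
  have hul : ((u / lam : ℝ) : ℂ) ≠ 0 := by
    have : u / lam ≠ 0 := by positivity
    exact_mod_cast this
  have hEd : ∀ t : ℝ, HasDerivAt E (cexp (((t * (u / lam) : ℝ) : ℂ) * I)) t := by
    intro t
    have h1 : HasDerivAt (fun t : ℝ => ((t * (u / lam) : ℝ) : ℂ) * I) ((u / lam : ℝ) * I) t := by
      have := ((hasDerivAt_id t).mul_const (u / lam)).ofReal_comp
      simpa using this.mul_const I
    refine (h1.cexp.div_const _).congr_deriv ?_
    field_simp [I_ne_zero]
  have hEn : ∀ t, ‖E t‖ = lam / u := by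
    intro t
    rw [hE]
    simp only [norm_div, norm_exp_ofReal_mul_I, norm_mul, norm_I, mul_one, norm_real]
    rw [Real.norm_of_nonneg (by positivity)]
    field_simp
    exact Real.norm_of_nonneg hl0.le
  have hgd : ∀ t : ℝ, HasDerivAt (fun t : ℝ => ((1 - t / 2 : ℝ) : ℂ)) (-(1 / 2)) t := by
    intro t
    have := (((hasDerivAt_id t).div_const 2).const_sub 1).ofReal_comp
    simpa using this
  have hg : ∀ t ∈ Icc (0 : ℝ) 2, ‖((1 - t / 2 : ℝ) : ℂ)‖ ≤ 1 := by
    intro t ht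
    rw [norm_real, Real.norm_eq_abs, abs_le]
    constructor <;> linarith [ht.1, ht.2]
  have hb : ∀ t ∈ Icc (0 : ℝ) 2, ‖R t‖ ≤ Q ^ 210 ∧
      ‖deriv (rem a r c) (σ + (t / lam : ℝ) * I)‖ ≤ Q ^ 210 := by
    intro t ht
    have ht2 : |t / lam| ≤ 2 := by
      rw [abs_of_nonneg (div_nonneg ht.1 hl0.le)]
      exact (div_le_self ht.1 hl).trans ht.2
    obtain ⟨h1, d, hd, h2⟩ := h.norm_rem_le hσ hσ2 ht2
    exact ⟨h1, by rwa [hd.deriv]⟩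
  have ibp := intervalIntegral.integral_mul_deriv_eq_deriv_mul (a := 0) (b := 2)
    (fun t _ => (hgd t).mul (hRd t)) (fun t _ => hEd t)
    (by
      apply Continuous.intervalIntegrable
      have : Continuous R := continuous_iff_continuousAt.mpr fun t => (hRd t).continuousAt
      fun_prop)
    (by apply Continuous.intervalIntegrable; fun_prop)
  have e1 : ∫ t in (0 : ℝ)..2, wt (u / lam) t * R t =
      ∫ t in (0 : ℝ)..2, ((fun t : ℝ => ((1 - t / 2 : ℝ) : ℂ)) * R) t *
        cexp (((t * (u / lam) : ℝ) : ℂ) * I) :=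
    intervalIntegral.integral_congr fun t _ => by simp only [wt, Pi.mul_apply]; ring
  rw [e1, ibp]
  have hint := intervalIntegral.norm_integral_le_of_norm_le_const (a := 0) (b := 2)
    (f := fun t : ℝ => (-(1 / 2) * R t + ((1 - t / 2 : ℝ) : ℂ) *
      (deriv (rem a r c) (σ + (t / lam : ℝ) * I) * ((lam : ℂ)⁻¹ * I))) * E t)
    (C := (1 / 2 * Q ^ 210 + 1 * (Q ^ 210 * 1)) * (lam / u)) (by
      intro t ht
      rw [uIoc_of_le (by norm_num)] at ht
      have ht' : t ∈ Icc (0 : ℝ) 2 := ⟨ht.1.le, ht.2⟩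
      rw [norm_mul, hEn]
      gcongr
      refine (norm_add_le _ _).trans ?_
      rw [norm_mul, norm_mul, norm_mul, norm_mul, norm_I, norm_inv, norm_real lam,
        Real.norm_of_nonneg hl0.le]
      gcongr
      · norm_num
      · exact (hb t ht').1
      · exact hg t ht'
      · exact (hb t ht').2
      · rw [mul_one]; exact inv_le_one_of_one_le₀ hl)
  refine (norm_sub_le _ _).trans ?_
  have h0 : ‖((fun t : ℝ => ((1 - t / 2 : ℝ) : ℂ)) * R) 2 * E 2 -
      ((fun t : ℝ => ((1 - t / 2 : ℝ) : ℂ)) * R) 0 * E 0‖ ≤ Q ^ 210 * (lam / u) := by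
    have : ((fun t : ℝ => ((1 - t / 2 : ℝ) : ℂ)) * R) 2 * E 2 -
      ((fun t : ℝ => ((1 - t / 2 : ℝ) : ℂ)) * R) 0 * E 0 = -(R 0 * E 0) := by
      simp
    rw [this, norm_neg, norm_mul, hEn]
    gcongr
    exact (hb 0 (by norm_num)).1
  refine (add_le_add h0 hint).trans (le_of_eq ?_)
  norm_num
  field_simp
  ring

theorem sum_fejer_eq (h : RieszRegular a L r c Q) {σ lam u : ℝ} (hσ : 1 < σ)
    (hσ2 : σ ≤ 1 + (Q ^ 102)⁻¹) (hl : 1 ≤ lam) (hu : 0 < u) :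
    Summable (fun m : ℕ => L m * (m : ℝ) ^ (-σ) * fejer ((u - Real.log m) / lam)) ∧
    |∑' m : ℕ, L m * (m : ℝ) ^ (-σ) * fejer ((u - Real.log m) / lam) -
      ∫ v in Ioi (0 : ℝ), Real.exp (-((σ - 1) * v)) * fejer ((u - v) / lam)| ≤
      8 * lam * Q ^ 210 / u := by
  have hs := h.hasSum_integral_wt (lam := lam) hσ u
  have hsr := (Complex.hasSum_re hs).mul_left 2
  have hterm : ∀ m : ℕ, 2 * ((((L m * (m : ℝ) ^ (-σ) : ℝ) : ℂ) *
        ∫ t in (0 : ℝ)..2, wt ((u - Real.log m) / lam) t)).re =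
      L m * (m : ℝ) ^ (-σ) * fejer ((u - Real.log m) / lam) := fun m => by
    rw [re_ofReal_mul, ← integral_wt_re]; ring
  simp_rw [hterm] at hsr
  refine ⟨hsr.summable, ?_⟩
  rw [hsr.tsum_eq]
  have hre : ∀ t : ℝ, 1 < ((σ : ℂ) + (t / lam : ℝ) * I).re := fun t => by simpa using hσ
  have hcp : Continuous fun t : ℝ => (σ : ℂ) + (t / lam : ℝ) * I := by fun_prop
  have hsplit : ∫ t in (0 : ℝ)..2, wt (u / lam) t * LSeries (fun n => (L n : ℂ)) (σ + (t / lam : ℝ) * I)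
      = (∫ t in (0 : ℝ)..2, wt (u / lam) t * (1 / ((σ : ℂ) + (t / lam : ℝ) * I - 1))) +
        ∫ t in (0 : ℝ)..2, wt (u / lam) t * rem a r c (σ + (t / lam : ℝ) * I) := by
    rw [← intervalIntegral.integral_add]
    · refine intervalIntegral.integral_congr fun t _ => ?_
      rw [h.log_series_eq (hre t), mul_add]
    · apply Continuous.intervalIntegrable
      refine (continuous_wt _).mul (continuous_const.div (by fun_prop) fun t h0 => ?_)
      have := hre t
      rw [sub_eq_zero] at h0
      rw [h0, one_re] at this
      exact lt_irrefl _ this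
    · apply Continuous.intervalIntegrable
      exact (continuous_wt _).mul (h.differentiableOn_rem.continuousOn.comp_continuous hcp hre)
  have hmain : 2 * (∫ t in (0 : ℝ)..2, wt (u / lam) t * (1 / ((σ : ℂ) + (t / lam : ℝ) * I - 1))).re =
      ∫ v in Ioi (0 : ℝ), Real.exp (-((σ - 1) * v)) * fejer ((u - v) / lam) := by
    rw [integral_wt_div hσ]
    have hint : IntegrableOn (fun v : ℝ => ((Real.exp (-((σ - 1) * v)) : ℝ) : ℂ) *
        ∫ t in (0 : ℝ)..2, wt ((u - v) / lam) t) (Ioi 0) := by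
      have h0 := (integrableOn_pow_mul_exp_neg 0 (ε := σ - 1) (by linarith)).const_mul 2
      simp only [pow_zero, one_mul] at h0
      refine h0.mono' ?_ (Eventually.of_forall fun v => ?_)
      · apply Continuous.aestronglyMeasurable
        refine Continuous.mul (by fun_prop) ?_
        apply intervalIntegral.continuous_parametric_intervalIntegral_of_continuous'
        unfold wt Function.uncurry
        fun_prop
      · rw [norm_mul, norm_real, Real.norm_of_nonneg (Real.exp_pos _).le, mul_comm]
        gcongr
        refine (intervalIntegral.norm_integral_le_of_norm_le_const (C := 1) fun t ht => ?_).trans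
          (by norm_num)
        rw [uIoc_of_le (by norm_num)] at ht
        exact norm_wt_le ht.1.le ht.2
    rw [← reCLM_apply, ← reCLM.integral_comp_comm hint, ← integral_const_mul]
    refine integral_congr_ae (Eventually.of_forall fun v => ?_)
    simp only [reCLM_apply]
    rw [re_ofReal_mul, ← integral_wt_re]
    ring
  rw [hsplit, add_re, mul_add, hmain, add_sub_cancel_left, abs_mul, abs_two]
  have := (Complex.abs_re_le_norm _).trans (h.norm_integral_wt_rem_le hσ hσ2 hl hu)
  refine (mul_le_mul_of_nonneg_left this (by norm_num)).trans (le_of_eq (by ring))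

end RieszRegular

end

section
open Complex MeasureTheory Set Filter Topology Asymptotics

theorem fejer_tail {B v : ℝ} (hB : 0 < B) (hv : B ≤ |v|) :
    fejer v ≤ (fejer (v / B) + 7 * fejer (v / B + Real.pi / 2)) / B ^ 2 := by
  have hv0 : v ≠ 0 := by rintro rfl; simp at hv; linarith
  set y := v / B with hy
  have hvy : v = B * y := by rw [hy]; field_simp
  have hy1 : 1 ≤ |y| := by rw [hy, abs_div, abs_of_pos hB, le_div_iff₀ hB]; linarith
  have hy0 : y ≠ 0 := by intro h; rw [h, mul_zero] at hvy; exact hv0 hvy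
  have hpi := Real.pi_le_four
  have hpi3 := Real.pi_gt_three
  have hpi' : Real.pi < 3.15 := Real.pi_lt_d2
  have h1 : fejer v ≤ 2 / y ^ 2 / B ^ 2 := by
    unfold fejer
    rw [Real.sinc_of_ne_zero hv0, hvy]
    rw [div_pow, mul_pow, ← mul_div_assoc, div_div, mul_comm (y ^ 2)]
    gcongr
    linarith [Real.sin_sq_le_one (B * y)]
  refine h1.trans ?_
  gcongr
  have h2 : fejer y = 2 * Real.sin y ^ 2 / y ^ 2 := by
    unfold fejer; rw [Real.sinc_of_ne_zero hy0, div_pow, mul_div_assoc]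
  have h3 : 2 * Real.cos y ^ 2 / y ^ 2 ≤ 7 * fejer (y + Real.pi / 2) := by
    have hz : |y + Real.pi / 2| ≤ |y| * (1 + 1.575) := by
      refine (abs_add_le _ _).trans ?_
      rw [abs_of_pos (by linarith : 0 < Real.pi / 2)]
      nlinarith
    have hz2 : (y + Real.pi / 2) ^ 2 ≤ 7 * y ^ 2 := by
      have := pow_le_pow_left₀ (abs_nonneg _) hz 2
      rw [mul_pow, sq_abs, sq_abs] at this
      nlinarith [sq_nonneg y]
    have hz0 : 0 < y ^ 2 := by positivity
    unfold fejer
    by_cases h0 : y + Real.pi / 2 = 0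
    · have : y = -(Real.pi / 2) := by linarith
      rw [h0, Real.sinc_zero, this, Real.cos_neg, Real.cos_pi_div_two]
      simp
    · clear_value y
      rw [Real.sinc_of_ne_zero h0, Real.sin_add_pi_div_two, div_pow (Real.cos y)]
      have : 0 < (y + Real.pi / 2) ^ 2 := by positivity
      rw [← mul_div_assoc, ← mul_div_assoc, div_le_div_iff₀ hz0 this]
      nlinarith [sq_nonneg (Real.cos y)]
  have h4 : 2 / y ^ 2 = 2 * Real.sin y ^ 2 / y ^ 2 + 2 * Real.cos y ^ 2 / y ^ 2 := by
    rw [← add_div]; congr 1; linarith [Real.sin_sq_add_cos_sq y]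
  rw [h4, h2]
  linarith

theorem fejer_ge {v : ℝ} (h0 : 0 ≤ v) (h1 : v ≤ 1) : 9 / 8 ≤ fejer v := by
  unfold fejer
  have : 3 / 4 ≤ Real.sinc v := by
    rcases h0.eq_or_lt with rfl | h
    · norm_num
    · rw [Real.sinc_of_ne_zero h.ne', le_div_iff₀ h]
      have := Real.sin_gt_sub_cube h
      have : v ^ 3 ≤ v := by nlinarith [sq_nonneg v]
      linarith
  nlinarith

theorem integrable_fejer {lam : ℝ} (hl : 0 < lam) (u : ℝ) :
    Integrable (fun v : ℝ => fejer ((u - v) / lam)) ∧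
    ∫ v : ℝ, fejer ((u - v) / lam) ≤ 4 * Real.pi * lam := by
  have hi : Integrable fejer := by
    refine (integrable_inv_one_add_sq.const_mul 4).mono' continuous_fejer.aestronglyMeasurable
      (Eventually.of_forall fun v => ?_)
    rw [Real.norm_of_nonneg (fejer_nonneg v), ← div_eq_mul_inv]
    exact fejer_bound v
  have h1 : ∫ v, fejer v ≤ 4 * Real.pi := by
    rw [← integral_univ_inv_one_add_sq, ← integral_const_mul]
    refine integral_mono hi (integrable_inv_one_add_sq.const_mul 4) fun v => ?_
    simp only
    rw [← div_eq_mul_inv]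
    exact fejer_bound v
  have hd := hi.comp_div hl.ne'
  refine ⟨hd.comp_sub_left u, ?_⟩
  rw [integral_sub_left_eq_self (fun v => fejer (v / lam)) volume u,
    Measure.integral_comp_div, abs_of_pos hl, smul_eq_mul, mul_comm]
  gcongr

namespace RieszRegular
variable {a L : ℕ → ℝ} {r : ℕ} {c Q : ℝ}

theorem integrable_exp_fejer {lam ε : ℝ} (hl : 0 < lam) (hε : 0 ≤ ε) (u : ℝ) :
    IntegrableOn (fun v : ℝ => Real.exp (-(ε * v)) * fejer ((u - v) / lam)) (Ioi 0) := by
  refine ((integrable_fejer hl u).1.integrableOn (s := Ioi 0)).mono' ?_ ?_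
  · apply Continuous.aestronglyMeasurable
    have := continuous_fejer
    fun_prop
  · filter_upwards [ae_restrict_mem measurableSet_Ioi] with v hv
    rw [Real.norm_of_nonneg (mul_nonneg (Real.exp_pos _).le (fejer_nonneg _))]
    refine mul_le_of_le_one_left (fejer_nonneg _) (Real.exp_le_one_iff.mpr ?_)
    have : 0 < v := hv
    nlinarith

theorem integral_exp_fejer_le {lam ε : ℝ} (hl : 0 < lam) (hε : 0 ≤ ε) (u : ℝ) :
    ∫ v in Ioi (0 : ℝ), Real.exp (-(ε * v)) * fejer ((u - v) / lam) ≤ 4 * Real.pi * lam := by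
  refine le_trans ?_ (integrable_fejer hl u).2
  refine le_trans ?_ (setIntegral_le_integral (s := Ioi 0) (integrable_fejer hl u).1
    (Eventually.of_forall fun v => fejer_nonneg _))
  refine setIntegral_mono_on (integrable_exp_fejer hl hε u)
    (integrable_fejer hl u).1.integrableOn measurableSet_Ioi fun v hv => ?_
  refine mul_le_of_le_one_left (fejer_nonneg _) (Real.exp_le_one_iff.mpr ?_)
  have : 0 < v := hv
  nlinarith

theorem integral_exp_fejer_ge {u : ℝ} (hu : 1 ≤ u) :
    2 / 5 ≤ ∫ v in Ioi (0 : ℝ), Real.exp (-(1 / u * v)) * fejer ((u - v) / 1) := by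
  have hu0 : 0 < u := by linarith
  have hε : 0 ≤ 1 / u := by positivity
  have h1 : ∫ v in Ioc (u - 1) u, Real.exp (-(1 / u * v)) * fejer ((u - v) / 1) ≤
      ∫ v in Ioi (0 : ℝ), Real.exp (-(1 / u * v)) * fejer ((u - v) / 1) := by
    refine setIntegral_mono_set (integrable_exp_fejer one_pos hε u)
      (Eventually.of_forall fun v => mul_nonneg (Real.exp_pos _).le (fejer_nonneg _))
      (Eventually.of_forall fun v hv => ?_)
    have hv1 : u - 1 < v := hv.1
    have hv2 : 0 < v := by linarith
    exact hv2
  refine le_trans ?_ h1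
  have h2 : ∫ v in Ioc (u - 1) u, (2 / 5 : ℝ) = 2 / 5 := by
    simp
  rw [← h2]
  refine setIntegral_mono_on (by simp) ((integrable_exp_fejer one_pos hε u).mono_set ?_)
    measurableSet_Ioc fun v hv => ?_
  · intro v hv
    have := hv.1
    exact mem_Ioi.mpr (by linarith)
  · have hf := fejer_ge (v := (u - v) / 1) (by linarith [hv.2]) (by linarith [hv.1])
    have he : Real.exp (-1) ≤ Real.exp (-(1 / u * v)) := by
      apply Real.exp_le_exp.mpr
      have : 1 / u * v ≤ 1 := by
        rw [one_div, inv_mul_le_iff₀ hu0]; linarith [hv.2]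
      linarith
    have he1 := Real.exp_neg_one_gt_d9
    calc (2 / 5 : ℝ) ≤ Real.exp (-1) * (9 / 8) := by linarith
      _ ≤ _ := by gcongr

end RieszRegular

/-- Explicit formula comparison of two regular families near `exp u`. -/
theorem sum_fejer_diff_ge {a₁ L₁ a₂ L₂ : ℕ → ℝ} {r₁ r₂ : ℕ} {c₁ c₂ Q : ℝ}
    (h₁ : RieszRegular a₁ L₁ r₁ c₁ Q) (h₂ : RieszRegular a₂ L₂ r₂ c₂ Q) {q : ℝ} (hq : 2 ≤ q)
    {u : ℝ} (hu : Q ^ 220 ≤ u) :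
    (1 / 20 : ℝ) ≤ ∑ m ∈ Finset.Icc ⌈Real.exp (u - 1000)⌉₊ ⌊Real.exp (u + 1000)⌋₊,
      (L₁ m - L₂ m / q) * ((m : ℝ) ^ (-(1 + 1 / u)) * fejer (u - Real.log m)) := by
  have hQ := h₁.two_le
  have hQ0 : 0 < Q := by linarith
  have hu1 : 1 ≤ u := (one_le_pow₀ (by linarith)).trans hu
  have hu0 : 0 < u := by linarith
  have hq0 : 0 < q := by linarith
  set σ := 1 + 1 / u with hσd
  have hσ : 1 < σ := by have : 0 < 1 / u := by positivity
                        linarith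
  have hσ1 : σ - 1 = 1 / u := by rw [hσd]; ring
  have hσ2 : σ ≤ 1 + (Q ^ 102)⁻¹ := by
    rw [hσd, one_div]
    gcongr
    exact (pow_le_pow_right₀ (by linarith) (by norm_num)).trans hu
  have herr : Q ^ 210 / u ≤ 1 / 1024 := by
    rw [div_le_div_iff₀ hu0 (by norm_num)]
    have : (2 : ℝ) ^ 10 ≤ Q ^ 10 := pow_le_pow_left₀ (by norm_num) hQ 10
    have e : Q ^ 220 = Q ^ 210 * Q ^ 10 := by ring
    have : 0 < Q ^ 210 := by positivity
    nlinarith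
  have e1 := h₁.sum_fejer_eq (u := u) hσ hσ2 le_rfl hu0
  have e2 := h₂.sum_fejer_eq (u := u) hσ hσ2 le_rfl hu0
  have e3 := h₁.sum_fejer_eq (u := u) (lam := 1000) hσ hσ2 (by norm_num) hu0
  have hpi := Real.pi_pos
  have e4 := h₁.sum_fejer_eq (u := u + 1000 * (Real.pi / 2)) (lam := 1000) hσ hσ2 (by norm_num)
    (by positivity)
  rw [hσ1] at e1 e2 e3 e4
  have i1 := RieszRegular.integral_exp_fejer_ge hu1
  have i3 := RieszRegular.integral_exp_fejer_le (lam := 1000) (ε := 1 / u) (by norm_num)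
    (by positivity) u
  have i4 := RieszRegular.integral_exp_fejer_le (lam := 1000) (ε := 1 / u) (by norm_num)
    (by positivity) (u + 1000 * (Real.pi / 2))
  set I₀ := ∫ v in Ioi (0 : ℝ), Real.exp (-(1 / u * v)) * fejer ((u - v) / 1)
  have b1 := (abs_le.mp e1.2).1
  have b2 := (abs_le.mp e2.2).2
  have b3 := (abs_le.mp e3.2).2
  have b4 := (abs_le.mp e4.2).2
  set N := Finset.Icc ⌈Real.exp (u - 1000)⌉₊ ⌊Real.exp (u + 1000)⌋₊ with hN
  set w : ℕ → ℝ := fun m => (m : ℝ) ^ (-σ) * fejer (u - Real.log m) with hw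
  have hw0 : ∀ m, 0 ≤ w m := fun m =>
    mul_nonneg (Real.rpow_nonneg (Nat.cast_nonneg m) _) (fejer_nonneg _)
  have s1 : Summable fun m => L₁ m * w m := by
    refine e1.1.congr fun m => ?_; rw [div_one, mul_assoc]
  have s2 : Summable fun m => L₂ m * w m := by
    refine e2.1.congr fun m => ?_; rw [div_one, mul_assoc]
  have t1 : ∑' m, L₁ m * w m = ∑' m : ℕ, L₁ m * (m : ℝ) ^ (-σ) * fejer ((u - Real.log m) / 1) :=
    tsum_congr fun m => by rw [div_one, mul_assoc]
  have t2 : ∑' m, L₂ m * w m = ∑' m : ℕ, L₂ m * (m : ℝ) ^ (-σ) * fejer ((u - Real.log m) / 1) :=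
    tsum_congr fun m => by rw [div_one, mul_assoc]
  rw [← t1] at b1
  rw [← t2] at b2
  -- the part of the first family away from `N`
  have hfar : ∑' m : ((N : Set ℕ)ᶜ : Set ℕ), L₁ m * w m ≤
      (∑' m : ℕ, L₁ m * (m : ℝ) ^ (-σ) * fejer ((u - Real.log m) / 1000) +
      7 * ∑' m : ℕ, L₁ m * (m : ℝ) ^ (-σ) *
        fejer ((u + 1000 * (Real.pi / 2) - Real.log m) / 1000)) / 1000 ^ 2 := by
    rw [← tsum_mul_left, ← e3.1.tsum_add (e4.1.mul_left 7), ← tsum_div_const]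
    have hs := (e3.1.add (e4.1.mul_left 7)).div_const ((1000 : ℝ) ^ 2)
    have hnn : ∀ m : ℕ, 0 ≤ (L₁ m * (m : ℝ) ^ (-σ) * fejer ((u - Real.log m) / 1000) +
      7 * (L₁ m * (m : ℝ) ^ (-σ) *
        fejer ((u + 1000 * (Real.pi / 2) - Real.log m) / 1000))) / 1000 ^ 2 := fun m => by
      have := h₁.weights_nonneg σ m
      have := fejer_nonneg ((u - Real.log m) / 1000)
      have := fejer_nonneg ((u + 1000 * (Real.pi / 2) - Real.log m) / 1000)
      positivity
    refine le_trans ((s1.subtype _).tsum_le_tsum ?_ (hs.subtype _))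
      (hs.tsum_subtype_le _ _ hnn)
    rintro ⟨m, hm⟩
    simp only [Function.comp]
    rcases Nat.eq_zero_or_pos m with rfl | hm0
    · simp [hw, Real.zero_rpow (show -σ ≠ 0 by linarith)]
    have hm0' : (0 : ℝ) < m := by exact_mod_cast hm0
    have hlog : (1000 : ℝ) ≤ |u - Real.log m| := by
      by_contra! hlt
      rw [abs_lt] at hlt
      apply hm
      rw [Finset.mem_coe, hN, Finset.mem_Icc]
      constructor
      · rw [Nat.ceil_le, ← Real.le_log_iff_exp_le hm0']; linarith
      · rw [Nat.le_floor_iff (Real.exp_pos _).le, ← Real.log_le_iff_le_exp hm0']; linarith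
    have hf := fejer_tail (by norm_num : (0 : ℝ) < 1000) hlog
    have hww := h₁.weights_nonneg σ m
    have e : (u + 1000 * (Real.pi / 2) - Real.log m) / 1000 =
      (u - Real.log m) / 1000 + Real.pi / 2 := by ring
    rw [e, hw]
    calc L₁ m * ((m : ℝ) ^ (-σ) * fejer (u - Real.log m))
        = L₁ m * (m : ℝ) ^ (-σ) * fejer (u - Real.log m) := by ring
      _ ≤ _ := mul_le_mul_of_nonneg_left hf hww
      _ = _ := by ring
  have hsplit : ∑' m, L₁ m * w m = ∑ m ∈ N, L₁ m * w m +
      ∑' m : ((N : Set ℕ)ᶜ : Set ℕ), L₁ m * w m := (s1.sum_add_tsum_compl).symm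
  have hsum2 : ∑ m ∈ N, L₂ m * w m ≤ ∑' m, L₂ m * w m :=
    s2.sum_le_tsum N fun m _ => mul_nonneg (h₂.log_nonneg m) (hw0 m)
  have hgoal : ∑ m ∈ N, (L₁ m - L₂ m / q) * w m =
      ∑ m ∈ N, L₁ m * w m - (∑ m ∈ N, L₂ m * w m) / q := by
    rw [Finset.sum_div, ← Finset.sum_sub_distrib]
    exact Finset.sum_congr rfl fun m _ => by ring
  change (1 / 20 : ℝ) ≤ ∑ m ∈ N, (L₁ m - L₂ m / q) * w m
  rw [hgoal]
  have hI : I₀ / q ≤ I₀ / 2 := by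
    have : 0 ≤ I₀ := by linarith
    gcongr
  have hb2 : (∑ m ∈ N, L₂ m * w m) / q ≤ (I₀ + 8 / 1024) / q := by
    gcongr
    have : 8 * 1 * Q ^ 210 / u = 8 * (Q ^ 210 / u) := by ring
    linarith
  have hb2' : (I₀ + 8 / 1024) / q ≤ (I₀ + 8 / 1024) / 2 := by
    have : 0 ≤ I₀ := by linarith
    gcongr
  have c1 : 8 * 1 * Q ^ 210 / u = 8 * (Q ^ 210 / u) := by ring
  have c3 : 8 * 1000 * Q ^ 210 / u = 8000 * (Q ^ 210 / u) := by ring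
  have c4 : 8 * 1000 * Q ^ 210 / (u + 1000 * (Real.pi / 2)) ≤ 8000 * (Q ^ 210 / u) := by
    rw [← c3]; gcongr; linarith
  have hpi' : Real.pi < 3.15 := Real.pi_lt_d2
  rw [c1] at b1
  rw [c3] at b3
  rw [hsplit] at b1
  linarith

end

section
open MeasureTheory Set
open scoped ENNReal

section LatticeCount
variable {E : Type*} [AddCommGroup E] [MeasurableSpace E] [MeasurableAdd E]
  {μ : Measure E} [μ.IsAddLeftInvariant] {Λ : AddSubgroup E} [Countable Λ] {D : Set E}

/-- The number of points of `Λ` in `S`. -/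
noncomputable def latticeCount (Λ : AddSubgroup E) (S : Set E) : ℝ≥0∞ :=
  ∑' g : Λ, S.indicator 1 (g : E)

theorem MeasureTheory.IsAddFundamentalDomain.lintegral_eq_setLIntegral_tsum
    (hD : IsAddFundamentalDomain Λ D μ) {f : E → ℝ≥0∞} (hf : Measurable f) :
    ∫⁻ x, f x ∂μ = ∫⁻ x in D, ∑' g : Λ, f (x + g) ∂μ := by
  rw [hD.lintegral_eq_tsum'', lintegral_tsum]
  · refine tsum_congr fun g => lintegral_congr fun x => ?_
    rw [AddSubgroup.vadd_def, vadd_eq_add, add_comm]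
  · intro g
    exact (hf.comp (measurable_add_const (g : E))).aemeasurable

theorem measure_eq_setLIntegral_tsum (hD : IsAddFundamentalDomain Λ D μ) {S : Set E}
    (hS : MeasurableSet S) :
    μ S = ∫⁻ x in D, ∑' g : Λ, S.indicator 1 (x + g) ∂μ := by
  rw [← hD.lintegral_eq_setLIntegral_tsum (measurable_one.indicator hS), lintegral_indicator_one hS]

theorem mul_latticeCount_le (hD : IsAddFundamentalDomain Λ D μ) {S T : Set E}
    (hS : MeasurableSet S) (h : ∀ x, ∃ y ∈ Λ, ∀ z ∈ T, z + x + y ∈ S) :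
    μ D * latticeCount Λ T ≤ μ S := by
  rw [measure_eq_setLIntegral_tsum hD hS, mul_comm, ← setLIntegral_const]
  refine lintegral_mono fun x => ?_
  obtain ⟨y, hy, H⟩ := h x
  rw [latticeCount, ← (Equiv.addRight (⟨y, hy⟩ : Λ)).tsum_eq fun g : Λ => S.indicator 1 (x + g)]
  refine ENNReal.tsum_le_tsum fun g => ?_
  by_cases hg : (g : E) ∈ T
  · have : x + ((Equiv.addRight (⟨y, hy⟩ : Λ)) g : E) ∈ S := by
      simpa [add_assoc, add_left_comm] using H g hg
    simp only [indicator_of_mem this, indicator_of_mem hg, Pi.one_apply, le_refl]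
  · simp [indicator_of_notMem hg]

theorem le_mul_latticeCount (hD : IsAddFundamentalDomain Λ D μ) {S T : Set E}
    (hS : MeasurableSet S) (h : ∀ x, ∃ y ∈ Λ, ∀ z ∈ S, z + x + y ∈ T) :
    μ S ≤ μ D * latticeCount Λ T := by
  rw [measure_eq_setLIntegral_tsum hD hS, mul_comm, ← setLIntegral_const]
  refine lintegral_mono fun x => ?_
  obtain ⟨y, hy, H⟩ := h (-x)
  rw [latticeCount, ← (Equiv.addRight (⟨y, hy⟩ : Λ)).tsum_eq fun g : Λ => T.indicator 1 (g : E)]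
  refine ENNReal.tsum_le_tsum fun g => ?_
  by_cases hg : x + (g : E) ∈ S
  · have : ((Equiv.addRight (⟨y, hy⟩ : Λ)) g : E) ∈ T := by
      simpa [add_assoc, add_left_comm] using H _ hg
    simp only [indicator_of_mem this, indicator_of_mem hg, Pi.one_apply, le_refl]
  · simp [indicator_of_notMem hg]

theorem measure_fundamentalDomain_le (hD : IsAddFundamentalDomain Λ D μ) {S : Set E}
    (hS : MeasurableSet S) (h : ∀ x, ∃ y ∈ Λ, x + y ∈ S) : μ D ≤ μ S := by
  have := mul_latticeCount_le hD (T := {0}) hS (by simpa using h)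
  refine le_trans (le_of_eq ?_) this
  rw [latticeCount, tsum_eq_single 0]
  · simp
  · intro g hg
    simpa using hg

end LatticeCount

end

section
open MeasureTheory Set Module NumberField NumberField.InfinitePlace NumberField.mixedEmbedding
open scoped ENNReal NNReal nonZeroDivisors

section
variable {K : Type*} [Field K]

open scoped Classical in
theorem mem_convexBodyLT_iff_normAtPlace (f : InfinitePlace K → ℝ≥0) (x : mixedSpace K) :
    x ∈ convexBodyLT K f ↔ ∀ w, normAtPlace w x < f w := by
  simp only [convexBodyLT, Set.mem_prod, Set.mem_pi, Set.mem_univ, mem_ball_zero_iff,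
    forall_true_left, Subtype.forall]
  constructor
  · rintro ⟨h₁, h₂⟩ w
    rcases w.isReal_or_isComplex with hw | hw
    · rw [normAtPlace_apply_of_isReal hw]; exact h₁ w hw
    · rw [normAtPlace_apply_of_isComplex hw]; exact h₂ w hw
  · intro h
    refine ⟨fun w hw => ?_, fun w hw => ?_⟩
    · rw [← normAtPlace_apply_of_isReal hw]; exact h w
    · rw [← normAtPlace_apply_of_isComplex hw]; exact h w

variable [NumberField K]

theorem measurableSet_convexBodyLT (f : InfinitePlace K → ℝ≥0) :
    MeasurableSet (convexBodyLT K f) :=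
  (MeasurableSet.univ_pi fun _ => measurableSet_ball).prod
    (MeasurableSet.univ_pi fun _ => measurableSet_ball)

open scoped Classical in
theorem convexBodyLT_volume_mul (f : InfinitePlace K → ℝ≥0) (hf : ∏ w, f w ^ mult w = 1)
    (t : ℝ≥0) :
    volume (convexBodyLT K fun w => t * f w) = convexBodyLTFactor K * (t : ℝ≥0∞) ^ finrank ℚ K := by
  rw [convexBodyLT_volume]
  have : ∏ w : InfinitePlace K, (t * f w) ^ mult w = t ^ finrank ℚ K := by
    simp_rw [mul_pow]
    rw [Finset.prod_mul_distrib, hf, mul_one, Finset.prod_pow_eq_pow_sum, sum_mult_eq]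
  rw [← ENNReal.coe_pow, ← this]

theorem span_mixedEmbedding_eq_top {ι : Type*} (b : ι → K)
    (hb : Submodule.span ℚ (range b) = ⊤) :
    Submodule.span ℝ (range fun i => mixedEmbedding K (b i)) = ⊤ := by
  have key : ∀ x : K, mixedEmbedding K x ∈
      Submodule.span ℝ (range fun i => mixedEmbedding K (b i)) := by
    intro x
    have hx : x ∈ Submodule.span ℚ (range b) := by rw [hb]; trivial
    induction hx using Submodule.span_induction with
    | mem x h => obtain ⟨i, rfl⟩ := h; exact Submodule.subset_span ⟨i, rfl⟩
    | zero => simp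
    | add x y _ _ hx hy => rw [map_add]; exact Submodule.add_mem _ hx hy
    | smul a x _ hx =>
      have : mixedEmbedding K (a • x) = (a : ℝ) • mixedEmbedding K x := by
        ext w
        · simp [Rat.smul_def, mixedEmbedding_apply_isReal]
        · simp [Rat.smul_def, mixedEmbedding_apply_isComplex]
      rw [this]
      exact Submodule.smul_mem _ _ hx
  rw [eq_top_iff, ← (latticeBasis K).span_eq, Submodule.span_le]
  rintro _ ⟨i, rfl⟩
  rw [latticeBasis_apply]
  exact key _

theorem exists_mem_idealLattice_normAtPlace_le {ι : Type*} [Fintype ι] (b : ι → 𝓞 K)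
    (hb : Submodule.span ℚ (range fun i => (b i : K)) = ⊤) {A : ℝ}
    (hA : ∀ i (w : InfinitePlace K), w (b i) ≤ A)
    (I : (FractionalIdeal (𝓞 K)⁰ K)ˣ) {α : K} (hα : α ∈ (I : FractionalIdeal (𝓞 K)⁰ K))
    (hα0 : α ≠ 0) (x : mixedSpace K) :
    ∃ y ∈ idealLattice K I, ∀ w, normAtPlace w (x + y) ≤ Fintype.card ι * A * w α := by
  have hspan : Submodule.span ℚ (range fun i => α * (b i : K)) = ⊤ := by
    have h1 : (range fun i => α * (b i : K)) =
        (LinearMap.mulLeft ℚ α) '' (range fun i => (b i : K)) := by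
      rw [← range_comp]; rfl
    rw [h1, ← Submodule.map_span, hb, Submodule.map_top, LinearMap.range_eq_top]
    intro y
    exact ⟨α⁻¹ * y, by simp [hα0]⟩
  have hx : x ∈ Submodule.span ℝ (range fun i => mixedEmbedding K (α * (b i : K))) := by
    rw [span_mixedEmbedding_eq_top _ hspan]; trivial
  rw [Submodule.mem_span_range_iff_exists_fun] at hx
  obtain ⟨c, rfl⟩ := hx
  refine ⟨∑ i, (-⌊c i⌋) • mixedEmbedding K (α * (b i : K)), ?_, fun w => ?_⟩
  · refine Submodule.sum_mem _ fun i _ => Submodule.smul_mem _ _ ?_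
    rw [mem_idealLattice]
    refine ⟨_, ?_, rfl⟩
    have := Submodule.smul_mem ((I : FractionalIdeal (𝓞 K)⁰ K) : Submodule (𝓞 K) K) (b i) hα
    rwa [Algebra.smul_def, mul_comm] at this
  · rw [← Finset.sum_add_distrib]
    classical
    have h1 : ∀ s : Finset ι, normAtPlace w (∑ i ∈ s, (c i • mixedEmbedding K (α * (b i : K)) +
        (-⌊c i⌋) • mixedEmbedding K (α * (b i : K)))) ≤ ∑ i ∈ s, A * w α := by
      intro s
      induction s using Finset.induction_on with
      | empty => simp
      | insert i s hi ih =>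
        rw [Finset.sum_insert hi, Finset.sum_insert hi]
        refine (normAtPlace_add_le _ _ _).trans (add_le_add ?_ ih)
        rw [neg_smul, ← sub_eq_add_neg, ← Int.cast_smul_eq_zsmul ℝ, ← sub_smul,
          normAtPlace_smul, normAtPlace_apply, map_mul]
        have h2 : |c i - ⌊c i⌋| ≤ 1 := by
          rw [abs_of_nonneg (by linarith [Int.floor_le (c i)])]
          linarith [Int.lt_floor_add_one (c i)]
        calc |c i - ⌊c i⌋| * (w α * w (b i)) ≤ 1 * (w α * A) := by
              refine mul_le_mul h2 (mul_le_mul_of_nonneg_left (hA i w) (apply_nonneg w α)) ?_ zero_le_one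
              exact mul_nonneg (apply_nonneg w α) (apply_nonneg w _)
          _ = A * w α := by ring
    refine (h1 Finset.univ).trans (le_of_eq ?_)
    rw [Finset.sum_const, Finset.card_univ, nsmul_eq_mul, mul_assoc]

variable (K) in
open scoped Classical in
/-- The covolume of the ring of integers. -/
noncomputable def integerCovolume : ℝ≥0∞ :=
  volume (ZSpan.fundamentalDomain (latticeBasis K))

open scoped Classical in
theorem integerCovolume_ne_zero : integerCovolume K ≠ 0 :=
  ZSpan.measure_fundamentalDomain_ne_zero _

open scoped Classical in
theorem integerCovolume_ne_top : integerCovolume K ≠ ⊤ :=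
  (ZSpan.fundamentalDomain_isBounded _).measure_lt_top.ne

instance countable_idealLattice (I : (FractionalIdeal (𝓞 K)⁰ K)ˣ) :
    Countable (idealLattice K I).toAddSubgroup := by
  change Countable (idealLattice K I)
  rw [← span_idealLatticeBasis]
  infer_instance

open scoped Classical in
theorem isAddFundamentalDomain_idealLattice (I : (FractionalIdeal (𝓞 K)⁰ K)ˣ) :
    IsAddFundamentalDomain (idealLattice K I).toAddSubgroup
      (ZSpan.fundamentalDomain (fractionalIdealLatticeBasis K I)) :=
  fundamentalDomain_idealLattice K I

open scoped Classical in
theorem volume_fundamentalDomain_ideal (I : (FractionalIdeal (𝓞 K)⁰ K)ˣ) (s : ℝ≥0)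
    (hs : (s : ℝ) ^ finrank ℚ K = (FractionalIdeal.absNorm (I : FractionalIdeal (𝓞 K)⁰ K) : ℝ)) :
    volume (ZSpan.fundamentalDomain (fractionalIdealLatticeBasis K I)) =
      integerCovolume K * (s : ℝ≥0∞) ^ finrank ℚ K := by
  rw [volume_fundamentalDomain_fractionalIdealLatticeBasis, integerCovolume, ← hs, mul_comm,
    ENNReal.ofReal_pow s.coe_nonneg, ENNReal.ofReal_coe_nnreal]

/-- A system of integers spanning the field, all of whose conjugates are bounded by `A`. -/
structure BoundedBasis {ι : Type*} [Fintype ι] (b : ι → 𝓞 K) (A : ℝ≥0) : Prop where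
  span : Submodule.span ℚ (range fun i => (b i : K)) = ⊤
  card : Fintype.card ι = finrank ℚ K
  one_le : 1 ≤ A
  le : ∀ i (w : InfinitePlace K), w (b i) ≤ A

namespace BoundedBasis
variable {ι : Type*} [Fintype ι] {b : ι → 𝓞 K} {A : ℝ≥0}

theorem integerCovolume_le (h : BoundedBasis b A) :
    integerCovolume K ≤ convexBodyLTFactor K * ((2 * finrank ℚ K * A : ℝ≥0) : ℝ≥0∞) ^ finrank ℚ K := by
  classical
  rw [← convexBodyLT_volume_mul (fun _ => 1) (by simp)]
  have h0 := volume_fundamentalDomain_ideal (K := K) 1 1 (by simp)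
  simp only [ENNReal.coe_one, one_pow, mul_one] at h0
  rw [← h0]
  refine measure_fundamentalDomain_le (isAddFundamentalDomain_idealLattice 1)
    (measurableSet_convexBodyLT _) fun x => ?_
  obtain ⟨y, hy, H⟩ := exists_mem_idealLattice_normAtPlace_le b h.span (A := A) h.le 1
    (α := 1) (by simp) one_ne_zero x
  refine ⟨y, hy, ?_⟩
  rw [mem_convexBodyLT_iff_normAtPlace]
  intro w
  refine (H w).trans_lt ?_
  rw [h.card, map_one]
  have h1 : (0 : ℝ) < finrank ℚ K := by exact_mod_cast finrank_pos
  have h2 : (1 : ℝ) ≤ A := by exact_mod_cast h.one_le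
  push_cast
  nlinarith [mul_pos h1 (zero_lt_one.trans_le h2)]

/-- Every translate of a box of radius proportional to `5 (n A) ^ 2` meets an ideal lattice. -/
theorem exists_mem_box (h : BoundedBasis b A) (I : (FractionalIdeal (𝓞 K)⁰ K)ˣ) (s : ℝ≥0)
    (hs : (s : ℝ) ^ finrank ℚ K = (FractionalIdeal.absNorm (I : FractionalIdeal (𝓞 K)⁰ K) : ℝ))
    (f : InfinitePlace K → ℝ≥0) (hf : ∏ w, f w ^ mult w = 1) (x : mixedSpace K) :
    ∃ y ∈ idealLattice K I, ∀ w,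
      normAtPlace w (x + y) < 5 * (finrank ℚ K * A) ^ 2 * s * f w := by
  classical
  have hn : (1 : ℝ≥0) ≤ finrank ℚ K := by exact_mod_cast finrank_pos (R := ℚ) (M := K)
  have hB : (1 : ℝ≥0) ≤ finrank ℚ K * A := one_le_mul hn h.one_le
  have hs0 : s ≠ 0 := by
    rintro rfl
    rw [NNReal.coe_zero, zero_pow finrank_pos.ne'] at hs
    have := (FractionalIdeal.absNorm_eq_zero_iff (I := (I : FractionalIdeal (𝓞 K)⁰ K))).not.mpr I.ne_zero
    exact this (by exact_mod_cast hs.symm)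
  have hmin : minkowskiBound K I <
      volume (convexBodyLT K fun w => (5 * (finrank ℚ K * A) * s) * f w) := by
    rw [convexBodyLT_volume_mul f hf, minkowskiBound, volume_fundamentalDomain_ideal I s hs,
      mixedEmbedding.finrank]
    calc _ ≤ (convexBodyLTFactor K * ((2 * finrank ℚ K * A : ℝ≥0) : ℝ≥0∞) ^ finrank ℚ K) *
          (s : ℝ≥0∞) ^ finrank ℚ K * 2 ^ finrank ℚ K := by
          gcongr; exact h.integerCovolume_le
      _ = (convexBodyLTFactor K : ℝ≥0∞) * ((4 * (finrank ℚ K * A) * s : ℝ≥0) : ℝ≥0∞) ^ finrank ℚ K := by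
          rw [mul_assoc, mul_assoc, ← mul_pow, ← mul_pow]
          congr 2
          push_cast
          ring
      _ < _ := by
          have hκ : convexBodyLTFactor K ≠ 0 :=
            (zero_lt_one.trans_le (one_le_convexBodyLTFactor K)).ne'
          rw [← ENNReal.coe_pow, ← ENNReal.coe_pow, ← ENNReal.coe_mul, ← ENNReal.coe_mul,
            ENNReal.coe_lt_coe]
          refine mul_lt_mul_of_pos_left ?_ (pos_iff_ne_zero.mpr hκ)
          refine pow_lt_pow_left₀ ?_ zero_le finrank_pos.ne'
          refine mul_lt_mul_of_pos_right ?_ (pos_iff_ne_zero.mpr hs0)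
          refine mul_lt_mul_of_pos_right (by norm_num) (by positivity)
  obtain ⟨α, hα, hα0, hlt⟩ := exists_ne_zero_mem_ideal_lt K I hmin
  obtain ⟨y, hy, H⟩ := exists_mem_idealLattice_normAtPlace_le b h.span (A := A) h.le I hα hα0 x
  refine ⟨y, hy, fun w => (H w).trans_lt ?_⟩
  have hlt' := hlt w
  push_cast at hlt'
  rw [h.card]
  have : (0 : ℝ) < finrank ℚ K * A := by exact_mod_cast (zero_lt_one.trans_le hB)
  nlinarith

theorem latticeCount_le (I : (FractionalIdeal (𝓞 K)⁰ K)ˣ) (s : ℝ≥0)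
    (hs : (s : ℝ) ^ finrank ℚ K = (FractionalIdeal.absNorm (I : FractionalIdeal (𝓞 K)⁰ K) : ℝ))
    (f : InfinitePlace K → ℝ≥0) (hf : ∏ w, f w ^ mult w = 1)
    (h : BoundedBasis b A) (t : ℝ≥0) :
    integerCovolume K * (s : ℝ≥0∞) ^ finrank ℚ K *
      latticeCount (idealLattice K I).toAddSubgroup (convexBodyLT K fun w => t * f w) ≤
    convexBodyLTFactor K *
      ((t + 5 * (finrank ℚ K * A) ^ 2 * s : ℝ≥0) : ℝ≥0∞) ^ finrank ℚ K := by
  classical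
  rw [← volume_fundamentalDomain_ideal I s hs, ← convexBodyLT_volume_mul f hf]
  refine mul_latticeCount_le (isAddFundamentalDomain_idealLattice I)
    (measurableSet_convexBodyLT _) fun x => ?_
  obtain ⟨y, hy, H⟩ := h.exists_mem_box I s hs f hf x
  refine ⟨y, hy, fun z hz => ?_⟩
  rw [mem_convexBodyLT_iff_normAtPlace] at hz ⊢
  intro w
  rw [add_assoc]
  refine (normAtPlace_add_le _ _ _).trans_lt ?_
  have h1 := hz w
  have h2 := H w
  push_cast at h1 h2 ⊢
  linarith

theorem le_latticeCount (I : (FractionalIdeal (𝓞 K)⁰ K)ˣ) (s : ℝ≥0)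
    (hs : (s : ℝ) ^ finrank ℚ K = (FractionalIdeal.absNorm (I : FractionalIdeal (𝓞 K)⁰ K) : ℝ))
    (f : InfinitePlace K → ℝ≥0) (hf : ∏ w, f w ^ mult w = 1)
    (h : BoundedBasis b A) (t : ℝ≥0) :
    convexBodyLTFactor K * (t : ℝ≥0∞) ^ finrank ℚ K ≤
    integerCovolume K * (s : ℝ≥0∞) ^ finrank ℚ K *
      latticeCount (idealLattice K I).toAddSubgroup
        (convexBodyLT K fun w => (t + 5 * (finrank ℚ K * A) ^ 2 * s) * f w) := by
  classical
  rw [← volume_fundamentalDomain_ideal I s hs, ← convexBodyLT_volume_mul f hf]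
  refine le_mul_latticeCount (isAddFundamentalDomain_idealLattice I)
    (measurableSet_convexBodyLT _) fun x => ?_
  obtain ⟨y, hy, H⟩ := h.exists_mem_box I s hs f hf x
  refine ⟨y, hy, fun z hz => ?_⟩
  rw [mem_convexBodyLT_iff_normAtPlace] at hz ⊢
  intro w
  rw [add_assoc]
  refine (normAtPlace_add_le _ _ _).trans_lt ?_
  have h1 := hz w
  have h2 := H w
  push_cast at h1 h2 ⊢
  linarith

theorem integerCovolume_le_pow (h : BoundedBasis b A) :
    integerCovolume K ≤
      convexBodyLTFactor K * ((5 * (finrank ℚ K * A) ^ 2 : ℝ≥0) : ℝ≥0∞) ^ finrank ℚ K := by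
  refine h.integerCovolume_le.trans ?_
  have hn : (1 : ℝ≥0) ≤ finrank ℚ K := by exact_mod_cast finrank_pos (R := ℚ) (M := K)
  have hB : (1 : ℝ≥0) ≤ finrank ℚ K * A := one_le_mul hn h.one_le
  have : 2 * finrank ℚ K * A ≤ 5 * (finrank ℚ K * A) ^ 2 := by nlinarith
  gcongr

end BoundedBasis
end

end

section
open MeasureTheory Set Module NumberField NumberField.InfinitePlace NumberField.mixedEmbedding
open NumberField.Units NumberField.Units.dirichletUnitTheorem
open scoped ENNReal NNReal nonZeroDivisors Pointwise

section Simplex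
variable {ι : Type*} [Fintype ι]

theorem volume_openSimplex (T : ℝ) :
    volume {y : ι → ℝ | (∀ i, 0 < y i) ∧ ∑ i, y i < T} =
      if 0 < T then ENNReal.ofReal (T ^ Fintype.card ι) *
        volume {y : ι → ℝ | (∀ i, 0 < y i) ∧ ∑ i, y i < 1} else 0 := by
  split_ifs with hT
  · have : {y : ι → ℝ | (∀ i, 0 < y i) ∧ ∑ i, y i < T} =
        T • {y : ι → ℝ | (∀ i, 0 < y i) ∧ ∑ i, y i < 1} := by
      ext y
      rw [mem_smul_set_iff_inv_smul_mem₀ hT.ne']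
      simp only [Set.mem_ofPred_eq, Pi.smul_apply, smul_eq_mul, ← Finset.mul_sum]
      refine and_congr (forall_congr' fun i => ?_) ?_
      · rw [mul_pos_iff_of_pos_left (inv_pos.mpr hT)]
      · rw [inv_mul_lt_iff₀ hT, mul_one]
    rw [this, Measure.addHaar_smul, finrank_pi, abs_of_pos (pow_pos hT _)]
  · convert measure_empty (μ := volume)
    refine eq_empty_of_forall_notMem fun y hy => hT ?_
    exact (Finset.sum_nonneg fun i _ => (hy.1 i).le).trans_lt hy.2

theorem volume_openSimplex_one_ne_zero :
    volume {y : ι → ℝ | (∀ i, 0 < y i) ∧ ∑ i, y i < 1} ≠ 0 := by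
  have hopen : IsOpen {y : ι → ℝ | (∀ i, 0 < y i) ∧ ∑ i, y i < 1} := by
    rw [ofPred_and, ofPred_forall]
    refine IsOpen.inter (isOpen_iInter_of_finite fun i => ?_) ?_
    · exact isOpen_lt continuous_const (continuous_apply i)
    · exact isOpen_lt (by fun_prop) continuous_const
  refine (hopen.measure_pos _ ⟨fun _ => 1 / (Fintype.card ι + 1 : ℝ), fun i => by positivity, ?_⟩).ne'
  rw [Finset.sum_const, Finset.card_univ, nsmul_eq_mul, mul_one_div, div_lt_one (by positivity)]
  linarith

theorem volume_openSimplex_one_ne_top :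
    volume {y : ι → ℝ | (∀ i, 0 < y i) ∧ ∑ i, y i < 1} ≠ ⊤ := by
  refine ((Metric.isBounded_Icc (0 : ι → ℝ) 1).subset ?_).measure_lt_top.ne
  rintro y ⟨h, h1⟩
  refine ⟨fun i => (h i).le, fun i => ?_⟩
  exact (Finset.single_le_sum (fun j _ => (h j).le) (Finset.mem_univ i)).trans h1.le

end Simplex

theorem AddMonoidHom.tsum_comp_eq {G H : Type*} [AddGroup G] [AddGroup H] (f : G →+ H)
    [Finite f.ker] (g : H → ℝ≥0∞) :
    ∑' x : G, g (f x) = Nat.card f.ker * ∑' y : f.range, g y := by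
  choose s hs using fun y : f.range => y.2
  have hbij : Function.Bijective (fun p : f.range × f.ker => (p.2 : G) + s p.1) := by
    constructor
    · rintro ⟨y, k⟩ ⟨y', k'⟩ h
      have h1 : f (k + s y) = f (k' + s y') := congrArg f h
      rw [map_add, map_add, hs, hs, f.mem_ker.mp k.2, f.mem_ker.mp k'.2, zero_add, zero_add] at h1
      obtain rfl := Subtype.ext h1
      have h2 : (k : G) = k' := add_right_cancel h
      rw [Subtype.ext h2]
    · intro x
      refine ⟨⟨⟨f x, x, rfl⟩, ⟨x - s ⟨f x, x, rfl⟩, ?_⟩⟩, ?_⟩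
      · rw [f.mem_ker, map_sub, hs, sub_self]
      · simp
  rw [← (Equiv.ofBijective _ hbij).tsum_eq, ENNReal.tsum_prod', ← ENNReal.tsum_mul_left]
  refine tsum_congr fun y => ?_
  have : ∀ k : f.ker, g (f ((Equiv.ofBijective _ hbij) (y, k))) = g y := by
    intro k
    simp [Equiv.ofBijective_apply, hs, f.mem_ker.mp k.2]
  simp_rw [this]
  rw [ENNReal.tsum_const, ENat.card_eq_coe_natCard, ENat.toENNReal_coe]

section
variable {K : Type*} [Field K] [NumberField K]

open scoped Classical in
/-- The extension of an element of the logarithmic space to all the places, with sum zero. -/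
noncomputable def fullLog (h : logSpace K) (w : InfinitePlace K) : ℝ :=
  if hw : w = w₀ then -∑ v, h v else h ⟨w, hw⟩

theorem sum_fullLog (h : logSpace K) : ∑ w, fullLog h w = 0 := by
  classical
  rw [Fintype.sum_eq_add_sum_subtype_ne _ w₀]
  have : ∀ w : {w : InfinitePlace K // w ≠ w₀}, fullLog h w = h w := fun w => dif_neg w.2
  simp only [this]
  simp [fullLog]

theorem fullLog_sub_logEmbedding (h : logSpace K) (ε : (𝓞 K)ˣ) (w : InfinitePlace K) :
    fullLog (h - logEmbedding K (Additive.ofMul ε)) w =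
      fullLog h w - mult w * Real.log (w (ε : K)) := by
  classical
  unfold fullLog
  split_ifs with hw
  · subst hw
    have := sum_logEmbedding_component ε
    simp only [Pi.sub_apply, Finset.sum_sub_distrib, this]
    ring
  · rfl

/-- The scaling of the places associated to an element of the logarithmic space. -/
noncomputable def placeScale (h : logSpace K) (w : InfinitePlace K) : ℝ≥0 :=
  ⟨Real.exp (fullLog h w / mult w), (Real.exp_pos _).le⟩

theorem prod_placeScale (h : logSpace K) : ∏ w, placeScale h w ^ mult w = 1 := by
  rw [← NNReal.coe_inj]
  push_cast
  have : ∀ w : InfinitePlace K, (placeScale h w : ℝ) ^ mult w = Real.exp (fullLog h w) := by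
    intro w
    change Real.exp _ ^ _ = _
    rw [← Real.exp_nat_mul]
    congr 1
    have : (mult w : ℝ) ≠ 0 := mult_coe_ne_zero
    field_simp
  simp_rw [this]
  rw [← Real.exp_sum, sum_fullLog, Real.exp_zero]

/-- The set of scalings for which the box of size `t` contains `β`. -/
def scaleRegion (t : ℝ) (β : K) : Set (logSpace K) :=
  {h | ∀ w : InfinitePlace K, w β < t * placeScale h w}

theorem mem_scaleRegion_iff {t : ℝ} (ht : 0 < t) {β : K} (hβ : β ≠ 0) (h : logSpace K) :
    h ∈ scaleRegion t β ↔
      ∀ w : InfinitePlace K, 0 < fullLog h w + mult w * (Real.log t - Real.log (w β)) := by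
  refine forall_congr' fun w => ?_
  have hw : 0 < w β := by rwa [pos_iff]
  have hm : (0 : ℝ) < mult w := by exact_mod_cast mult_pos
  change w β < t * Real.exp (fullLog h w / mult w) ↔ _
  rw [← Real.log_lt_log_iff hw (mul_pos ht (Real.exp_pos _))]
  rw [Real.log_mul ht.ne' (Real.exp_pos _).ne', Real.log_exp]
  have : fullLog h w + mult w * (Real.log t - Real.log (w β)) =
      mult w * ((Real.log t + fullLog h w / mult w) - Real.log (w β)) := by
    field_simp
    ring
  rw [this, mul_pos_iff_of_pos_left hm, sub_pos]

theorem mem_scaleRegion_unit_mul {t : ℝ} (ht : 0 < t) {β : K} (hβ : β ≠ 0) (ε : (𝓞 K)ˣ)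
    (h : logSpace K) :
    h ∈ scaleRegion t ((ε : K) * β) ↔
      h - logEmbedding K (Additive.ofMul ε) ∈ scaleRegion t β := by
  have hε : (ε : K) ≠ 0 := Units.coe_ne_zero ε
  rw [mem_scaleRegion_iff ht (mul_ne_zero hε hβ), mem_scaleRegion_iff ht hβ]
  refine forall_congr' fun w => ?_
  rw [fullLog_sub_logEmbedding, map_mul, Real.log_mul]
  · ring_nf
  · exact (map_ne_zero w).mpr hε
  · exact (map_ne_zero w).mpr hβ

variable (K) in
open scoped Classical in
/-- The volume of the unit simplex in the logarithmic space. -/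
noncomputable def simplexVolume : ℝ≥0∞ :=
  volume {y : logSpace K | (∀ i, 0 < y i) ∧ ∑ i, y i < 1}

theorem sum_mult_mul_log_sub {t : ℝ} {β : K} (hβ : β ≠ 0) :
    ∑ w : InfinitePlace K, mult w * (Real.log t - Real.log (w β)) =
      finrank ℚ K * Real.log t - Real.log (|Algebra.norm ℚ β| : ℚ) := by
  rw [← prod_eq_abs_norm, Real.log_prod]
  · simp_rw [mul_sub, Finset.sum_sub_distrib, ← Finset.sum_mul, Real.log_pow]
    rw [← Nat.cast_sum, sum_mult_eq]
  · intro w _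
    exact pow_ne_zero _ ((map_ne_zero w).mpr hβ)

open scoped Classical in
theorem volume_scaleRegion {t : ℝ} (ht : 0 < t) {β : K} (hβ : β ≠ 0) :
    volume (scaleRegion t β) =
      if 0 < finrank ℚ K * Real.log t - Real.log (|Algebra.norm ℚ β| : ℚ) then
        ENNReal.ofReal
          ((finrank ℚ K * Real.log t - Real.log (|Algebra.norm ℚ β| : ℚ)) ^ rank K) *
          simplexVolume K else 0 := by
  rw [← sum_mult_mul_log_sub hβ]
  set g : InfinitePlace K → ℝ := fun w => mult w * (Real.log t - Real.log (w β)) with hg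
  have hcard : rank K = Fintype.card {w : InfinitePlace K // w ≠ w₀} := by
    rw [rank, Fintype.card_subtype_compl, Fintype.card_subtype_eq]
  rw [hcard, simplexVolume, ← volume_openSimplex]
  have : scaleRegion t β = (fun h : logSpace K => h + fun w : {w : InfinitePlace K // w ≠ w₀} => g w) ⁻¹'
      {y : logSpace K | (∀ i, 0 < y i) ∧ ∑ i, y i < ∑ w, g w} := by
    ext h
    rw [mem_scaleRegion_iff ht hβ]
    have h1 : ∀ w : {w : InfinitePlace K // w ≠ w₀}, fullLog h w = h w := fun w => dif_neg w.2
    simp only [mem_preimage, Set.mem_ofPred_eq, Pi.add_apply, Finset.sum_add_distrib]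
    rw [Fintype.sum_eq_add_sum_subtype_ne g w₀]
    have h0 : fullLog h w₀ = -∑ v, h v := dif_pos rfl
    constructor
    · intro H
      refine ⟨fun w => ?_, ?_⟩
      · rw [← h1]; exact H w
      · have := H w₀
        rw [h0] at this
        simp only [hg] at *
        linarith
    · rintro ⟨H, H'⟩ w
      by_cases hw : w = w₀
      · rw [hw, h0]
        simp only [hg] at H'
        linarith
      · have := H ⟨w, hw⟩
        rwa [← h1] at this
  rw [this, measure_preimage_add_right]

theorem measurableSet_scaleRegion (t : ℝ) (β : K) : MeasurableSet (scaleRegion t β) := by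
  classical
  rw [scaleRegion, ofPred_forall]
  refine MeasurableSet.iInter fun w => measurableSet_lt measurable_const ?_
  refine measurable_const.mul ?_
  change Measurable fun h : logSpace K => Real.exp (fullLog h w / mult w)
  refine Real.measurable_exp.comp (Measurable.div_const ?_ _)
  unfold fullLog
  split_ifs
  · fun_prop
  · fun_prop

variable (K) in
open scoped Classical in
/-- A fundamental domain of the unit lattice. -/
noncomputable def unitDomain : Set (logSpace K) :=
  ZSpan.fundamentalDomain ((basisUnitLattice K).ofZLatticeBasis ℝ (unitLattice K))

open scoped Classical in
theorem isAddFundamentalDomain_unitDomain :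
    IsAddFundamentalDomain (unitLattice K).toAddSubgroup (unitDomain K) volume :=
  ZLattice.isAddFundamentalDomain (basisUnitLattice K) _

open scoped Classical in
theorem volume_unitDomain_ne_zero : volume (unitDomain K) ≠ 0 :=
  ZSpan.measure_fundamentalDomain_ne_zero _

open scoped Classical in
theorem volume_unitDomain_ne_top : volume (unitDomain K) ≠ ⊤ :=
  (ZSpan.fundamentalDomain_isBounded _).measure_lt_top.ne

theorem tsum_units_eq (g : logSpace K → ℝ≥0∞) :
    ∑' ε : (𝓞 K)ˣ, g (logEmbedding K (Additive.ofMul ε)) =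
      torsionOrder K * ∑' l : (unitLattice K).toAddSubgroup, g l := by
  have hfin : Finite (logEmbedding K).ker := by
    rw [logEmbedding_ker]
    exact inferInstanceAs (Finite (torsion K))
  have hcard : Nat.card (logEmbedding K).ker = torsionOrder K := by
    rw [logEmbedding_ker]; rfl
  have hrange : (unitLattice K).toAddSubgroup = (logEmbedding K).range := by
    ext x
    simp [unitLattice]
  rw [hrange, ← hcard, ← AddMonoidHom.tsum_comp_eq, ← Additive.ofMul.tsum_eq]

open scoped Classical in
theorem tsum_units_volume_scaleRegion {t : ℝ} (ht : 0 < t) {β : K} (hβ : β ≠ 0) :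
    ∑' ε : (𝓞 K)ˣ, volume (unitDomain K ∩ scaleRegion t ((ε : K) * β)) =
      torsionOrder K * volume (scaleRegion t β) := by
  have h1 : ∀ ε : (𝓞 K)ˣ, volume (unitDomain K ∩ scaleRegion t ((ε : K) * β)) =
      (fun l => ∫⁻ x in unitDomain K, (scaleRegion t β).indicator 1 (x - l))
        (logEmbedding K (Additive.ofMul ε)) := by
    intro ε
    rw [inter_comm, ← Measure.restrict_apply (measurableSet_scaleRegion _ _),
      ← lintegral_indicator_one (measurableSet_scaleRegion _ _)]
    refine lintegral_congr fun x => ?_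
    simp only [indicator, mem_scaleRegion_unit_mul ht hβ]
    rfl
  have : Countable (unitLattice K).toAddSubgroup := inferInstanceAs (Countable (unitLattice K))
  refine (tsum_congr h1).trans ((tsum_units_eq
    fun l => ∫⁻ x in unitDomain K, (scaleRegion t β).indicator 1 (x - l)).trans ?_)
  congr 1
  rw [measure_eq_setLIntegral_tsum isAddFundamentalDomain_unitDomain
    (measurableSet_scaleRegion _ _), ← lintegral_tsum]
  · refine lintegral_congr fun x => ?_
    rw [← (Equiv.neg _).tsum_eq]
    refine tsum_congr fun l => ?_
    simp [sub_eq_add_neg]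
  · intro l
    refine Measurable.aemeasurable ?_
    exact (measurable_one.indicator (measurableSet_scaleRegion t β)).comp
      (measurable_id.sub_const _)
end

end

section
open MeasureTheory Set Module NumberField NumberField.InfinitePlace NumberField.mixedEmbedding
open NumberField.Units NumberField.Units.dirichletUnitTheorem
open scoped ENNReal NNReal nonZeroDivisors Pointwise

variable {K : Type*} [Field K] [NumberField K]

/-- An integral ideal representing an ideal class. -/
noncomputable def classRep (C : ClassGroup (𝓞 K)) : (Ideal (𝓞 K))⁰ :=
  (ClassGroup.mk0_surjective C).choose

theorem mk0_classRep (C : ClassGroup (𝓞 K)) : ClassGroup.mk0 (classRep C) = C :=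
  (ClassGroup.mk0_surjective C).choose_spec

/-- The representative of the class inverse to the class of an ideal. -/
noncomputable def complement (𝔟 : (Ideal (𝓞 K))⁰) : ClassGroup (𝓞 K) := (ClassGroup.mk0 𝔟)⁻¹

theorem exists_span_eq_classRep_mul (𝔟 : (Ideal (𝓞 K))⁰) :
    ∃ β : 𝓞 K, Ideal.span {β} = (classRep (complement 𝔟) : Ideal (𝓞 K)) * 𝔟 := by
  have h : ClassGroup.mk0 (classRep (complement 𝔟) * 𝔟) = 1 := by
    rw [map_mul, mk0_classRep, complement, inv_mul_cancel]
  rw [ClassGroup.mk0_eq_one_iff] at h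
  obtain ⟨β, hβ⟩ := h.principal
  exact ⟨β, hβ.symm⟩

/-- A generator of the product of an ideal with the representative of the inverse class. -/
noncomputable def generator (𝔟 : (Ideal (𝓞 K))⁰) : 𝓞 K := (exists_span_eq_classRep_mul 𝔟).choose

theorem span_generator (𝔟 : (Ideal (𝓞 K))⁰) :
    Ideal.span {generator 𝔟} = (classRep (complement 𝔟) : Ideal (𝓞 K)) * 𝔟 :=
  (exists_span_eq_classRep_mul 𝔟).choose_spec

theorem generator_ne_zero (𝔟 : (Ideal (𝓞 K))⁰) : generator 𝔟 ≠ 0 := by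
  intro h
  have := span_generator 𝔟
  rw [h, Ideal.span_singleton_zero, eq_comm, ← Submonoid.coe_mul] at this
  exact nonZeroDivisors.coe_ne_zero _ this

variable (K) in
/-- Nonzero elements of the representative ideals. -/
abbrev ClassPoint : Type _ :=
  {p : ClassGroup (𝓞 K) × 𝓞 K // p.2 ≠ 0 ∧ p.2 ∈ (classRep p.1 : Ideal (𝓞 K))}

theorem unit_mul_generator_mem (𝔟 : (Ideal (𝓞 K))⁰) (ε : (𝓞 K)ˣ) :
    (ε : 𝓞 K) * generator 𝔟 ∈ (classRep (complement 𝔟) : Ideal (𝓞 K)) := by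
  have h : generator 𝔟 ∈ (classRep (complement 𝔟) : Ideal (𝓞 K)) * 𝔟 := by
    rw [← span_generator]
    exact Ideal.mem_span_singleton_self _
  exact Ideal.mul_mem_left _ _ (Ideal.mul_le_left h)

/-- The nonzero element of a representative ideal attached to an ideal and a unit. -/
noncomputable def classPoint (p : (Ideal (𝓞 K))⁰ × (𝓞 K)ˣ) : ClassPoint K :=
  ⟨(complement p.1, p.2 * generator p.1),
    mul_ne_zero p.2.ne_zero (generator_ne_zero _), unit_mul_generator_mem p.1 p.2⟩

theorem classPoint_bijective : Function.Bijective (classPoint (K := K)) := by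
  constructor
  · rintro ⟨𝔟, ε⟩ ⟨𝔟', ε'⟩ h
    rw [classPoint, classPoint, Subtype.mk_eq_mk, Prod.mk.injEq] at h
    obtain ⟨h1, h2⟩ := h
    have h3 : Ideal.span {generator 𝔟} = Ideal.span {generator 𝔟'} := by
      rw [Ideal.span_singleton_eq_span_singleton]
      have : (ε : 𝓞 K) * generator 𝔟 = ε' * generator 𝔟' := h2
      refine ⟨ε * ε'⁻¹, ?_⟩
      push_cast
      rw [← mul_assoc, mul_comm _ (ε : 𝓞 K), this, mul_right_comm, Units.mul_inv, one_mul]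
    rw [span_generator, span_generator] at h3
    simp only at h1
    rw [h1] at h3
    have h4 : 𝔟 = 𝔟' := Subtype.ext (mul_left_cancel₀ (nonZeroDivisors.coe_ne_zero _) h3)
    subst h4
    exact Prod.ext rfl (Units.ext (mul_right_cancel₀ (generator_ne_zero 𝔟) h2))
  · rintro ⟨⟨C, α⟩, hα0, hα⟩
    simp only at hα0 hα
    obtain ⟨𝔟, h𝔟⟩ := Ideal.dvd_span_singleton.mpr hα
    have h𝔟0 : 𝔟 ≠ ⊥ := by
      rintro rfl
      rw [Ideal.mul_bot, Ideal.span_singleton_eq_bot] at h𝔟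
      exact hα0 h𝔟
    set b : (Ideal (𝓞 K))⁰ := ⟨𝔟, mem_nonZeroDivisors_of_ne_zero h𝔟0⟩
    have hC : complement b = C := by
      rw [complement, inv_eq_iff_mul_eq_one, ← mk0_classRep C, ← map_mul,
        ClassGroup.mk0_eq_one_iff]
      refine ⟨⟨α, ?_⟩⟩
      change 𝔟 * (classRep C : Ideal (𝓞 K)) = Ideal.span {α}
      rw [h𝔟, mul_comm]
    have h1 : Ideal.span {generator b} = Ideal.span {α} := by
      rw [span_generator, hC, h𝔟]
    rw [Ideal.span_singleton_eq_span_singleton] at h1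
    obtain ⟨ε, hε⟩ := h1
    refine ⟨(b, ε), Subtype.ext (Prod.ext hC ?_)⟩
    change (ε : 𝓞 K) * generator b = α
    rw [mul_comm, hε]

theorem norm_generator (𝔟 : (Ideal (𝓞 K))⁰) :
    ((|Algebra.norm ℚ (generator 𝔟 : K)| : ℚ) : ℝ) =
      Ideal.absNorm (classRep (complement 𝔟) : Ideal (𝓞 K)) * Ideal.absNorm (𝔟 : Ideal (𝓞 K)) := by
  have := congrArg Ideal.absNorm (span_generator 𝔟)
  rw [Ideal.absNorm_span_singleton, map_mul] at this
  have h2 : Algebra.norm ℚ (generator 𝔟 : K) = ((Algebra.norm ℤ (generator 𝔟) : ℤ) : ℚ) :=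
    (Algebra.coe_norm_int (generator 𝔟)).symm
  rw [h2, ← Nat.cast_mul, ← this]
  push_cast
  rw [Nat.cast_natAbs]
  push_cast
  rfl

/-- The size of the box attached to an ideal class. -/
noncomputable def boxSize (v : ℝ) (C : ClassGroup (𝓞 K)) : ℝ :=
  Real.exp ((v + Real.log (Ideal.absNorm (classRep C : Ideal (𝓞 K)))) / finrank ℚ K)

open scoped Classical in
theorem sum_setLIntegral_eq (v : ℝ) :
    ∑ C : ClassGroup (𝓞 K), ∫⁻ h in unitDomain K,
      ∑' α : {α : 𝓞 K // α ≠ 0 ∧ α ∈ (classRep C : Ideal (𝓞 K))},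
        (scaleRegion (boxSize v C) ((α : 𝓞 K) : K)).indicator 1 h =
    torsionOrder K * simplexVolume K * ∑' 𝔟 : (Ideal (𝓞 K))⁰,
      if 0 < v - Real.log (Ideal.absNorm (𝔟 : Ideal (𝓞 K))) then
        ENNReal.ofReal ((v - Real.log (Ideal.absNorm (𝔟 : Ideal (𝓞 K)))) ^ rank K) else 0 := by
  have hcount : Countable (𝓞 K) := 
    (Free.chooseBasis ℤ (𝓞 K)).equivFun.toEquiv.countable_iff.mpr inferInstance
  have h1 : ∀ C : ClassGroup (𝓞 K), ∫⁻ h in unitDomain K,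
      ∑' α : {α : 𝓞 K // α ≠ 0 ∧ α ∈ (classRep C : Ideal (𝓞 K))},
        (scaleRegion (boxSize v C) ((α : 𝓞 K) : K)).indicator 1 h =
      ∑' α : {α : 𝓞 K // α ≠ 0 ∧ α ∈ (classRep C : Ideal (𝓞 K))},
        volume (unitDomain K ∩ scaleRegion (boxSize v C) ((α : 𝓞 K) : K)) := by
    intro C
    rw [lintegral_tsum]
    · refine tsum_congr fun α => ?_
      rw [lintegral_indicator_one (measurableSet_scaleRegion _ _),
        Measure.restrict_apply (measurableSet_scaleRegion _ _), inter_comm]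
    · intro α
      exact (measurable_one.indicator (measurableSet_scaleRegion _ _)).aemeasurable
  let e : ClassPoint K ≃ Σ C : ClassGroup (𝓞 K),
      {α : 𝓞 K // α ≠ 0 ∧ α ∈ (classRep C : Ideal (𝓞 K))} :=
    { toFun := fun p => ⟨p.1.1, p.1.2, p.2⟩
      invFun := fun s => ⟨(s.1, s.2.1), s.2.2⟩
      left_inv := fun p => rfl
      right_inv := fun s => rfl }
  rw [Finset.sum_congr rfl fun C _ => h1 C, ← tsum_fintype (L := .unconditional _),
    ← ENNReal.tsum_sigma' (fun p : Σ C : ClassGroup (𝓞 K),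
      {α : 𝓞 K // α ≠ 0 ∧ α ∈ (classRep C : Ideal (𝓞 K))} =>
      volume (unitDomain K ∩ scaleRegion (boxSize v p.1) ((p.2 : 𝓞 K) : K))), ← e.tsum_eq,
    ← (Equiv.ofBijective _ classPoint_bijective).tsum_eq, ENNReal.tsum_prod', ← ENNReal.tsum_mul_left]
  refine tsum_congr fun 𝔟 => ?_
  have h2 : ∀ ε : (𝓞 K)ˣ, volume (unitDomain K ∩ scaleRegion
      (boxSize v (e ((Equiv.ofBijective _ classPoint_bijective) (𝔟, ε))).1)
      (((e ((Equiv.ofBijective _ classPoint_bijective) (𝔟, ε))).2 : 𝓞 K) : K)) =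
      volume (unitDomain K ∩ scaleRegion (boxSize v (complement 𝔟)) ((ε : K) * (generator 𝔟 : K))) := by
    intro ε
    have : (((e ((Equiv.ofBijective _ classPoint_bijective) (𝔟, ε))).2 : 𝓞 K) : K) =
        (ε : K) * (generator 𝔟 : K) := by
      rw [← map_mul]; rfl
    rw [this]; rfl
  have h0 : (generator 𝔟 : K) ≠ 0 := RingOfIntegers.coe_ne_zero_iff.mpr (generator_ne_zero 𝔟)
  have hN : ∀ I : (Ideal (𝓞 K))⁰, (Ideal.absNorm (I : Ideal (𝓞 K)) : ℝ) ≠ 0 := fun I => by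
    have := Ideal.absNorm_ne_zero_of_nonZeroDivisors I
    exact_mod_cast this
  have hbox : 0 < boxSize v (complement 𝔟) := Real.exp_pos _
  rw [tsum_congr h2, tsum_units_volume_scaleRegion hbox h0,
    volume_scaleRegion hbox h0, norm_generator, boxSize, Real.log_exp,
    Real.log_mul (hN _) (hN _)]
  have hn : (finrank ℚ K : ℝ) ≠ 0 := by exact_mod_cast finrank_pos.ne'
  have h5 : finrank ℚ K * ((v + Real.log (Ideal.absNorm (classRep (complement 𝔟) : Ideal (𝓞 K)))) /
      finrank ℚ K) - (Real.log (Ideal.absNorm (classRep (complement 𝔟) : Ideal (𝓞 K))) +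
        Real.log (Ideal.absNorm (𝔟 : Ideal (𝓞 K)))) =
      v - Real.log (Ideal.absNorm (𝔟 : Ideal (𝓞 K))) := by
    field_simp
    ring
  rw [h5]
  split_ifs
  · ring
  · simp

end

section
open MeasureTheory Set Module NumberField NumberField.InfinitePlace NumberField.mixedEmbedding
open NumberField.Units NumberField.Units.dirichletUnitTheorem
open scoped ENNReal NNReal nonZeroDivisors Pointwise

variable {K : Type*} [Field K] [NumberField K]

variable (K) in
/-- The number of nonzero ideals of a given norm. -/
noncomputable def idealCount (m : ℕ) : ℝ :=
  Nat.card {I : (Ideal (𝓞 K))⁰ // Ideal.absNorm (I : Ideal (𝓞 K)) = m}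

instance finite_idealFiber (m : ℕ) :
    Finite {I : (Ideal (𝓞 K))⁰ // Ideal.absNorm (I : Ideal (𝓞 K)) = m} :=
  (Ideal.finite_setOfPred_absNorm_le₀ (S := 𝓞 K) m).subset fun _ h => le_of_eq h

theorem tsum_absNorm_eq (g : ℕ → ℝ≥0∞) :
    ∑' 𝔟 : (Ideal (𝓞 K))⁰, g (Ideal.absNorm (𝔟 : Ideal (𝓞 K))) =
      ∑' m, ENNReal.ofReal (idealCount K m) * g m := by
  rw [← (Equiv.sigmaFiberEquiv
    fun 𝔟 : (Ideal (𝓞 K))⁰ => Ideal.absNorm (𝔟 : Ideal (𝓞 K))).tsum_eq, ENNReal.tsum_sigma']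
  refine tsum_congr fun m => ?_
  have : ∀ I : {I : (Ideal (𝓞 K))⁰ // Ideal.absNorm (I : Ideal (𝓞 K)) = m},
      g (Ideal.absNorm (((Equiv.sigmaFiberEquiv
        fun 𝔟 : (Ideal (𝓞 K))⁰ => Ideal.absNorm (𝔟 : Ideal (𝓞 K))) ⟨m, I⟩ : (Ideal (𝓞 K))⁰) :
        Ideal (𝓞 K))) = g m := fun I => congrArg g I.2
  rw [tsum_congr this, ENNReal.tsum_const, idealCount, ENNReal.ofReal_natCast]
  simp [ENat.card_eq_coe_natCard]

variable (K) in
theorem idealCount_zero : idealCount K 0 = 0 := by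
  rw [idealCount, Nat.cast_eq_zero, Nat.card_eq_zero]
  exact Or.inl ⟨fun I => Ideal.absNorm_ne_zero_of_nonZeroDivisors I.1 I.2⟩

variable (K) in
theorem idealCount_one : idealCount K 1 = 1 := by
  rw [idealCount, Nat.cast_eq_one, Nat.card_eq_one_iff_unique]
  refine ⟨⟨fun I J => Subtype.ext (Subtype.ext ?_)⟩, ⟨⟨1, by simp⟩⟩⟩
  rw [Ideal.absNorm_eq_one_iff.mp I.2, Ideal.absNorm_eq_one_iff.mp J.2]

theorem idealCount_nonneg (m : ℕ) : 0 ≤ idealCount K m := Nat.cast_nonneg _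

variable (K) in
theorem tsum_eq_riesz (v : ℝ) (r : ℕ) :
    (∑' 𝔟 : (Ideal (𝓞 K))⁰,
      if 0 < v - Real.log (Ideal.absNorm (𝔟 : Ideal (𝓞 K))) then
        ENNReal.ofReal ((v - Real.log (Ideal.absNorm (𝔟 : Ideal (𝓞 K)))) ^ r) else 0) =
      ENNReal.ofReal (riesz (idealCount K) r v) := by
  rw [tsum_absNorm_eq fun m : ℕ => if 0 < v - Real.log m then
    ENNReal.ofReal ((v - Real.log m) ^ r) else 0,
    tsum_eq_sum (s := Finset.Ico 1 ⌈Real.exp v⌉₊), riesz, ENNReal.ofReal_sum_of_nonneg]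
  · refine Finset.sum_congr rfl fun n hn => ?_
    rw [Finset.mem_Ico, Nat.lt_ceil] at hn
    have : 0 < v - Real.log n := by
      rw [sub_pos, Real.log_lt_iff_lt_exp (by exact_mod_cast hn.1)]
      exact hn.2
    rw [if_pos this, ENNReal.ofReal_mul (idealCount_nonneg _)]
  · intro n hn
    rw [Finset.mem_Ico, Nat.lt_ceil, ← Real.log_lt_iff_lt_exp] at hn
    · exact mul_nonneg (idealCount_nonneg _) (pow_nonneg (sub_nonneg.mpr hn.2.le) _)
    · exact_mod_cast hn.1
  · intro n hn
    rcases Nat.eq_zero_or_pos n with rfl | h0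
    · simp [idealCount_zero]
    · rw [if_neg, mul_zero]
      intro h
      refine hn (Finset.mem_Ico.mpr ⟨h0, Nat.lt_ceil.mpr ?_⟩)
      rwa [sub_pos, Real.log_lt_iff_lt_exp (by exact_mod_cast h0)] at h

theorem latticeCount_eq_tsum {E ι : Type*} [AddCommGroup E] (Λ : AddSubgroup E) (f : ι → E)
    (hf : Function.Injective f) (hr : Set.range f = Λ) (S : Set E) :
    latticeCount Λ S = ∑' i, S.indicator 1 (f i) := by
  have hm : ∀ i, f i ∈ Λ := fun i => by
    rw [← SetLike.mem_coe, ← hr]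
    exact mem_range_self i
  have hb : Function.Bijective (fun i => (⟨f i, hm i⟩ : Λ)) := by
    refine ⟨fun x y h => hf (congrArg Subtype.val h), fun ⟨x, hx⟩ => ?_⟩
    rw [← SetLike.mem_coe, ← hr] at hx
    obtain ⟨i, rfl⟩ := hx
    exact ⟨i, rfl⟩
  exact ((Equiv.ofBijective _ hb).tsum_eq fun g : Λ => S.indicator (1 : E → ℝ≥0∞) (g : E)).symm

theorem latticeCount_idealLattice_eq (𝔞 : (Ideal (𝓞 K))⁰) (S : Set (mixedSpace K)) :
    latticeCount (idealLattice K (FractionalIdeal.mk0 K 𝔞)).toAddSubgroup S =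
      ∑' α : ↥(𝔞 : Ideal (𝓞 K)), S.indicator 1 (mixedEmbedding K ((α : 𝓞 K) : K)) := by
  apply latticeCount_eq_tsum
  · intro x y hxy
    exact Subtype.ext (RingOfIntegers.ext (mixedEmbedding_injective K hxy))
  · ext x
    rw [mem_range, SetLike.mem_coe, Submodule.mem_toAddSubgroup, mem_idealLattice]
    simp only [FractionalIdeal.coe_mk0]
    constructor
    · rintro ⟨α, rfl⟩
      exact ⟨_, (FractionalIdeal.mem_coeIdeal _).mpr ⟨α, α.2, rfl⟩, rfl⟩
    · rintro ⟨y, hy, rfl⟩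
      obtain ⟨z, hz, rfl⟩ := (FractionalIdeal.mem_coeIdeal _).mp hy
      exact ⟨⟨z, hz⟩, rfl⟩

theorem indicator_convexBodyLT_eq (t : ℝ≥0) (h : logSpace K) (α : K) :
    (convexBodyLT K fun w => t * placeScale h w).indicator
      (1 : mixedSpace K → ℝ≥0∞) (mixedEmbedding K α) = (scaleRegion t α).indicator 1 h := by
  have : mixedEmbedding K α ∈ (convexBodyLT K fun w => t * placeScale h w) ↔
      h ∈ scaleRegion t α := by
    rw [mem_convexBodyLT_iff_normAtPlace]
    simp only [normAtPlace_apply]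
    rfl
  by_cases hm : h ∈ scaleRegion t α
  · rw [indicator_of_mem hm, indicator_of_mem (this.mpr hm), Pi.one_apply, Pi.one_apply]
  · rw [indicator_of_notMem hm, indicator_of_notMem (mt this.mp hm)]

theorem tsum_ideal_eq {R : Type*} [CommRing R] (I : Ideal R) (F : R → ℝ≥0∞) :
    ∑' α : I, F α = F 0 + ∑' α : {α : R // α ≠ 0 ∧ α ∈ I}, F α := by
  classical
  have h1 : ∑' α : {α : R // α ≠ 0 ∧ α ∈ I}, F α = ∑' α : R, if α ≠ 0 ∧ α ∈ I then F α else 0 := by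
    refine (tsum_subtype {α : R | α ≠ 0 ∧ α ∈ I} F).trans (tsum_congr fun α => ?_)
    rw [Set.indicator_apply]
    congr 1
  have h2 : ∑' α : I, F α = ∑' α : R, if α ∈ I then F α else 0 :=
    tsum_subtype (I : Set R) F
  rw [h1, h2, ENNReal.tsum_eq_add_tsum_ite (0 : R), if_pos I.zero_mem]
  congr 1
  refine tsum_congr fun α => ?_
  by_cases h0 : α = 0 <;> simp [h0]

theorem latticeCount_convexBodyLT_eq (𝔞 : (Ideal (𝓞 K))⁰) (t : ℝ≥0) (ht : 0 < t)
    (h : logSpace K) :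
    latticeCount (idealLattice K (FractionalIdeal.mk0 K 𝔞)).toAddSubgroup
      (convexBodyLT K fun w => t * placeScale h w) =
    1 + ∑' α : {α : 𝓞 K // α ≠ 0 ∧ α ∈ (𝔞 : Ideal (𝓞 K))},
      (scaleRegion t ((α : 𝓞 K) : K)).indicator 1 h := by
  classical
  rw [latticeCount_idealLattice_eq]
  simp only [indicator_convexBodyLT_eq]
  rw [tsum_ideal_eq (𝔞 : Ideal (𝓞 K)) fun α => (scaleRegion t (α : K)).indicator 1 h]
  congr 1
  rw [indicator_of_mem, Pi.one_apply]
  intro w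
  simp only [map_zero]
  have : 0 < placeScale h w := Real.exp_pos _
  positivity

variable (K) in
open scoped Classical in
theorem sum_setLIntegral_latticeCount (v : ℝ) :
    ∑ C : ClassGroup (𝓞 K), ∫⁻ h in unitDomain K,
      latticeCount (idealLattice K (FractionalIdeal.mk0 K (classRep C))).toAddSubgroup
        (convexBodyLT K fun w => (boxSize v C).toNNReal * placeScale h w) =
    Fintype.card (ClassGroup (𝓞 K)) * volume (unitDomain K) + torsionOrder K * simplexVolume K *
      ENNReal.ofReal (riesz (idealCount K) (rank K) v) := by
  rw [← tsum_eq_riesz, ← sum_setLIntegral_eq]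
  have h0 : ∀ C : ClassGroup (𝓞 K), 0 < boxSize v C := fun C => Real.exp_pos _
  simp_rw [latticeCount_convexBodyLT_eq _ _ (Real.toNNReal_pos.mpr (h0 _)),
    Real.coe_toNNReal _ (h0 _).le]
  rw [Finset.sum_congr rfl fun C _ => lintegral_add_left measurable_const _]
  simp only [lintegral_const, one_mul, Measure.restrict_apply_univ]
  rw [Finset.sum_add_distrib, Finset.sum_const, nsmul_eq_mul, Finset.card_univ]

end

section
open MeasureTheory Set Module NumberField NumberField.InfinitePlace NumberField.mixedEmbedding
open NumberField.Units NumberField.Units.dirichletUnitTheorem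
open scoped ENNReal NNReal nonZeroDivisors Pointwise

variable {K : Type*} [Field K] [NumberField K]

/-- The normalized side of a representative ideal. -/
noncomputable def idealSide (C : ClassGroup (𝓞 K)) : ℝ≥0 :=
  (Ideal.absNorm (classRep C : Ideal (𝓞 K)) : ℝ≥0) ^ ((1 : ℝ) / finrank ℚ K)

theorem idealSide_pos (C : ClassGroup (𝓞 K)) : 0 < idealSide C := by
  refine NNReal.rpow_pos ?_
  exact_mod_cast Nat.pos_of_ne_zero (Ideal.absNorm_ne_zero_of_nonZeroDivisors (classRep C))

theorem idealSide_pow (C : ClassGroup (𝓞 K)) :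
    ((idealSide C : ℝ≥0) : ℝ) ^ finrank ℚ K =
      ((FractionalIdeal.absNorm (FractionalIdeal.mk0 K (classRep C) :
        FractionalIdeal (𝓞 K)⁰ K) : ℚ) : ℝ) := by
  rw [FractionalIdeal.coe_mk0, FractionalIdeal.coeIdeal_absNorm, idealSide, ← NNReal.coe_pow,
    ← NNReal.rpow_natCast, ← NNReal.rpow_mul, one_div, inv_mul_cancel₀]
  · simp
  · exact_mod_cast finrank_pos.ne'

theorem coe_mul_pow (x y : ℝ≥0) (n : ℕ) :
    ((x * y : ℝ≥0) : ℝ≥0∞) ^ n = (x : ℝ≥0∞) ^ n * (y : ℝ≥0∞) ^ n := by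
  rw [ENNReal.coe_mul, mul_pow]

theorem boxSize_pos (v : ℝ) (C : ClassGroup (𝓞 K)) : 0 < boxSize v C := Real.exp_pos _

theorem boxSize_eq (v : ℝ) (C : ClassGroup (𝓞 K)) :
    boxSize v C = Real.exp (v / finrank ℚ K) * idealSide C := by
  have h : (0 : ℝ) < Ideal.absNorm (classRep C : Ideal (𝓞 K)) := by
    exact_mod_cast Nat.pos_of_ne_zero (Ideal.absNorm_ne_zero_of_nonZeroDivisors (classRep C))
  rw [boxSize, idealSide, add_div, Real.exp_add, NNReal.coe_rpow, Real.rpow_def_of_pos 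
    (by exact_mod_cast h)]
  simp [div_eq_mul_inv]

variable {ι : Type*} [Fintype ι] {b : ι → 𝓞 K} {A : ℝ≥0}

open scoped Classical in
theorem BoundedBasis.covolume_mul_setLIntegral_le (hb : BoundedBasis b A) (v : ℝ)
    (C : ClassGroup (𝓞 K)) :
    integerCovolume K * ∫⁻ h in unitDomain K,
      latticeCount (idealLattice K (FractionalIdeal.mk0 K (classRep C))).toAddSubgroup
        (convexBodyLT K fun w => (boxSize v C).toNNReal * placeScale h w) ≤
    convexBodyLTFactor K * volume (unitDomain K) *
      ENNReal.ofReal ((Real.exp (v / finrank ℚ K) + 5 * (finrank ℚ K * A) ^ 2) ^ finrank ℚ K) := by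
  set s := idealSide C
  have hs0 : (s : ℝ≥0∞) ^ finrank ℚ K ≠ 0 :=
    pow_ne_zero _ (ENNReal.coe_ne_zero.mpr (idealSide_pos C).ne')
  have hs1 : (s : ℝ≥0∞) ^ finrank ℚ K ≠ ⊤ := ENNReal.pow_ne_top ENNReal.coe_ne_top
  rw [← ENNReal.mul_le_mul_iff_right hs0 hs1]
  have h1 : ∀ h : logSpace K, (s : ℝ≥0∞) ^ finrank ℚ K * (integerCovolume K *
      latticeCount (idealLattice K (FractionalIdeal.mk0 K (classRep C))).toAddSubgroup
        (convexBodyLT K fun w => (boxSize v C).toNNReal * placeScale h w)) ≤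
      (s : ℝ≥0∞) ^ finrank ℚ K * (convexBodyLTFactor K *
      ENNReal.ofReal ((Real.exp (v / finrank ℚ K) + 5 * (finrank ℚ K * A) ^ 2) ^ finrank ℚ K)) := by
    intro h
    refine le_trans (le_of_eq (by ring)) ((hb.latticeCount_le _ s (idealSide_pow C) _
      (prod_placeScale h) (boxSize v C).toNNReal).trans (le_of_eq ?_))
    have h2 : (boxSize v C).toNNReal + 5 * (finrank ℚ K * A) ^ 2 * s =
        (Real.exp (v / finrank ℚ K) + 5 * (finrank ℚ K * A) ^ 2).toNNReal * s := by
      rw [← NNReal.coe_inj]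
      push_cast [Real.coe_toNNReal _ (boxSize_pos v C).le]
      rw [boxSize_eq, Real.coe_toNNReal _ (by positivity)]
      ring
    rw [h2, coe_mul_pow, ENNReal.ofReal_pow (by positivity), ENNReal.ofReal]
    ring
  calc _ = ∫⁻ h in unitDomain K, (s : ℝ≥0∞) ^ finrank ℚ K * (integerCovolume K *
      latticeCount (idealLattice K (FractionalIdeal.mk0 K (classRep C))).toAddSubgroup
        (convexBodyLT K fun w => (boxSize v C).toNNReal * placeScale h w)) := by
        rw [lintegral_const_mul' _ _ hs1, lintegral_const_mul' _ _ (integerCovolume_ne_top)]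
    _ ≤ ∫⁻ h in unitDomain K, _ := lintegral_mono h1
    _ = _ := by
        rw [lintegral_const, Measure.restrict_apply_univ]
        ring

open scoped Classical in
theorem BoundedBasis.le_covolume_mul_setLIntegral (hb : BoundedBasis b A) (v : ℝ)
    (hv : 5 * (finrank ℚ K * A : ℝ) ^ 2 ≤ Real.exp (v / finrank ℚ K)) (C : ClassGroup (𝓞 K)) :
    convexBodyLTFactor K * volume (unitDomain K) *
      ENNReal.ofReal ((Real.exp (v / finrank ℚ K) - 5 * (finrank ℚ K * A) ^ 2) ^ finrank ℚ K) ≤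
    integerCovolume K * ∫⁻ h in unitDomain K,
      latticeCount (idealLattice K (FractionalIdeal.mk0 K (classRep C))).toAddSubgroup
        (convexBodyLT K fun w => (boxSize v C).toNNReal * placeScale h w) := by
  set s := idealSide C
  have hs0 : (s : ℝ≥0∞) ^ finrank ℚ K ≠ 0 :=
    pow_ne_zero _ (ENNReal.coe_ne_zero.mpr (idealSide_pos C).ne')
  have hs1 : (s : ℝ≥0∞) ^ finrank ℚ K ≠ ⊤ := ENNReal.pow_ne_top ENNReal.coe_ne_top
  rw [← ENNReal.mul_le_mul_iff_right hs0 hs1]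
  have hsub : (0 : ℝ) ≤ Real.exp (v / finrank ℚ K) - 5 * (finrank ℚ K * A) ^ 2 :=
    sub_nonneg.mpr hv
  have h2 : (boxSize v C).toNNReal =
      (Real.exp (v / finrank ℚ K) - 5 * (finrank ℚ K * A) ^ 2).toNNReal * s +
      5 * (finrank ℚ K * A) ^ 2 * s := by
    rw [← NNReal.coe_inj]
    push_cast [Real.coe_toNNReal _ (boxSize_pos v C).le]
    rw [boxSize_eq, Real.coe_toNNReal _ hsub]
    ring
  have h1 : ∀ h : logSpace K, 
      (s : ℝ≥0∞) ^ finrank ℚ K * (convexBodyLTFactor K *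
      ENNReal.ofReal ((Real.exp (v / finrank ℚ K) - 5 * (finrank ℚ K * A) ^ 2) ^ finrank ℚ K)) ≤
      (s : ℝ≥0∞) ^ finrank ℚ K * (integerCovolume K *
      latticeCount (idealLattice K (FractionalIdeal.mk0 K (classRep C))).toAddSubgroup
        (convexBodyLT K fun w => (boxSize v C).toNNReal * placeScale h w)) := by
    intro h
    refine le_trans (le_of_eq ?_) ((hb.le_latticeCount _ s (idealSide_pow C) _
      (prod_placeScale h) ((Real.exp (v / finrank ℚ K) -
        5 * (finrank ℚ K * A) ^ 2).toNNReal * s)).trans (le_of_eq ?_))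
    · rw [ENNReal.ofReal_pow hsub, coe_mul_pow, ENNReal.ofReal]
      ring
    · rw [h2]
      ring
  calc _ = ∫⁻ h in unitDomain K, (s : ℝ≥0∞) ^ finrank ℚ K * (convexBodyLTFactor K *
      ENNReal.ofReal ((Real.exp (v / finrank ℚ K) - 5 * (finrank ℚ K * A) ^ 2) ^ finrank ℚ K)) := by
        rw [lintegral_const, Measure.restrict_apply_univ]
        ring
    _ ≤ _ := lintegral_mono h1
    _ = _ := by
        rw [lintegral_const_mul' _ _ hs1, lintegral_const_mul' _ _ (integerCovolume_ne_top)]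

end

section
open MeasureTheory Set Module NumberField NumberField.InfinitePlace NumberField.mixedEmbedding
open NumberField.Units NumberField.Units.dirichletUnitTheorem
open scoped ENNReal NNReal nonZeroDivisors Pointwise

variable {K : Type*} [Field K] [NumberField K]

theorem riesz_idealCount_nonneg (r : ℕ) (v : ℝ) : 0 ≤ riesz (idealCount K) r v := by
  refine Finset.sum_nonneg fun n hn => ?_
  rw [Finset.mem_Ico, Nat.lt_ceil] at hn
  refine mul_nonneg (idealCount_nonneg _) (pow_nonneg (sub_nonneg.mpr ?_) _)
  rw [Real.log_le_iff_le_exp (by exact_mod_cast hn.1)]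
  exact hn.2.le

variable {ι : Type*} [Fintype ι] {b : ι → 𝓞 K} {A : ℝ≥0}

theorem BoundedBasis.exists_riesz_bounds (hb : BoundedBasis b A) :
    ∃ c B : ℝ, 0 < c ∧ 0 ≤ B ∧ B ≤ c * (5 * (finrank ℚ K * A) ^ 2) ^ finrank ℚ K ∧ ∀ v : ℝ,
      riesz (idealCount K) (rank K) v + B ≤
        c * (Real.exp (v / finrank ℚ K) + 5 * (finrank ℚ K * A) ^ 2) ^ finrank ℚ K ∧
      (5 * (finrank ℚ K * A : ℝ) ^ 2 ≤ Real.exp (v / finrank ℚ K) →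
        c * (Real.exp (v / finrank ℚ K) - 5 * (finrank ℚ K * A) ^ 2) ^ finrank ℚ K ≤
          riesz (idealCount K) (rank K) v + B) := by
  classical
  have hco : 0 < (integerCovolume K).toReal :=
    ENNReal.toReal_pos integerCovolume_ne_zero integerCovolume_ne_top
  have hV : 0 < (volume (unitDomain K)).toReal :=
    ENNReal.toReal_pos volume_unitDomain_ne_zero volume_unitDomain_ne_top
  have hV1 : 0 < (simplexVolume K).toReal :=
    ENNReal.toReal_pos volume_openSimplex_one_ne_zero volume_openSimplex_one_ne_top
  have hV1top : simplexVolume K ≠ ⊤ := volume_openSimplex_one_ne_top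
  have hw : (0 : ℝ) < torsionOrder K := by exact_mod_cast (torsionOrder K).pos_of_neZero
  have hh : (0 : ℝ) < Fintype.card (ClassGroup (𝓞 K)) := by exact_mod_cast Fintype.card_pos
  have hκ : (0 : ℝ) < convexBodyLTFactor K := by
    exact_mod_cast pos_iff_ne_zero.mpr (convexBodyLTFactor_ne_zero K)
  set co := (integerCovolume K).toReal with hco_def
  set V := (volume (unitDomain K)).toReal with hV_def
  set V1 := (simplexVolume K).toReal
  set w : ℝ := ((torsionOrder K : ℕ) : ℝ) with hw_def
  set h : ℝ := ((Fintype.card (ClassGroup (𝓞 K)) : ℕ) : ℝ) with hh_def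
  set κ : ℝ := ((convexBodyLTFactor K : ℝ≥0) : ℝ)
  refine ⟨h * κ * V / (w * V1 * co), h * V / (w * V1), by positivity, by positivity, ?_, ?_⟩
  · have h1 := ENNReal.toReal_mono (by finiteness) hb.integerCovolume_le_pow
    rw [ENNReal.toReal_mul, ENNReal.toReal_pow, ENNReal.coe_toReal, ENNReal.coe_toReal] at h1
    push_cast at h1
    change co ≤ κ * _ at h1
    rw [div_mul_eq_mul_div, div_le_div_iff₀ (by positivity) (by positivity)]
    have := mul_le_mul_of_nonneg_left h1 (by positivity : 0 ≤ h * V * (w * V1))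
    linarith
  · intro v
    have key := congrArg (integerCovolume K * ·) (sum_setLIntegral_latticeCount K v)
    simp only [Finset.mul_sum] at key
    have hR := riesz_idealCount_nonneg (K := K) (rank K) v
    set R := riesz (idealCount K) (rank K) v
    have keyR : (integerCovolume K * (Fintype.card (ClassGroup (𝓞 K)) * volume (unitDomain K) +
        torsionOrder K * simplexVolume K * ENNReal.ofReal R)).toReal =
        co * (h * V + w * V1 * R) := by
      rw [ENNReal.toReal_mul, ENNReal.toReal_add, ENNReal.toReal_mul, ENNReal.toReal_mul,
        ENNReal.toReal_mul, ENNReal.toReal_ofReal hR, ENNReal.toReal_natCast,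
        ENNReal.toReal_natCast]
      · exact ENNReal.mul_ne_top (by finiteness) volume_unitDomain_ne_top
      · exact ENNReal.mul_ne_top (ENNReal.mul_ne_top (by finiteness)
          hV1top) (by finiteness)
    have hsum : ∀ z : ℝ, 0 ≤ z → (∑ C : ClassGroup (𝓞 K), convexBodyLTFactor K *
        volume (unitDomain K) * ENNReal.ofReal z).toReal = h * κ * V * z := by
      intro z hz
      rw [Finset.sum_const, nsmul_eq_mul, ENNReal.toReal_mul, ENNReal.toReal_mul,
        ENNReal.toReal_mul, ENNReal.toReal_ofReal hz, Finset.card_univ, ENNReal.toReal_natCast,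
        ENNReal.coe_toReal]
      ring
    constructor
    · have h1 := Finset.sum_le_sum fun (C : ClassGroup (𝓞 K)) (_ : C ∈ Finset.univ) =>
        hb.covolume_mul_setLIntegral_le v C
      rw [key] at h1
      have h2 := ENNReal.toReal_mono (ENNReal.sum_ne_top.mpr fun C _ =>
        ENNReal.mul_ne_top (ENNReal.mul_ne_top (by finiteness) volume_unitDomain_ne_top)
          (by finiteness)) h1
      rw [keyR, hsum _ (by positivity)] at h2
      rw [← sub_nonneg] at h2 ⊢
      refine le_of_le_of_eq (div_nonneg h2 (by positivity : 0 ≤ w * V1 * co)) ?_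
      field_simp
      ring
    · intro hle
      have h1 := Finset.sum_le_sum fun (C : ClassGroup (𝓞 K)) (_ : C ∈ Finset.univ) =>
        hb.le_covolume_mul_setLIntegral v hle C
      rw [key] at h1
      have h2 := ENNReal.toReal_mono (ENNReal.mul_ne_top integerCovolume_ne_top
        (ENNReal.add_ne_top.mpr ⟨ENNReal.mul_ne_top (by finiteness) volume_unitDomain_ne_top,
          ENNReal.mul_ne_top (ENNReal.mul_ne_top (by finiteness)
          hV1top) (by finiteness)⟩)) h1
      rw [keyR, hsum _ (pow_nonneg (sub_nonneg.mpr hle) _)] at h2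
      rw [← sub_nonneg] at h2 ⊢
      refine le_of_le_of_eq (div_nonneg h2 (by positivity : 0 ≤ w * V1 * co)) ?_
      field_simp
      ring

theorem add_pow_succ_le {Z Y : ℝ} (hZ : 1 ≤ Z) (hY : 0 ≤ Y) (m : ℕ) :
    (Z + Y) ^ (m + 1) ≤ Z ^ (m + 1) + ((1 + Y) ^ (m + 1) - 1) * Z ^ m := by
  induction m with
  | zero => simp
  | succ m ih =>
    have h1 := mul_le_mul_of_nonneg_left ih (by linarith : 0 ≤ Z + Y)
    have h2 : 1 ≤ (1 + Y) ^ (m + 1) := one_le_pow₀ (by linarith)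
    have h3 : 0 ≤ Y * ((1 + Y) ^ (m + 1) - 1) * (Z ^ (m + 1) - Z ^ m) :=
      mul_nonneg (mul_nonneg hY (by linarith))
        (sub_nonneg.mpr (pow_le_pow_right₀ hZ (Nat.le_succ m)))
    rw [pow_succ' (Z + Y), pow_succ' (1 + Y)]
    refine h1.trans (sub_nonneg.mp (le_of_le_of_eq h3 ?_))
    ring

/-- The error constant in the ideal counting estimate. -/
noncomputable def errorConst (n : ℕ) (A : ℝ) : ℝ := 3 * (1 + 5 * (n * A) ^ 2) ^ n

theorem BoundedBasis.exists_abs_riesz_sub_le (hb : BoundedBasis b A) :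
    ∃ c : ℝ, 0 < c ∧ ∀ v : ℝ, 0 < v →
      |riesz (idealCount K) (rank K) v - c * Real.exp v| ≤
        c * errorConst (finrank ℚ K) A * Real.exp ((1 - 1 / finrank ℚ K) * v) := by
  obtain ⟨c, B, hc, hB, hBY, H⟩ := hb.exists_riesz_bounds
  refine ⟨c, hc, fun v hv => ?_⟩
  obtain ⟨H1, H2⟩ := H v
  have hR := riesz_idealCount_nonneg (K := K) (rank K) v
  set R := riesz (idealCount K) (rank K) v
  have hn : 0 < finrank ℚ K := finrank_pos
  rw [errorConst]
  set n := finrank ℚ K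
  set Y : ℝ := 5 * (n * A) ^ 2
  have hY : 0 ≤ Y := by positivity
  set Z := Real.exp (v / n)
  have hn' : (0 : ℝ) < n := by exact_mod_cast hn
  have hZ1 : 1 ≤ Z := Real.one_le_exp (by positivity)
  have hZn : Real.exp v = Z * Z ^ (n - 1) := by
    rw [← pow_succ', Nat.sub_add_cancel hn, ← Real.exp_nat_mul, mul_div_cancel₀ _ hn'.ne']
  have hZn1 : Real.exp ((1 - 1 / n) * v) = Z ^ (n - 1) := by
    rw [← Real.exp_nat_mul, Nat.cast_sub hn]
    congr 1
    field_simp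
    simp
  have hZ0 : 0 < Z := by linarith
  have hP1 : 1 ≤ Z ^ (n - 1) := one_le_pow₀ hZ1
  have hbern : 1 + n * Y ≤ (1 + Y) ^ n := one_add_mul_le_pow (by linarith) n
  have hYn : Y ^ n ≤ (1 + Y) ^ n := pow_le_pow_left₀ hY (by linarith) n
  have hn1 : (1 : ℝ) ≤ n := by exact_mod_cast hn
  have hYY : Y ≤ n * Y := le_mul_of_one_le_left hY hn1
  rw [hZn1, abs_le]
  constructor
  · by_cases hYZ : Y ≤ Z
    · have h3 := H2 hYZ
      have h4 : Z ^ n - n * Y * Z ^ (n - 1) ≤ (Z - Y) ^ n := by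
        have h5 := one_add_mul_le_pow (a := -(Y / Z)) (by
          have : Y / Z ≤ 1 := (div_le_one hZ0).mpr hYZ
          linarith) n
        have h6 := mul_le_mul_of_nonneg_left h5 (pow_pos hZ0 n).le
        rw [← mul_pow] at h6
        have h7 : Z * (1 + -(Y / Z)) = Z - Y := by field_simp; ring
        rw [h7] at h6
        refine le_trans (le_of_eq ?_) h6
        have h8 : Z ^ n = Z * Z ^ (n - 1) := by rw [← pow_succ', Nat.sub_add_cancel hn]
        rw [h8]
        field_simp
        ring
      have h8 : Z ^ n = Z * Z ^ (n - 1) := by rw [← pow_succ', Nat.sub_add_cancel hn]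
      rw [h8] at h4
      rw [hZn]
      have h9 := mul_le_mul_of_nonneg_left h4 hc.le
      have h10 : n * Y * Z ^ (n - 1) + Y ^ n ≤ 3 * (1 + Y) ^ n * Z ^ (n - 1) := by
        have := mul_le_mul_of_nonneg_right (show n * Y ≤ (1 + Y) ^ n by linarith)
          (by linarith : 0 ≤ Z ^ (n - 1))
        have h11 : (1 + Y) ^ n ≤ (1 + Y) ^ n * Z ^ (n - 1) :=
          le_mul_of_one_le_right (by positivity) hP1
        nlinarith
      have := mul_le_mul_of_nonneg_left h10 hc.le
      linarith
    · rw [hZn]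
      have h1 : Z ≤ 3 * (1 + Y) ^ n := by nlinarith [pow_pos (by linarith : 0 < 1 + Y) n]
      have := mul_le_mul_of_nonneg_left h1 (by positivity : 0 ≤ c * Z ^ (n - 1))
      linarith
  · rw [hZn]
    have h1 : (Z + Y) ^ n ≤ Z * Z ^ (n - 1) + (1 + Y) ^ n * Z ^ (n - 1) := by
      obtain ⟨m, hm⟩ : ∃ m, n = m + 1 := ⟨n - 1, by omega⟩
      rw [hm, Nat.add_sub_cancel, ← pow_succ']
      have := add_pow_succ_le hZ1 hY m
      nlinarith [pow_pos hZ0 m]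
    have h2 := mul_le_mul_of_nonneg_left h1 hc.le
    have : 0 ≤ c * ((1 + Y) ^ n * Z ^ (n - 1)) := by positivity
    linarith

end

section
open Set Module NumberField IsDedekindDomain UniqueFactorizationMonoid
open scoped ENNReal NNReal nonZeroDivisors

variable {K : Type*} [Field K] [NumberField K]

variable (K) in
/-- Indices of positive powers of prime ideals. -/
abbrev PrimePowerIndex : Type _ := HeightOneSpectrum (𝓞 K) × ℕ

/-- The prime power ideal attached to an index. -/
noncomputable def PrimePowerIndex.toIdeal (x : PrimePowerIndex K) : (Ideal (𝓞 K))⁰ :=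
  ⟨x.1.asIdeal ^ (x.2 + 1), mem_nonZeroDivisors_of_ne_zero (pow_ne_zero _ x.1.ne_bot)⟩

/-- The logarithm of the norm of the prime underlying a prime power. -/
noncomputable def PrimePowerIndex.logNorm (x : PrimePowerIndex K) : ℝ≥0∞ :=
  ENNReal.ofReal (Real.log (Ideal.absNorm x.1.asIdeal))

/-- The norm of a nonzero ideal. -/
noncomputable abbrev idealNorm (I : (Ideal (𝓞 K))⁰) : ℕ := Ideal.absNorm (I : Ideal (𝓞 K))

theorem tsum_ite_succ_le (c : ℕ) (L : ℝ≥0∞) : (∑' j : ℕ, if j + 1 ≤ c then L else 0) = c * L := by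
  rw [tsum_eq_sum (s := Finset.range c)]
  · rw [Finset.sum_congr rfl fun j hj => if_pos (Nat.succ_le_of_lt (Finset.mem_range.mp hj))]
    simp
  · intro j hj
    rw [if_neg]
    simpa using hj

open scoped Classical in
theorem tsum_toIdeal_dvd (I : (Ideal (𝓞 K))⁰) :
    (∑' x : PrimePowerIndex K, if x.toIdeal ∣ I then x.logNorm else 0) =
      ENNReal.ofReal (Real.log (idealNorm I)) := by
  have h1 : ∀ (J : Ideal (𝓞 K)) (P : HeightOneSpectrum (𝓞 K)) (j : ℕ), J ≠ 0 →
      (P.asIdeal ^ (j + 1) ∣ J ↔ j + 1 ≤ (normalizedFactors J).count P.asIdeal) := by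
    intro J P j hJ
    rw [pow_dvd_iff_le_emultiplicity,
      emultiplicity_eq_count_normalizedFactors P.irreducible hJ, normalize_eq]
    norm_cast
  have h2 : ∀ J : Ideal (𝓞 K), J ≠ 0 →
      ∑' P : HeightOneSpectrum (𝓞 K), ((normalizedFactors J).count P.asIdeal : ℝ≥0∞) *
        ENNReal.ofReal (Real.log (Ideal.absNorm P.asIdeal)) =
      ENNReal.ofReal (Real.log (Ideal.absNorm J)) := by
    intro J
    induction J using induction_on_prime with
    | h₁ => simp
    | h₂ J hJ =>
      intro _
      rw [Ideal.isUnit_iff.mp hJ, ← Ideal.one_eq_top, normalizedFactors_one]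
      simp
    | h₃ J P hJ hP ih =>
      intro _
      have hPr : Ideal.absNorm P ≠ 0 := Ideal.absNorm_eq_zero_iff.not.mpr hP.ne_zero
      have hJr : Ideal.absNorm J ≠ 0 := Ideal.absNorm_eq_zero_iff.not.mpr hJ
      rw [normalizedFactors_mul hP.ne_zero hJ, normalizedFactors_irreducible hP.irreducible,
        normalize_eq, map_mul, Nat.cast_mul, Real.log_mul (by exact_mod_cast hPr)
        (by exact_mod_cast hJr), ENNReal.ofReal_add (Real.log_natCast_nonneg _)
        (Real.log_natCast_nonneg _), ← ih hJ]
      simp only [Multiset.count_add, Nat.cast_add, add_mul]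
      rw [ENNReal.tsum_add]
      congr 1
      rw [tsum_eq_single (⟨P, Ideal.isPrime_of_prime hP, hP.ne_zero⟩ : HeightOneSpectrum (𝓞 K))]
      · simp
      · intro Q hQ
        rw [Multiset.count_eq_zero_of_notMem]
        · simp
        · rw [Multiset.mem_singleton]
          exact fun h => hQ (HeightOneSpectrum.ext h)
  rw [ENNReal.tsum_prod', ← h2 _ (nonZeroDivisors.coe_ne_zero I)]
  refine tsum_congr fun P => ?_
  rw [← tsum_ite_succ_le]
  refine tsum_congr fun j => ?_
  have h3 : PrimePowerIndex.toIdeal (P, j) ∣ I ↔ P.asIdeal ^ (j + 1) ∣ (I : Ideal (𝓞 K)) := by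
    constructor
    · rintro ⟨J, rfl⟩
      exact ⟨J, rfl⟩
    · rintro ⟨J, hJ⟩
      have hJ0 : J ≠ 0 := by
        rintro rfl
        rw [mul_zero] at hJ
        exact nonZeroDivisors.coe_ne_zero I hJ
      exact ⟨⟨J, mem_nonZeroDivisors_of_ne_zero hJ0⟩, Subtype.ext hJ⟩
  exact if_congr (h3.trans (h1 _ _ _ (nonZeroDivisors.coe_ne_zero I))) rfl rfl

variable (K) in
open scoped Classical in
/-- The extended von Mangoldt function of a number field, as a function of the norm. -/
noncomputable def eMangoldt (m : ℕ) : ℝ≥0∞ :=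
  ∑' x : PrimePowerIndex K, if idealNorm x.toIdeal = m then x.logNorm else 0

open scoped Classical in
theorem tsum_ite_dvd_eq (J : (Ideal (𝓞 K))⁰) (F : (Ideal (𝓞 K))⁰ → ℝ≥0∞) :
    (∑' I, if J ∣ I then F I else 0) = ∑' I, F (J * I) := by
  have hinj : Function.Injective (fun I : (Ideal (𝓞 K))⁰ => J * I) := fun I I' h =>
    Subtype.ext (mul_left_cancel₀ (nonZeroDivisors.coe_ne_zero J) (congrArg Subtype.val h :))
  rw [← hinj.tsum_eq]
  · exact tsum_congr fun I => if_pos (dvd_mul_right J I)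
  · intro I hI
    by_contra h
    exact hI (if_neg fun ⟨I', hI'⟩ => h ⟨I', hI'.symm⟩)

variable (K) in
theorem idealCount_mul_log_eq (m : ℕ) :
    ENNReal.ofReal (idealCount K m) * ENNReal.ofReal (Real.log m) =
      ∑ p ∈ m.divisorsAntidiagonal, eMangoldt K p.1 * ENNReal.ofReal (idealCount K p.2) := by
  classical
  have hc : ∀ e : ℕ, ENNReal.ofReal (idealCount K e) =
      ∑' J : (Ideal (𝓞 K))⁰, if idealNorm J = e then 1 else 0 := by
    intro e
    rw [tsum_absNorm_eq fun k => if k = e then 1 else 0, tsum_eq_single e]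
    · simp
    · intro k hk
      simp [hk]
  have h1 : ∀ I : (Ideal (𝓞 K))⁰, (if idealNorm I = m then ENNReal.ofReal (Real.log m) else 0) =
      ∑' x : PrimePowerIndex K, if x.toIdeal ∣ I then
        (if idealNorm I = m then x.logNorm else 0) else 0 := by
    intro I
    by_cases h : idealNorm I = m
    · simp only [if_pos h]
      rw [← h, tsum_toIdeal_dvd]
    · simp [if_neg h]
  have h2 : ENNReal.ofReal (idealCount K m) * ENNReal.ofReal (Real.log m) =
      ∑' I : (Ideal (𝓞 K))⁰, if idealNorm I = m then ENNReal.ofReal (Real.log m) else 0 := by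
    rw [hc, ← ENNReal.tsum_mul_right]
    exact tsum_congr fun I => by split_ifs <;> simp
  rw [h2, tsum_congr h1, ENNReal.tsum_comm]
  simp_rw [tsum_ite_dvd_eq]
  rcases Nat.eq_zero_or_pos m with rfl | hm
  · simp only [Nat.divisorsAntidiagonal_zero, Finset.sum_empty, ENNReal.tsum_eq_zero,
      ite_eq_right_iff]
    intro x J h
    exact absurd h (Ideal.absNorm_ne_zero_of_nonZeroDivisors _)
  simp_rw [eMangoldt, hc, ← ENNReal.tsum_mul_left, ← ENNReal.tsum_mul_right]
  rw [← Summable.tsum_finsetSum fun _ _ => ENNReal.summable, ENNReal.tsum_comm]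
  refine tsum_congr fun J => ?_
  rw [← Summable.tsum_finsetSum fun _ _ => ENNReal.summable]
  refine tsum_congr fun x => ?_
  have h3 : idealNorm (x.toIdeal * J) = idealNorm x.toIdeal * idealNorm J := by
    simp [idealNorm]
  by_cases h : idealNorm (x.toIdeal * J) = m
  · rw [if_pos h, Finset.sum_eq_single (idealNorm x.toIdeal, idealNorm J)]
    · simp
    · rintro ⟨d, e⟩ - hde
      by_cases h4 : idealNorm x.toIdeal = d
      · rw [if_neg (c := idealNorm J = e), mul_zero]
        rintro h5
        exact hde (Prod.ext h4.symm h5.symm)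
      · rw [if_neg h4, zero_mul]
    · intro h5
      exact absurd (Nat.mem_divisorsAntidiagonal.mpr ⟨h3.symm.trans h, hm.ne'⟩) h5
  · rw [if_neg h, eq_comm, Finset.sum_eq_zero]
    rintro ⟨d, e⟩ hde
    rw [Nat.mem_divisorsAntidiagonal] at hde
    by_cases h4 : idealNorm x.toIdeal = d
    · rw [if_neg (c := idealNorm J = e), mul_zero]
      rintro h5
      exact h (h3.trans (by rw [h4, h5]; exact hde.1))
    · rw [if_neg h4, zero_mul]

variable (K) in
theorem eMangoldt_le (m : ℕ) (hm : m ≠ 0) :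
    eMangoldt K m ≤ ENNReal.ofReal (finrank ℚ K * Real.log m) := by
  classical
  let I : (Ideal (𝓞 K))⁰ := ⟨Ideal.span {(m : 𝓞 K)}, mem_nonZeroDivisors_of_ne_zero (by
    rw [Ne, Ideal.zero_eq_bot, Ideal.span_singleton_eq_bot]
    exact_mod_cast hm)⟩
  have hI : idealNorm I = m ^ finrank ℚ K := by
    change Ideal.absNorm (Ideal.span {(m : 𝓞 K)}) = _
    rw [Ideal.absNorm_span_singleton, ← map_natCast (algebraMap ℤ (𝓞 K)),
      Algebra.norm_algebraMap, RingOfIntegers.rank, Int.natAbs_pow]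
    simp
  have h1 := tsum_toIdeal_dvd I
  rw [hI, Nat.cast_pow, Real.log_pow, ENNReal.tsum_prod'] at h1
  rw [← h1, eMangoldt, ENNReal.tsum_prod']
  refine ENNReal.tsum_le_tsum fun P => ?_
  have hP1 : 1 < Ideal.absNorm P.asIdeal := by
    have h0 : Ideal.absNorm P.asIdeal ≠ 0 := Ideal.absNorm_eq_zero_iff.not.mpr P.ne_bot
    have h1 : Ideal.absNorm P.asIdeal ≠ 1 := Ideal.absNorm_eq_one_iff.not.mpr P.isPrime.ne_top
    omega
  have hN : ∀ j : ℕ, idealNorm (PrimePowerIndex.toIdeal (P, j)) =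
      Ideal.absNorm P.asIdeal ^ (j + 1) := fun j => by simp [idealNorm, PrimePowerIndex.toIdeal]
  by_cases hex : ∃ j : ℕ, Ideal.absNorm P.asIdeal ^ (j + 1) = m
  · obtain ⟨j, hj⟩ := hex
    have hdvd : PrimePowerIndex.toIdeal (P, 0) ∣ I := by
      have : P.asIdeal ∣ Ideal.span {(m : 𝓞 K)} := by
        rw [Ideal.dvd_span_singleton, ← hj, Nat.cast_pow]
        exact Ideal.pow_mem_of_mem _ (Ideal.absNorm_mem _) _ (Nat.succ_pos _)
      obtain ⟨J, hJ⟩ := this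
      have hJ0 : J ≠ 0 := by
        rintro rfl
        rw [mul_zero] at hJ
        exact nonZeroDivisors.coe_ne_zero I hJ
      exact ⟨⟨J, mem_nonZeroDivisors_of_ne_zero hJ0⟩, Subtype.ext (by
        change Ideal.span {(m : 𝓞 K)} = P.asIdeal ^ (0 + 1) * J
        rw [zero_add, pow_one, hJ])⟩
    rw [tsum_eq_single j]
    · rw [hN, if_pos hj]
      refine le_trans (le_of_eq ?_) (ENNReal.le_tsum 0)
      rw [if_pos hdvd]
      rfl
    · intro k hk
      rw [hN, if_neg]
      intro h
      rw [← hj] at h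
      have := Nat.pow_right_injective hP1 h
      omega
  · push Not at hex
    rw [ENNReal.tsum_eq_zero.mpr]
    · exact zero_le
    · intro j
      rw [hN, if_neg (hex j)]

variable (K) in
/-- The von Mangoldt function of a number field, as a function of the norm. -/
noncomputable def fieldMangoldt (m : ℕ) : ℝ := (eMangoldt K m).toReal

theorem fieldMangoldt_nonneg (m : ℕ) : 0 ≤ fieldMangoldt K m := ENNReal.toReal_nonneg

variable (K) in
theorem fieldMangoldt_le (m : ℕ) (hm : m ≠ 0) :
    fieldMangoldt K m ≤ finrank ℚ K * Real.log m := by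
  have := ENNReal.toReal_mono ENNReal.ofReal_ne_top (eMangoldt_le K m hm)
  rwa [ENNReal.toReal_ofReal
    (mul_nonneg (Nat.cast_nonneg _) (Real.log_natCast_nonneg _))] at this

variable (K) in
theorem idealCount_mul_log (m : ℕ) :
    idealCount K m * Real.log m =
      ∑ p ∈ m.divisorsAntidiagonal, fieldMangoldt K p.1 * idealCount K p.2 := by
  have h := congrArg ENNReal.toReal (idealCount_mul_log_eq K m)
  rw [ENNReal.toReal_mul, ENNReal.toReal_ofReal (idealCount_nonneg _),
    ENNReal.toReal_ofReal (Real.log_natCast_nonneg _), ENNReal.toReal_sum] at h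
  · rw [h]
    refine Finset.sum_congr rfl fun p _ => ?_
    rw [ENNReal.toReal_mul, ENNReal.toReal_ofReal (idealCount_nonneg _), fieldMangoldt]
  · rintro ⟨d, e⟩ hde
    have : d ≠ 0 := by
      rintro rfl
      simp at hde
      omega
    exact ENNReal.mul_ne_top ((eMangoldt_le K d this).trans_lt ENNReal.ofReal_lt_top).ne
      ENNReal.ofReal_ne_top

theorem isPrimePow_of_fieldMangoldt_ne_zero {m : ℕ} (h : fieldMangoldt K m ≠ 0) :
    IsPrimePow m := by
  classical
  have h1 : eMangoldt K m ≠ 0 := fun h0 => h (by rw [fieldMangoldt, h0, ENNReal.toReal_zero])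
  rw [eMangoldt, Ne, ENNReal.tsum_eq_zero, not_forall] at h1
  obtain ⟨⟨P, j⟩, hx⟩ := h1
  have hm : idealNorm (PrimePowerIndex.toIdeal (P, j)) = m := by
    by_contra h0
    exact hx (if_neg h0)
  rw [← hm]
  have h2 : idealNorm (PrimePowerIndex.toIdeal (P, j)) = Ideal.absNorm P.asIdeal ^ (j + 1) := by
    simp [idealNorm, PrimePowerIndex.toIdeal]
  rw [h2]
  refine IsPrimePow.pow ?_ (Nat.succ_ne_zero j)
  have := P.isPrime.isMaximal P.ne_bot
  let := Ideal.Quotient.field P.asIdeal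
  have : Finite (𝓞 K ⧸ P.asIdeal) := Ideal.finiteQuotientOfFreeOfNeBot _ P.ne_bot
  let := Fintype.ofFinite (𝓞 K ⧸ P.asIdeal)
  have h3 := FiniteField.isPrimePow_card (𝓞 K ⧸ P.asIdeal)
  rwa [← Nat.card_eq_fintype_card] at h3

end

section
open Set Module NumberField NumberField.InfinitePlace NumberField.Units
open scoped ENNReal NNReal nonZeroDivisors

variable {K : Type*} [Field K] [NumberField K]

variable (K) in
theorem idealCount_le_pow (m : ℕ) : idealCount K m ≤ (m : ℝ) ^ (finrank ℚ K + 1) := by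
  induction m using Nat.strong_induction_on with
  | _ m ih =>
  rcases Nat.lt_or_ge m 2 with hm | hm
  · interval_cases m
    · simp [idealCount_zero]
    · simp [idealCount_one]
  have hn : 0 < finrank ℚ K := finrank_pos
  set n := finrank ℚ K with hn_def
  have hm0 : m ≠ 0 := by omega
  have hlog : 0 < Real.log m := Real.log_pos (by exact_mod_cast hm)
  have hconv := idealCount_mul_log K m
  have hterm : ∀ p ∈ m.divisorsAntidiagonal, fieldMangoldt K p.1 * idealCount K p.2 ≤
      if 2 ≤ p.1 then n * Real.log m * ((m : ℝ) ^ (n + 1) * ((2 : ℝ) ^ (n - 1))⁻¹ *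
        ((p.1 : ℝ) ^ 2)⁻¹) else 0 := by
    rintro ⟨d, e⟩ hde
    rw [Nat.mem_divisorsAntidiagonal] at hde
    obtain ⟨hde, -⟩ := hde
    simp only at hde ⊢
    have hd0 : d ≠ 0 := by rintro rfl; simp at hde; omega
    have he0 : e ≠ 0 := by rintro rfl; simp at hde; omega
    split_ifs with h2
    · have hem : e < m := by nlinarith [Nat.pos_of_ne_zero he0]
      have h1 : fieldMangoldt K d ≤ n * Real.log m := by
        refine (fieldMangoldt_le K d hd0).trans ?_
        refine mul_le_mul_of_nonneg_left (Real.log_le_log (by positivity) ?_) (by positivity)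
        exact_mod_cast Nat.le_of_dvd (by omega) ⟨e, hde.symm⟩
      refine mul_le_mul h1 ((ih e hem).trans ?_) (idealCount_nonneg _) (by positivity)
      have hd' : (0 : ℝ) < d := by positivity
      have h3 : (2 : ℝ) ^ (n - 1) * (d : ℝ) ^ 2 ≤ (d : ℝ) ^ (n + 1) := by
        have : n + 1 = (n - 1) + 2 := by omega
        rw [this, pow_add]
        gcongr
        exact_mod_cast h2
      rw [← hde, Nat.cast_mul, mul_pow, mul_assoc, ← mul_inv, mul_comm ((d : ℝ) ^ (n + 1)),
        mul_assoc]
      refine le_mul_of_one_le_right (by positivity) ?_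
      rw [← div_eq_mul_inv, one_le_div (by positivity)]
      exact h3
    · have hd1 : d = 1 := by omega
      subst hd1
      have h1 : fieldMangoldt K 1 = 0 :=
        le_antisymm (by simpa using fieldMangoldt_le K 1 one_ne_zero) (fieldMangoldt_nonneg _)
      rw [h1, zero_mul]
  have h5 := hconv.le.trans (Finset.sum_le_sum hterm)
  rw [Nat.sum_divisorsAntidiagonal fun d _ => if 2 ≤ d then n * Real.log m *
    ((m : ℝ) ^ (n + 1) * ((2 : ℝ) ^ (n - 1))⁻¹ * ((d : ℝ) ^ 2)⁻¹) else 0,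
    ← Finset.sum_filter] at h5
  have h6 : ∑ d ∈ m.divisors.filter (fun d => 2 ≤ d), ((d : ℝ) ^ 2)⁻¹ ≤ 1 := by
    refine (Finset.sum_le_sum_of_subset_of_nonneg (t := Finset.Ioc 1 m) ?_
      fun _ _ _ => by positivity).trans ?_
    · intro d hd
      rw [Finset.mem_filter, Nat.mem_divisors] at hd
      exact Finset.mem_Ioc.mpr ⟨hd.2, Nat.le_of_dvd (by omega) hd.1.1⟩
    · refine (sum_Ioc_inv_sq_le_sub one_ne_zero (by omega)).trans ?_
      simp
  rw [← Finset.mul_sum, ← Finset.mul_sum] at h5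
  have h7 : (n : ℝ) * ((2 : ℝ) ^ (n - 1))⁻¹ ≤ 1 := by
    rw [← div_eq_mul_inv, div_le_one (by positivity)]
    have : n - 1 < 2 ^ (n - 1) := Nat.lt_two_pow_self
    have : n ≤ 2 ^ (n - 1) := by omega
    exact_mod_cast this
  refine le_of_mul_le_mul_right (h5.trans ?_) hlog
  have h8 := mul_le_mul h7 h6 (Finset.sum_nonneg fun _ _ => by positivity) zero_le_one
  have := mul_le_mul_of_nonneg_left h8 (by positivity : 0 ≤ (m : ℝ) ^ (n + 1) * Real.log m)
  linarith

theorem rank_add_one_le : rank K + 1 ≤ finrank ℚ K := by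
  have h := card_add_two_mul_card_eq_rank K
  have h2 : 0 < Fintype.card (InfinitePlace K) := Fintype.card_pos
  have h3 := card_eq_nrRealPlaces_add_nrComplexPlaces K
  rw [rank]
  omega

variable {ι : Type*} [Fintype ι] {b : ι → 𝓞 K} {A : ℝ≥0}

/-- The regularity constant of a number field with a bounded basis. -/
noncomputable def regularityConst (n : ℕ) (A : ℝ) : ℝ := (2 * errorConst n A) ^ (n * (2 * n + 3))

theorem three_mul_pow_le_errorConst (n : ℕ) (hn : 0 < n) {A : ℝ} (hA : 1 ≤ A) :
    3 * 6 ^ n ≤ errorConst n A := by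
  have h1 : 1 ≤ (n : ℝ) * A := one_le_mul_of_one_le_of_one_le (by exact_mod_cast hn) hA
  have h2 : 1 ≤ ((n : ℝ) * A) ^ 2 := one_le_pow₀ h1
  rw [errorConst]
  gcongr
  linarith

theorem BoundedBasis.exists_rieszRegular (hb : BoundedBasis b A) {Q : ℝ}
    (hQ : regularityConst (finrank ℚ K) A ≤ Q) :
    ∃ c, RieszRegular (idealCount K) (fieldMangoldt K) (rank K) c Q := by
  obtain ⟨c, hc, H⟩ := hb.exists_abs_riesz_sub_le
  have hn : 0 < finrank ℚ K := finrank_pos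
  have hr := rank_add_one_le (K := K)
  have hE := three_mul_pow_le_errorConst (finrank ℚ K) hn (A := A) (by exact_mod_cast hb.one_le)
  rw [regularityConst] at hQ
  have hpow := idealCount_le_pow K
  set n := finrank ℚ K with hn_def
  set E := errorConst n A
  set r := rank K
  have h6 : (6 : ℝ) ≤ 6 ^ n := by
    calc (6 : ℝ) = 6 ^ 1 := by norm_num
      _ ≤ 6 ^ n := pow_le_pow_right₀ (by norm_num) hn
  have hE1 : 18 ≤ E := by linarith
  have hn' : (0 : ℝ) < n := by exact_mod_cast hn
  have hn1 : (1 : ℝ) ≤ n := by exact_mod_cast hn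
  have hnE : (n : ℝ) ≤ E := by
    have h1 : (n : ℝ) < 2 ^ n := by exact_mod_cast Nat.lt_two_pow_self
    have h2 : (2 : ℝ) ^ n ≤ 6 ^ n := by gcongr; norm_num
    linarith
  have hQk : ∀ k : ℕ, k ≤ n * (2 * n + 3) → (2 * E) ^ k ≤ Q := fun k hk =>
    (pow_le_pow_right₀ (by linarith) hk).trans hQ
  have hk5 : 5 * n ≤ n * (2 * n + 3) := by nlinarith
  have h2E : 2 * E ≤ Q := by simpa using hQk 1 (by omega)
  have hQ2 : 36 ≤ Q := by linarith
  -- lower bound for the leading constant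
  have hclow : 1 ≤ c * (6 * E) := by
    have h1 := H 1 one_pos
    have h2 : 1 ≤ riesz (idealCount K) r 1 := by
      rw [riesz]
      refine le_trans (le_of_eq ?_) (Finset.single_le_sum (f := fun n : ℕ =>
        idealCount K n * (1 - Real.log n) ^ r) (a := 1) ?_ ?_)
      · simp [idealCount_one]
      · intro m hm
        rw [Finset.mem_Ico, Nat.lt_ceil] at hm
        refine mul_nonneg (idealCount_nonneg _) (pow_nonneg (sub_nonneg.mpr ?_) _)
        rw [Real.log_le_iff_le_exp (by exact_mod_cast hm.1)]
        exact hm.2.le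
      · rw [Finset.mem_Ico, Nat.lt_ceil]
        exact ⟨le_rfl, by simp⟩
    have h3 : Real.exp ((1 - 1 / n) * 1) ≤ Real.exp 1 := by
      rw [Real.exp_le_exp]
      have : 0 ≤ (1 : ℝ) / n := by positivity
      linarith
    have h4 := Real.exp_one_lt_d9
    have h5 := (abs_le.mp h1).2
    have h7 := mul_le_mul_of_nonneg_left (h3.trans h4.le) (by positivity : 0 ≤ c * E)
    have h8 := mul_le_mul_of_nonneg_left h4.le hc.le
    have h9 := mul_le_mul_of_nonneg_left hE1 hc.le
    nlinarith
  -- upper bound for the leading constant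
  have hcup : c ≤ (2 * E) ^ (n * (2 * n + 2)) := by
    have h0 : 0 < Real.log (2 * E) := Real.log_pos (by linarith)
    have h1 := H (n * Real.log (2 * E)) (by positivity)
    have h2 : Real.exp (n * Real.log (2 * E)) = (2 * E) ^ n := by
      rw [Real.exp_nat_mul, Real.exp_log (by linarith)]
    have h3 : Real.exp ((1 - 1 / n) * (n * Real.log (2 * E))) = (2 * E) ^ (n - 1) := by
      have : (1 - 1 / (n : ℝ)) * (n * Real.log (2 * E)) = ((n - 1 : ℕ) : ℝ) * Real.log (2 * E) := by
        rw [Nat.cast_sub hn]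
        field_simp
        simp
      rw [this, Real.exp_nat_mul, Real.exp_log (by linarith)]
    rw [h2, h3] at h1
    have h4 := (abs_le.mp h1).1
    have h5 : c ≤ riesz (idealCount K) r (n * Real.log (2 * E)) := by
      have h6 : (2 * E) ^ n = 2 * E * (2 * E) ^ (n - 1) := by
        rw [← pow_succ', Nat.sub_add_cancel hn]
      rw [h6] at h4
      have h7 : 1 ≤ E * (2 * E) ^ (n - 1) :=
        one_le_mul_of_one_le_of_one_le (by linarith) (one_le_pow₀ (by linarith))
      have := mul_le_mul_of_nonneg_left h7 hc.le
      linarith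
    refine h5.trans ?_
    have hX1 : 1 ≤ (2 * E) ^ n := one_le_pow₀ (by linarith)
    rw [riesz, h2]
    set X := (2 * E) ^ n
    have hlogX : n * Real.log (2 * E) ≤ X := by
      rw [← Real.log_pow]
      exact (Real.log_le_sub_one_of_pos (by positivity)).trans (by linarith)
    calc _ ≤ ∑ m ∈ Finset.Ico 1 ⌈X⌉₊, X ^ (n + 1) * X ^ n := by
          refine Finset.sum_le_sum fun m hm => ?_
          rw [Finset.mem_Ico, Nat.lt_ceil] at hm
          have hm1 : (1 : ℝ) ≤ m := by exact_mod_cast hm.1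
          have h8 : Real.log m ≤ n * Real.log (2 * E) := by
            rw [← Real.log_pow]
            exact Real.log_le_log (by linarith) hm.2.le
          refine mul_le_mul ((hpow m).trans (pow_le_pow_left₀ (by linarith) hm.2.le _)) ?_
            (pow_nonneg (sub_nonneg.mpr h8) _) (by positivity)
          refine (pow_le_pow_left₀ (sub_nonneg.mpr h8)
            (?_ : n * Real.log (2 * E) - Real.log m ≤ X) r).trans
            (pow_le_pow_right₀ hX1 (by omega))
          have := Real.log_nonneg hm1
          linarith
      _ ≤ X * (X ^ (n + 1) * X ^ n) := by
          rw [Finset.sum_const, nsmul_eq_mul, Nat.card_Ico]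
          refine mul_le_mul_of_nonneg_right ?_ (by positivity)
          have h9 := Nat.ceil_lt_add_one (by linarith : 0 ≤ X)
          have h10 : 1 ≤ ⌈X⌉₊ := Nat.one_le_ceil_iff.mpr (by linarith)
          rw [Nat.cast_sub h10]
          push_cast
          linarith
      _ = (2 * E) ^ (n * (2 * n + 2)) := by
          rw [pow_mul]
          ring
  have hcE : c * E ≤ Q := by
    refine le_trans ?_ hQ
    have h1 : n * (2 * n + 3) = n * (2 * n + 2) + n := by ring
    rw [h1, pow_add]
    refine mul_le_mul hcup ?_ (by linarith) (by positivity)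
    calc E ≤ (2 * E) ^ 1 := by linarith
      _ ≤ (2 * E) ^ n := pow_le_pow_right₀ (by linarith) hn
  refine ⟨c, ⟨idealCount_nonneg, fieldMangoldt_nonneg, idealCount_one K, idealCount_mul_log K,
    by linarith, ?_, ?_, ?_, ?_, ?_⟩⟩
  · rw [div_le_iff₀ (by linarith)]
    refine hclow.trans (mul_le_mul_of_nonneg_left ?_ hc.le)
    have := hQk 2 (by omega)
    nlinarith
  · exact hcup.trans (hQk _ (by nlinarith))
  · calc (r.factorial : ℝ) ≤ (n : ℝ) ^ n := by
          exact_mod_cast (Nat.factorial_le (by omega : r ≤ n)).trans (Nat.factorial_le_pow n)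
      _ ≤ (2 * E) ^ n := by gcongr; linarith
      _ ≤ Q := hQk n (by omega)
  · calc (5 : ℝ) ^ (r + 1) ≤ 5 ^ n := pow_le_pow_right₀ (by norm_num) hr
      _ ≤ (2 * E) ^ n := by gcongr; linarith
      _ ≤ Q := hQk n (by omega)
  · intro v hv
    refine (H v hv).trans (mul_le_mul hcE ?_ (by positivity) (by linarith))
    rw [Real.exp_le_exp]
    refine mul_le_mul_of_nonneg_right ?_ hv.le
    have : 1 / Q ≤ 1 / n := one_div_le_one_div_of_le hn' (by linarith)
    linarith

end

section
open Set Module NumberField NumberField.InfinitePlace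
open scoped ENNReal NNReal nonZeroDivisors

section
variable {K : Type*} [Field K] [NumberField K]

theorem abs_trace_le {x : 𝓞 K} {B : ℝ} (hx : ∀ w : InfinitePlace K, w x ≤ B) :
    |(Algebra.trace ℤ (𝓞 K) x : ℝ)| ≤ finrank ℚ K * B := by
  have h := trace_eq_sum_embeddings (K := ℚ) (L := K) (E := ℂ) (x := (x : K))
  rw [← Algebra.coe_trace_int] at h
  have h1 : ‖((Algebra.trace ℤ (𝓞 K) x : ℤ) : ℂ)‖ = |(Algebra.trace ℤ (𝓞 K) x : ℝ)| := by simp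
  have h2 : ((Algebra.trace ℤ (𝓞 K) x : ℤ) : ℂ) = ∑ σ : K →ₐ[ℚ] ℂ, σ x := by
    rw [← h]; simp
  rw [← h1, h2]
  refine (norm_sum_le _ _).trans ((Finset.sum_le_card_nsmul _ _ B fun σ _ => ?_).trans ?_)
  · exact hx (InfinitePlace.mk (σ : K →+* ℂ))
  · rw [nsmul_eq_mul, Finset.card_univ, AlgHom.card]

namespace BoundedBasis
variable {ι : Type*} [Fintype ι] {b : ι → 𝓞 K} {A : ℝ≥0}

theorem linearIndependent (hb : BoundedBasis b A) :
    LinearIndependent ℚ fun i => (b i : K) :=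
  linearIndependent_of_top_le_span_of_card_eq_finrank hb.span.ge hb.card

/-- The discriminant of a bounded basis conducts the ring of integers into its span. -/
theorem exists_conductor (hb : BoundedBasis b A) :
    ∃ D : ℕ, D ≠ 0 ∧
      (D : ℝ) ≤ (finrank ℚ K).factorial * (finrank ℚ K * (A : ℝ) ^ 2) ^ finrank ℚ K ∧
      ∀ x : 𝓞 K, (D : 𝓞 K) * x ∈ Submodule.span ℤ (range b) := by
  classical
  set T := Algebra.traceMatrix ℤ b with hT
  let B : Basis ι ℚ K := Basis.mk hb.linearIndependent hb.span.ge
  have hB : ∀ i, B i = b i := fun i => by simp [B]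
  have hTQ : Algebra.traceMatrix ℚ B = T.map (Int.castRingHom ℚ) := by
    ext i j
    rw [Algebra.traceMatrix_apply, Matrix.map_apply, hT, Algebra.traceMatrix_apply,
      Algebra.traceForm_apply, Algebra.traceForm_apply, hB, hB, eq_intCast,
      Algebra.coe_trace_int]
    rfl
  have hdet : (T.det : ℚ) = (Algebra.traceMatrix ℚ B).det := by
    rw [hTQ, ← RingHom.mapMatrix_apply, ← RingHom.map_det, eq_intCast]
  have hT0 : T.det ≠ 0 := by
    intro h0
    refine Algebra.discr_not_zero_of_basis ℚ B ?_
    rw [Algebra.discr_def, ← hdet, h0, Int.cast_zero]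
  have hmem : ∀ x : 𝓞 K, (T.det : 𝓞 K) * x ∈ Submodule.span ℤ (range b) := by
    intro x
    let t : ι → ℤ := fun i => Algebra.trace ℤ (𝓞 K) (x * b i)
    let c : ι → ℤ := T.adjugate.mulVec t
    have hc : ∀ i, (c i : ℚ) = T.det * B.equivFun (x : K) i := by
      have h1 : (Algebra.traceMatrix ℚ B).mulVec (B.equivFun (x : K)) = fun i => (t i : ℚ) := by
        rw [Algebra.traceMatrix_of_basis_mulVec]
        ext i
        rw [hB, Algebra.coe_trace_int]
        rfl
      have h2 : (fun i => (c i : ℚ)) = (Algebra.traceMatrix ℚ B).adjugate.mulVec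
          fun i => (t i : ℚ) := by
        ext i
        rw [hTQ, ← RingHom.mapMatrix_apply, ← RingHom.map_adjugate]
        simp [c, Matrix.mulVec, dotProduct]
      intro i
      have h3 := congrFun h2 i
      rw [← h1, Matrix.mulVec_mulVec, Matrix.adjugate_mul, Matrix.smul_mulVec, Matrix.one_mulVec,
        ← hdet, Pi.smul_apply, smul_eq_mul] at h3
      exact h3
    have h4 : (T.det : 𝓞 K) * x = ∑ i, c i • b i := by
      refine RingOfIntegers.ext ?_
      simp only [map_mul, map_sum, map_intCast]
      conv_lhs => rw [← B.sum_equivFun (algebraMap (𝓞 K) K x), Finset.mul_sum]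
      refine Finset.sum_congr rfl fun i _ => ?_
      rw [hB, zsmul_eq_mul, map_mul, map_intCast, ← Rat.cast_intCast (c i), hc, Rat.cast_mul,
        Rat.cast_intCast, Algebra.smul_def, eq_ratCast, mul_assoc]
    rw [h4]
    exact Submodule.sum_mem _ fun i _ => Submodule.smul_mem _ _
      (Submodule.subset_span (mem_range_self i))
  refine ⟨T.det.natAbs, Int.natAbs_ne_zero.2 hT0, ?_, fun x => ?_⟩
  · have hle := Matrix.det_le (A := T.map (Int.castRingHom ℝ)) (abv := AbsoluteValue.abs)
      (x := finrank ℚ K * (A : ℝ) ^ 2) (fun i j => by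
        rw [Matrix.map_apply, hT, Algebra.traceMatrix_apply, Algebra.traceForm_apply]
        refine abs_trace_le fun w => ?_
        rw [RingOfIntegers.coe_eq_algebraMap, map_mul, map_mul, sq]
        exact mul_le_mul (hb.le i w) (hb.le j w) (apply_nonneg _ _) A.2)
    rw [← RingHom.mapMatrix_apply, ← RingHom.map_det, eq_intCast, hb.card, nsmul_eq_mul] at hle
    rwa [Nat.cast_natAbs, Int.cast_abs]
  · rcases Int.natAbs_eq T.det with h | h
    · have := hmem x
      rwa [h, Int.cast_natCast] at this
    · have := Submodule.neg_mem _ (hmem x)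
      rw [h] at this
      simpa using this

/-- Any finite system of bounded integers spanning the field contains a bounded basis. -/
theorem exists_of_span {S : Set (𝓞 K)} (hS : S.Finite) {A : ℝ≥0} (hA : 1 ≤ A)
    (hspan : Submodule.span ℚ ((fun x : 𝓞 K => (x : K)) '' S) = ⊤)
    (hle : ∀ x ∈ S, ∀ w : InfinitePlace K, w x ≤ A) :
    ∃ (n : ℕ) (b : Fin n → 𝓞 K), BoundedBasis b A ∧ range b ⊆ S := by
  obtain ⟨s, hs, hspan', hli⟩ := exists_linearIndependent ℚ ((fun x : 𝓞 K => (x : K)) '' S)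
  have hfin : s.Finite := (hS.image _).subset hs
  have := hfin.fintype
  have hcard : Fintype.card s = finrank ℚ K := by
    rw [finrank_eq_card_basis (Basis.mk hli (by rw [Subtype.range_coe, hspan', hspan]))]
  choose g hgS hg using fun x : s => hs x.2
  let e := Fintype.equivFin s
  refine ⟨_, fun i => g (e.symm i), ⟨?_, ?_, hA, fun i w => hle _ (hgS _) w⟩, ?_⟩
  · rw [← hspan, ← hspan']
    congr 1
    ext y
    simp only [mem_range]
    constructor
    · rintro ⟨i, rfl⟩
      rw [show ((g (e.symm i) : 𝓞 K) : K) = e.symm i from hg _]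
      exact (e.symm i).2
    · intro hy
      exact ⟨e ⟨y, hy⟩, by rw [e.symm_apply_apply]; exact hg ⟨y, hy⟩⟩
  · rw [Fintype.card_fin, hcard]
  · rintro _ ⟨i, rfl⟩
    exact hgS _

end BoundedBasis
end

end

section
open Set Module NumberField NumberField.InfinitePlace
open scoped ENNReal NNReal nonZeroDivisors

section
variable {K : Type*} [Field K] [NumberField K]

theorem fieldMangoldt_prime {p : ℕ} (hp : p.Prime) :
    fieldMangoldt K p = idealCount K p * Real.log p := by
  have h1 : fieldMangoldt K 1 = 0 :=
    le_antisymm (by simpa using fieldMangoldt_le K 1 one_ne_zero) (fieldMangoldt_nonneg _)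
  rw [idealCount_mul_log, Nat.sum_divisorsAntidiagonal fun x y => fieldMangoldt K x * idealCount K y,
    hp.sum_divisors]
  simp [h1, idealCount_one, Nat.div_self hp.pos]

section
variable {R : Type*} [CommRing R] {p : ℕ}

theorem RingHom.surjective_of_zmod (φ : R →+* ZMod p) : Function.Surjective φ := fun y => by
  obtain ⟨n, rfl⟩ := ZMod.intCast_surjective y
  exact ⟨n, map_intCast φ n⟩

theorem RingHom.eq_of_ker_eq_zmod {φ ψ : R →+* ZMod p} (h : RingHom.ker φ = RingHom.ker ψ) :
    φ = ψ := by
  ext x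
  obtain ⟨n, hn⟩ := ZMod.intCast_surjective (φ x)
  have : x - n ∈ RingHom.ker φ := by rw [RingHom.mem_ker, map_sub, map_intCast, hn, sub_self]
  rw [h, RingHom.mem_ker, map_sub, map_intCast, sub_eq_zero, hn] at this
  exact this.symm

end

/-- Ideals of prime norm correspond to reductions onto the prime field. -/
theorem idealCount_prime {p : ℕ} (hp : p.Prime) :
    idealCount K p = Nat.card (𝓞 K →+* ZMod p) := by
  have := Fact.mk hp
  have hnorm : ∀ φ : 𝓞 K →+* ZMod p, Ideal.absNorm (RingHom.ker φ) = p := fun φ => by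
    rw [Ideal.absNorm_apply, Submodule.cardQuot_apply]
    exact (Nat.card_congr (RingHom.quotientKerEquivOfSurjective
      φ.surjective_of_zmod).toEquiv).trans (Nat.card_zmod p)
  rw [idealCount, Nat.cast_inj]
  symm
  refine Nat.card_eq_of_bijective (fun φ : 𝓞 K →+* ZMod p =>
    (⟨⟨RingHom.ker φ, mem_nonZeroDivisors_of_ne_zero fun h0 => ?_⟩, hnorm φ⟩ :
      {I : (Ideal (𝓞 K))⁰ // Ideal.absNorm (I : Ideal (𝓞 K)) = p})) ⟨fun φ ψ h => ?_, ?_⟩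
  · have := hnorm φ
    rw [h0] at this
    simp [hp.ne_zero.symm] at this
  · exact RingHom.eq_of_ker_eq_zmod (by simpa using h)
  · rintro ⟨⟨I, hI0⟩, hI⟩
    have hcard : Nat.card (𝓞 K ⧸ I) = p := by
      rw [← hI, Ideal.absNorm_apply, Submodule.cardQuot_apply]
    have : Finite (𝓞 K ⧸ I) := Nat.finite_of_card_ne_zero (by rw [hcard]; exact hp.ne_zero)
    have := Fintype.ofFinite (𝓞 K ⧸ I)
    let e := ZMod.ringEquivOfPrime (𝓞 K ⧸ I) hp (by rw [← Nat.card_eq_fintype_card, hcard])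
    refine ⟨(e.symm : 𝓞 K ⧸ I →+* ZMod p).comp (Ideal.Quotient.mk I), ?_⟩
    rw [Subtype.mk.injEq, Subtype.mk.injEq]
    ext x
    simp [RingHom.mem_ker, Ideal.Quotient.eq_zero_iff_mem]

instance finite_ringHom_zmod {p : ℕ} [Fact p.Prime] : Finite (𝓞 K →+* ZMod p) := by
  refine Finite.of_injective (fun φ : 𝓞 K →+* ZMod p => fun i => φ (RingOfIntegers.basis K i))
    fun φ ψ h => ?_
  have h1 : φ.toIntAlgHom.toLinearMap = ψ.toIntAlgHom.toLinearMap :=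
    (RingOfIntegers.basis K).ext fun i => congrFun h i
  ext x
  exact LinearMap.congr_fun h1 x

end

/-- A homomorphism to a field extends from a quotient of `A` to any overring `R` conducted into it
by an integer that stays invertible. -/
theorem RingHom.exists_extension_of_conductor {A R k : Type*} [CommRing A] [CommRing R] [Field k]
    (e : A →+* R) (χ : A →+* k) (hker : ∀ g, e g = 0 → χ g = 0) (D : ℕ) (hD : (D : k) ≠ 0)
    (hcond : ∀ x : R, ∃ g, e g = D * x) :
    ∃ φ : R →+* k, ∀ g, φ (e g) = χ g := by
  have heq : ∀ g h, e g = e h → χ g = χ h := fun g h hgh => by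
    rw [← sub_eq_zero, ← map_sub]
    exact hker _ (by rw [map_sub, hgh, sub_self])
  choose g hg using hcond
  have hφ : ∀ h, χ (g (e h)) / D = χ h := fun h => by
    rw [div_eq_iff hD, ← map_natCast χ, ← map_mul]
    exact heq _ _ (by rw [hg, map_mul, map_natCast, mul_comm])
  refine ⟨{ toFun := fun x => χ (g x) / D, map_one' := ?_, map_mul' := ?_, map_zero' := ?_,
            map_add' := ?_ }, hφ⟩
  · simpa using hφ 1
  · intro x y
    rw [div_mul_div_comm, div_eq_div_iff hD (mul_ne_zero hD hD), ← map_natCast χ, ← map_mul,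
      ← map_mul, ← map_mul, ← map_mul]
    refine heq _ _ ?_
    simp only [map_mul, hg, map_natCast]
    ring
  · simpa using hφ 0
  · intro x y
    rw [← add_div, ← map_add]
    congr 1
    exact heq _ _ (by rw [map_add, hg, hg, hg, mul_add])

end

section
open Set Module NumberField Polynomial

variable {F M : Type*} [Field F] [Field M] [Algebra F M]

/-- The number of roots modulo `p` of an integer polynomial. -/
noncomputable def rootCount (f : ℤ[X]) (p : ℕ) : ℕ := Nat.card {y : ZMod p // aeval y f = 0}

theorem RingHom.ext_of_conductor {R k : Type*} [CommRing R] [Field k] {s : Set R}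
    (φ ψ : R →+* k) (D : ℕ) (hD : (D : k) ≠ 0)
    (hcond : ∀ x : R, (D : R) * x ∈ Algebra.adjoin ℤ s) (h : EqOn φ ψ s) : φ = ψ := by
  have h1 : EqOn φ.toIntAlgHom ψ.toIntAlgHom (Algebra.adjoin ℤ s) :=
    AlgHom.eqOn_adjoin_iff.2 h
  ext x
  have h2 : φ (D * x) = ψ (D * x) := h1 (hcond x)
  rw [map_mul, map_mul, map_natCast, map_natCast] at h2
  exact mul_left_cancel₀ hD h2

theorem card_ringHom_le {q p : ℕ} (hq : q.Prime) [Fact p.Prime] {f : ℤ[X]}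
    {θ ζ : 𝓞 F} (hθ : aeval θ f = 0) (hζ : IsPrimitiveRoot ζ q) {D : ℕ} (hD : (D : ZMod p) ≠ 0)
    (hcond : ∀ x : 𝓞 F, (D : 𝓞 F) * x ∈ Algebra.adjoin ℤ {θ, ζ}) :
    Nat.card (𝓞 F →+* ZMod p) ≤ (q - 1) * rootCount f p := by
  classical
  have hcyc : aeval ζ (cyclotomic q ℤ) = 0 := by
    rw [aeval_def, eval₂_eq_eval_map, map_cyclotomic]
    exact hζ.isRoot_cyclotomic hq.pos
  have hev : ∀ (φ : 𝓞 F →+* ZMod p) (x : 𝓞 F) (g : ℤ[X]), aeval x g = 0 →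
      aeval (φ x) g = 0 := fun φ x g hg => by
    have := aeval_algHom_apply φ.toIntAlgHom x g
    rw [hg, map_zero] at this
    exact this
  have hC : cyclotomic q (ZMod p) ≠ 0 := cyclotomic_ne_zero _ _
  have hcount : Nat.card {y : ZMod p // aeval y (cyclotomic q ℤ) = 0} ≤ q - 1 := by
    rw [← Nat.totient_prime hq, ← natDegree_cyclotomic q (ZMod p)]
    refine le_trans ?_ (card_roots' _)
    refine le_trans (le_of_eq ?_) (Multiset.toFinset_card_le _)
    rw [← Nat.card_eq_finsetCard]
    refine Nat.card_congr (Equiv.subtypeEquivRight fun y => ?_)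
    rw [Multiset.mem_toFinset, mem_roots hC, IsRoot.def, aeval_def, eval₂_eq_eval_map,
      map_cyclotomic]
  have hinj : Nat.card (𝓞 F →+* ZMod p) ≤
      Nat.card ({y : ZMod p // aeval y (cyclotomic q ℤ) = 0} × {y : ZMod p // aeval y f = 0}) := by
    refine Nat.card_le_card_of_injective (fun φ : 𝓞 F →+* ZMod p =>
      (⟨φ ζ, hev φ ζ _ hcyc⟩, ⟨φ θ, hev φ θ _ hθ⟩)) fun φ ψ h => ?_
    simp only [Prod.mk.injEq, Subtype.mk.injEq] at h
    refine RingHom.ext_of_conductor φ ψ D hD hcond ?_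
    rintro x (rfl | rfl)
    · exact h.2
    · exact h.1
  rw [Nat.card_prod] at hinj
  exact hinj.trans (Nat.mul_le_mul_right _ hcount)

theorem card_pow_eq_of_ringHom {q p : ℕ} (hq : q.Prime) [Fact p.Prime] {ζ : 𝓞 F}
    (hζ : IsPrimitiveRoot ζ q) (hqp : (q : ZMod p) ≠ 0) (φ : 𝓞 F →+* ZMod p) {c : ZMod p}
    (hc : c ≠ 0) (hex : ∃ y, y ^ q = c) : Nat.card {y : ZMod p // y ^ q = c} = q := by
  classical
  have : NeZero (q : ZMod p) := ⟨hqp⟩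
  have hζ' : IsPrimitiveRoot (φ ζ) q := by
    rw [← isRoot_cyclotomic_iff, IsRoot.def, ← map_cyclotomic q φ, eval_map_apply,
      (hζ.isRoot_cyclotomic hq.pos).eq_zero, map_zero]
  have h1 := hζ'.card_nthRoots c
  rw [if_pos hex] at h1
  rw [← Multiset.toFinset_card_of_nodup (hζ'.nthRoots_nodup hc)] at h1
  refine Eq.trans ?_ h1
  rw [← Nat.card_eq_finsetCard]
  refine Nat.card_congr (Equiv.subtypeEquivRight fun y => ?_)
  rw [Multiset.mem_toFinset, mem_nthRoots hq.pos]

theorem card_ringHom_mul_le {q p : ℕ} (hq : q.Prime) [NumberField M] [Fact p.Prime] {a : ℤ}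
    {θ ζ : 𝓞 F} {α : 𝓞 M} (hα : α ^ q = a) (hirr : Irreducible (X ^ q - C (a : F)))
    {D : ℕ} (hD : (D : ZMod p) ≠ 0)
    (hcond : ∀ x : 𝓞 M, (D : 𝓞 M) * x ∈
      Algebra.adjoin ℤ {algebraMap (𝓞 F) (𝓞 M) θ, algebraMap (𝓞 F) (𝓞 M) ζ, α}) :
    Nat.card (𝓞 F →+* ZMod p) * Nat.card {y : ZMod p // y ^ q = (a : ZMod p)} ≤
      Nat.card (𝓞 M →+* ZMod p) := by
  let e : (𝓞 F)[X] →+* 𝓞 M := eval₂RingHom (algebraMap (𝓞 F) (𝓞 M)) α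
  have hmonic : (X ^ q - C (a : 𝓞 F)).Monic := monic_X_pow_sub_C _ hq.ne_zero
  have hker : ∀ g, e g = 0 → (X ^ q - C (a : 𝓞 F)) ∣ g := fun g hg => by
    refine (map_dvd_map (algebraMap (𝓞 F) F) RingOfIntegers.coe_injective hmonic).1 ?_
    have hmin : minpoly F (α : M) = X ^ q - C (a : F) := by
      symm
      refine minpoly.eq_of_irreducible_of_monic hirr ?_ (monic_X_pow_sub_C _ hq.ne_zero)
      rw [map_sub, map_pow, aeval_X, aeval_C, map_intCast, sub_eq_zero]
      have := congrArg (algebraMap (𝓞 M) M) hα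
      rwa [map_pow, map_intCast] at this
    have h1 : (X ^ q - C (a : 𝓞 F)).map (algebraMap (𝓞 F) F) = X ^ q - C (a : F) := by
      simp
    rw [h1, ← hmin]
    refine minpoly.dvd F _ ?_
    have h2 := congrArg (algebraMap (𝓞 M) M) hg
    rw [map_zero, coe_eval₂RingHom, hom_eval₂] at h2
    rw [aeval_def, eval₂_map]
    exact h2
  have hrange : ∀ x : 𝓞 M, ∃ g, e g = (D : 𝓞 M) * x := fun x => by
    have h1 : Algebra.adjoin ℤ {algebraMap (𝓞 F) (𝓞 M) θ, algebraMap (𝓞 F) (𝓞 M) ζ, α} ≤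
        e.toIntAlgHom.range := by
      refine Algebra.adjoin_le ?_
      rintro y (rfl | rfl | rfl)
      · exact ⟨C θ, by simp [e]⟩
      · exact ⟨C ζ, by simp [e]⟩
      · exact ⟨X, by simp [e]⟩
    exact h1 (hcond x)
  have hext : ∀ (ψ : 𝓞 F →+* ZMod p) (y : {y : ZMod p // y ^ q = (a : ZMod p)}),
      ∃ φ : 𝓞 M →+* ZMod p, φ.comp (algebraMap (𝓞 F) (𝓞 M)) = ψ ∧ φ α = y := by
    intro ψ y
    obtain ⟨φ, hφ⟩ := RingHom.exists_extension_of_conductor e (eval₂RingHom ψ (y : ZMod p))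
      (fun g hg => by
        obtain ⟨h, rfl⟩ := hker g hg
        rw [coe_eval₂RingHom, eval₂_mul, eval₂_sub, eval₂_X_pow, eval₂_C, map_intCast, y.2,
          sub_self, zero_mul]) D hD hrange
    refine ⟨φ, ?_, ?_⟩
    · ext x
      have := hφ (C x)
      simpa [e] using this
    · have := hφ X
      simpa [e] using this
  choose Φ hΦ hΦα using hext
  rw [← Nat.card_prod]
  refine Nat.card_le_card_of_injective (fun x : (𝓞 F →+* ZMod p) ×
    {y : ZMod p // y ^ q = (a : ZMod p)} => Φ x.1 x.2) fun x y h => ?_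
  refine Prod.ext ?_ (Subtype.ext ?_)
  · rw [← hΦ x.1 x.2, ← hΦ y.1 y.2]
    exact congrArg (fun φ : 𝓞 M →+* ZMod p => φ.comp (algebraMap (𝓞 F) (𝓞 M))) h
  · rw [← hΦα x.1 x.2, ← hΦα y.1 y.2]
    exact congrArg (fun φ : 𝓞 M →+* ZMod p => φ α) h

/-- The excess of degree-one primes in a Kummer extension is supported on the primes modulo which
the radicand is not a power. -/
theorem card_ringHom_sub_le {q p : ℕ} (hq : q.Prime) [NumberField M] [Fact p.Prime] {f : ℤ[X]}
    {a : ℤ} {θ ζ : 𝓞 F} {α : 𝓞 M} (hθ : aeval θ f = 0) (hζ : IsPrimitiveRoot ζ q)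
    (hα : α ^ q = a) (hirr : Irreducible (X ^ q - C (a : F)))
    (hqp : (q : ZMod p) ≠ 0) (hap : (a : ZMod p) ≠ 0)
    {D : ℕ} (hD : (D : ZMod p) ≠ 0) {D' : ℕ} (hD' : (D' : ZMod p) ≠ 0)
    (hcond : ∀ x : 𝓞 F, (D : 𝓞 F) * x ∈ Algebra.adjoin ℤ {θ, ζ})
    (hcond' : ∀ x : 𝓞 M, (D' : 𝓞 M) * x ∈
      Algebra.adjoin ℤ {algebraMap (𝓞 F) (𝓞 M) θ, algebraMap (𝓞 F) (𝓞 M) ζ, α}) :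
    (Nat.card (𝓞 F →+* ZMod p) : ℝ) - Nat.card (𝓞 M →+* ZMod p) / q ≤ q * rootCount f p ∧
      ((∃ y : ZMod p, y ^ q = a) →
        (Nat.card (𝓞 F →+* ZMod p) : ℝ) - Nat.card (𝓞 M →+* ZMod p) / q ≤ 0) := by
  have hq0 : (0 : ℝ) < q := by exact_mod_cast hq.pos
  have hM := card_ringHom_mul_le (θ := θ) (ζ := ζ) hq hα hirr hD' hcond'
  refine ⟨?_, fun hex => ?_⟩
  rotate_left
  · rw [sub_nonpos, le_div_iff₀ hq0]
    rcases isEmpty_or_nonempty (𝓞 F →+* ZMod p) with h | ⟨⟨φ⟩⟩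
    · simp
    · rw [card_pow_eq_of_ringHom hq hζ hqp φ hap hex] at hM
      exact_mod_cast hM
  · have h1 := card_ringHom_le hq hθ hζ hD hcond
    have h2 : (Nat.card (𝓞 F →+* ZMod p) : ℝ) ≤ q * rootCount f p := by
      exact_mod_cast h1.trans (Nat.mul_le_mul_right _ (Nat.sub_le _ _))
    have : (0 : ℝ) ≤ Nat.card (𝓞 M →+* ZMod p) / q := by positivity
    linarith

end

section
open Set Module NumberField Polynomial
open scoped NNReal Pointwise

section
variable {F M : Type*} [Field F] [Field M] [Algebra F M]

theorem Algebra.adjoin_eq_top_of_tower {L : Type*} [Field L] [Algebra L F] [CharZero L]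
    [CharZero F] {S : Set L} {T : Set F} (hS : Algebra.adjoin ℚ S = ⊤)
    (hT : Algebra.adjoin L T = ⊤) : Algebra.adjoin ℚ (algebraMap L F '' S ∪ T) = ⊤ := by
  set W := Algebra.adjoin ℚ (algebraMap L F '' S ∪ T) with hW
  have hL : ∀ l : L, algebraMap L F l ∈ W := fun l => by
    have hl : l ∈ Algebra.adjoin ℚ S := hS ▸ Algebra.mem_top
    induction hl using Algebra.adjoin_induction with
    | mem x hx => exact Algebra.subset_adjoin (Or.inl (mem_image_of_mem _ hx))
    | algebraMap r =>
      rw [eq_ratCast, map_ratCast, ← eq_ratCast (algebraMap ℚ F)]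
      exact W.algebraMap_mem r
    | add x y _ _ hx hy => rw [map_add]; exact W.add_mem hx hy
    | mul x y _ _ hx hy => rw [map_mul]; exact W.mul_mem hx hy
  suffices h : ∀ x, x ∈ W from Algebra.eq_top_iff.2 h
  intro x
  have hx : x ∈ Algebra.adjoin L T := hT ▸ Algebra.mem_top
  induction hx using Algebra.adjoin_induction with
  | mem x hx => exact Algebra.subset_adjoin (Or.inr hx)
  | algebraMap r => exact hL r
  | add x y _ _ hx hy => exact W.add_mem hx hy
  | mul x y _ _ hx hy => exact W.mul_mem hx hy

end

theorem aeval_map_eq_zero {R S : Type*} [CommRing R] [CommRing S] (φ : R →+* S) {x : R}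
    {f : ℤ[X]} (h : aeval x f = 0) : aeval (φ x) f = 0 := by
  have := aeval_algHom_apply φ.toIntAlgHom x f
  rw [h, map_zero] at this
  exact this

section
variable {K : Type*} [Field K]

theorem span_monomials_eq_top {θ ζ α : K} [CharZero K] {f : ℚ[X]} (hf : f.Monic)
    (hθ : aeval θ f = 0) {q : ℕ} (hq : q ≠ 0) (hζ : ζ ^ q = 1) {c : ℚ} (hα : α ^ q = c)
    (hgen : Algebra.adjoin ℚ {θ, ζ, α} = ⊤) :
    Submodule.span ℚ ((fun x : ℕ × ℕ × ℕ => θ ^ x.1 * (ζ ^ x.2.1 * α ^ x.2.2)) ''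
      (Finset.range f.natDegree ×ˢ Finset.range q ×ˢ Finset.range q : Finset (ℕ × ℕ × ℕ))) = ⊤ := by
  classical
  have h1 := Submodule.span_range_natDegree_eq_adjoin hf hθ
  have h2 := Submodule.span_range_natDegree_eq_adjoin (x := ζ)
    (monic_X_pow_sub_C (1 : ℚ) hq) (by simp [hζ])
  have h3 := Submodule.span_range_natDegree_eq_adjoin (x := α)
    (monic_X_pow_sub_C c hq) (by simp [hα])
  rw [natDegree_X_pow_sub_C] at h2 h3
  rw [← Algebra.top_toSubmodule, ← hgen, show ({θ, ζ, α} : Set K) = {θ} ∪ ({ζ} ∪ {α}) from rfl,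
    Algebra.adjoin_union_coe_submodule, Algebra.adjoin_union_coe_submodule, ← h1, ← h2, ← h3,
    Submodule.span_mul_span, Submodule.span_mul_span]
  congr 1
  ext y
  simp only [mem_image, Finset.mem_coe, Finset.mem_product, Finset.coe_image, mem_mul,
    Finset.coe_range, mem_Iio, Finset.mem_range, Prod.exists]
  constructor
  · rintro ⟨i, l, m, ⟨hi, hl, hm⟩, rfl⟩
    exact ⟨_, ⟨i, hi, rfl⟩, _, ⟨_, ⟨l, hl, rfl⟩, _, ⟨m, hm, rfl⟩, rfl⟩, rfl⟩
  · rintro ⟨_, ⟨i, hi, rfl⟩, _, ⟨_, ⟨l, hl, rfl⟩, _, ⟨m, hm, rfl⟩, rfl⟩, rfl⟩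
    exact ⟨i, l, m, ⟨hi, hl, hm⟩, rfl⟩

variable [NumberField K]

theorem exists_boundedBasis {θ ζ α : 𝓞 K} {f : ℤ[X]} (hf : f.Monic)
    (hθ : aeval θ f = 0) {q : ℕ} (hq : q ≠ 0) (hζ : ζ ^ q = 1) {c : ℤ} (hα : α ^ q = c)
    (hgen : Algebra.adjoin ℚ {(θ : K), (ζ : K), (α : K)} = ⊤) {B : ℝ≥0} (hB : 1 ≤ B)
    (hroot : ∀ z : ℂ, aeval z f = 0 → ‖z‖ ≤ B) (hc : |(c : ℝ)| ≤ B) :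
    finrank ℚ K ≤ f.natDegree * (q * q) ∧ ∃ (n : ℕ) (b : Fin n → 𝓞 K),
      BoundedBasis b (B ^ (f.natDegree + q)) ∧ range b ⊆ Algebra.adjoin ℤ {θ, ζ, α} := by
  classical
  set I : Finset (ℕ × ℕ × ℕ) := Finset.range f.natDegree ×ˢ Finset.range q ×ˢ Finset.range q
    with hI
  let g : ℕ × ℕ × ℕ → 𝓞 K := fun x => θ ^ x.1 * (ζ ^ x.2.1 * α ^ x.2.2)
  have hθK : aeval (θ : K) (f.map (Int.castRingHom ℚ)) = 0 := by
    exact (aeval_map_algebraMap ℚ (θ : K) f).trans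
      (aeval_map_eq_zero (algebraMap (𝓞 K) K) hθ)
  have hspan := span_monomials_eq_top (hf.map (Int.castRingHom ℚ)) hθK hq
    (by have := congrArg (algebraMap (𝓞 K) K) hζ; simpa using this)
    (c := c) (by have := congrArg (algebraMap (𝓞 K) K) hα; simpa using this) hgen
  rw [hf.natDegree_map, ← hI] at hspan
  have himg : (fun x : 𝓞 K => (x : K)) '' (g '' I) =
      (fun x : ℕ × ℕ × ℕ => (θ : K) ^ x.1 * ((ζ : K) ^ x.2.1 * (α : K) ^ x.2.2)) '' I := by
    rw [image_image]
    refine image_congr fun x _ => ?_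
    simp only [g, map_mul, map_pow]
  have hfin : (g '' I).Finite := (Finset.finite_toSet I).image g
  constructor
  · have h1 : finrank ℚ (⊤ : Submodule ℚ K) ≤ I.card := by
      rw [← hspan, ← Finset.coe_image]
      exact (finrank_span_finset_le_card _).trans Finset.card_image_le
    rw [finrank_top] at h1
    refine h1.trans (le_of_eq ?_)
    rw [hI, Finset.card_product, Finset.card_product, Finset.card_range, Finset.card_range]
  have hle : ∀ x ∈ g '' I, ∀ w : InfinitePlace K, w x ≤ (B ^ (f.natDegree + q) : ℝ≥0) := by
    rintro _ ⟨⟨i, l, m⟩, him, rfl⟩ w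
    rw [Finset.mem_coe, hI, Finset.mem_product, Finset.mem_product, Finset.mem_range,
      Finset.mem_range, Finset.mem_range] at him
    have hB' : (1 : ℝ) ≤ B := by exact_mod_cast hB
    have hwθ : w θ ≤ B := by
      rw [← InfinitePlace.norm_embedding_eq]
      exact hroot _ (aeval_map_eq_zero (w.embedding.comp (algebraMap (𝓞 K) K)) hθ)
    have hwζ : w ζ = 1 := by
      have h0 := congrArg (fun x : 𝓞 K => w x) hζ
      simp only [map_pow, map_one] at h0
      exact (pow_eq_one_iff_of_nonneg (apply_nonneg _ _) hq).1 h0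
    have hwα : w α ≤ B := by
      have h0 := congrArg (fun x : 𝓞 K => w x) hα
      simp only [map_pow, map_intCast] at h0
      have h1 : w (c : K) = |(c : ℝ)| := by
        rw [← InfinitePlace.norm_embedding_eq, map_intCast, Complex.norm_intCast]
      rw [h1] at h0
      by_contra! hlt
      have h2 : w α ≤ w α ^ q := le_self_pow₀ (hB'.trans hlt.le) hq
      linarith
    simp only [g, map_mul, map_pow, hwζ, one_pow, one_mul, NNReal.coe_pow]
    rw [pow_add]
    have e1 : w θ ^ i ≤ (B : ℝ) ^ f.natDegree :=
      (pow_le_pow_left₀ (apply_nonneg _ _) hwθ i).trans (pow_le_pow_right₀ hB' him.1.le)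
    have e2 : w α ^ m ≤ (B : ℝ) ^ q :=
      (pow_le_pow_left₀ (apply_nonneg _ _) hwα m).trans (pow_le_pow_right₀ hB' him.2.2.le)
    exact mul_le_mul e1 e2 (pow_nonneg (apply_nonneg _ _) _) (by positivity)
  obtain ⟨n, b, hb, hbS⟩ := BoundedBasis.exists_of_span hfin (one_le_pow₀ hB)
    (by rw [himg, hspan]) hle
  refine ⟨n, b, hb, hbS.trans ?_⟩
  rintro _ ⟨x, -, rfl⟩
  have hmem : ∀ y ∈ ({θ, ζ, α} : Set (𝓞 K)), y ∈ Algebra.adjoin ℤ {θ, ζ, α} :=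
    fun y hy => Algebra.subset_adjoin hy
  exact mul_mem (pow_mem (hmem _ (by simp)) _)
    (mul_mem (pow_mem (hmem _ (by simp)) _) (pow_mem (hmem _ (by simp)) _))

theorem one_le_errorConst (n : ℕ) {A : ℝ} : 1 ≤ errorConst n A := by
  rw [errorConst]
  have : (1 : ℝ) ≤ (1 + 5 * (n * A) ^ 2) ^ n := one_le_pow₀ (by nlinarith [sq_nonneg (n * A)])
  linarith

theorem errorConst_mono {m n : ℕ} (hmn : m ≤ n) {A : ℝ} (hA : 0 ≤ A) :
    errorConst m A ≤ errorConst n A := by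
  rw [errorConst, errorConst]
  have h0 : (m : ℝ) * A ≤ n * A := mul_le_mul_of_nonneg_right (by exact_mod_cast hmn) hA
  have h1 : (1 + 5 * (m * A) ^ 2) ^ m ≤ (1 + 5 * (n * A) ^ 2) ^ m := by
    refine pow_le_pow_left₀ (by positivity) ?_ _
    have := pow_le_pow_left₀ (by positivity) h0 2
    linarith
  have h2 : (1 + 5 * (n * A) ^ 2) ^ m ≤ (1 + 5 * (n * A) ^ 2) ^ n :=
    pow_le_pow_right₀ (by nlinarith [sq_nonneg (n * A)]) hmn
  linarith

theorem regularityConst_mono {m n : ℕ} (hmn : m ≤ n) {A : ℝ} (hA : 0 ≤ A) :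
    regularityConst m A ≤ regularityConst n A := by
  rw [regularityConst, regularityConst]
  have h0 := one_le_errorConst n (A := A)
  have h1 := one_le_errorConst m (A := A)
  refine (pow_le_pow_left₀ (by linarith) (mul_le_mul_of_nonneg_left (errorConst_mono hmn hA)
    zero_le_two) _).trans (pow_le_pow_right₀ (by linarith) ?_)
  exact Nat.mul_le_mul hmn (by omega)

theorem factorial_mul_le_regularityConst {n : ℕ} (hn : 0 < n) {A : ℝ} (hA : 1 ≤ A) :
    n.factorial * (n * A ^ 2) ^ n ≤ regularityConst n A := by
  have hn1 : (1 : ℝ) ≤ n := by exact_mod_cast hn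
  have h0 : (n.factorial : ℝ) ≤ (n : ℝ) ^ n := by exact_mod_cast Nat.factorial_le_pow n
  have h1 : (n * A) ^ 2 ≤ 2 * errorConst n A := by
    have : (1 + 5 * (n * A) ^ 2) ≤ (1 + 5 * (n * A) ^ 2) ^ n :=
      le_self_pow₀ (by nlinarith [sq_nonneg (n * A)]) hn.ne'
    rw [errorConst]
    nlinarith [sq_nonneg (n * A)]
  have h2 : (n.factorial : ℝ) * (n * A ^ 2) ^ n ≤ ((n * A) ^ 2) ^ n := by
    calc (n.factorial : ℝ) * (n * A ^ 2) ^ n ≤ (n : ℝ) ^ n * (n * A ^ 2) ^ n := by gcongr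
      _ = ((n * A) ^ 2) ^ n := by rw [← mul_pow]; ring
  refine h2.trans ((pow_le_pow_left₀ (by positivity) h1 n).trans ?_)
  rw [regularityConst]
  exact pow_le_pow_right₀ (by linarith [one_le_errorConst n (A := A)])
    (Nat.le_mul_of_pos_right n (by omega))

/-- Regularity of ideal counts and a conductor, both controlled by the degrees and heights of
generators of a number field. -/
theorem exists_conductor_and_rieszRegular {θ ζ α : 𝓞 K} {f : ℤ[X]} (hf : f.Monic)
    (hθ : aeval θ f = 0) {q : ℕ} (hq : q ≠ 0) (hζ : ζ ^ q = 1) {c : ℤ} (hα : α ^ q = c)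
    (hgen : Algebra.adjoin ℚ {(θ : K), (ζ : K), (α : K)} = ⊤) {B : ℝ≥0} (hB : 1 ≤ B)
    (hroot : ∀ z : ℂ, aeval z f = 0 → ‖z‖ ≤ B) (hc : |(c : ℝ)| ≤ B) {Q : ℝ}
    (hQ : regularityConst (f.natDegree * (q * q)) (B ^ (f.natDegree + q)) ≤ Q) :
    finrank ℚ K ≤ f.natDegree * (q * q) ∧
      (∃ D : ℕ, D ≠ 0 ∧ (D : ℝ) ≤ Q ∧ ∀ x : 𝓞 K, (D : 𝓞 K) * x ∈ Algebra.adjoin ℤ {θ, ζ, α}) ∧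
      ∃ c', RieszRegular (idealCount K) (fieldMangoldt K) (Units.rank K) c' Q := by
  obtain ⟨hn, n, b, hb, hbS⟩ := exists_boundedBasis hf hθ hq hζ hα hgen hB hroot hc
  have hA : (1 : ℝ) ≤ (B : ℝ) ^ (f.natDegree + q) := one_le_pow₀ (by exact_mod_cast hB)
  have hreg := (regularityConst_mono hn (zero_le_one.trans hA)).trans hQ
  refine ⟨hn, ?_, hb.exists_rieszRegular (by rwa [NNReal.coe_pow])⟩
  obtain ⟨D, hD0, hD, hDx⟩ := hb.exists_conductor
  refine ⟨D, hD0, hD.trans ?_, fun x => ?_⟩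
  · rw [NNReal.coe_pow]
    exact (factorial_mul_le_regularityConst finrank_pos hA).trans hreg
  · have h1 : Submodule.span ℤ (range b) ≤
        Subalgebra.toSubmodule (Algebra.adjoin ℤ {θ, ζ, α}) := Submodule.span_le.2 hbS
    exact h1 (hDx x)
end

end

section
open Set Module NumberField Polynomial
open scoped NNReal

theorem not_pow_of_coprime_finrank {L F : Type*} [Field L] [Field F] [Algebra L F] {q : ℕ}
    (hco : (finrank L F).Coprime q) {a : L} (ha : a ≠ 0)
    (hno : ∀ β : L, β ^ q ≠ a) (β : F) : β ^ q ≠ algebraMap L F a := by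
  intro h
  have h1 := congrArg (Algebra.norm L) h
  rw [map_pow, Algebra.norm_algebraMap] at h1
  have hbez := Nat.gcd_eq_gcd_ab (finrank L F) q
  rw [hco.gcd_eq_one] at hbez
  set s := Nat.gcdA (finrank L F) q
  set t := Nat.gcdB (finrank L F) q
  refine hno (Algebra.norm L β ^ s * a ^ t) ?_
  rw [mul_pow, ← zpow_natCast, ← zpow_natCast, ← zpow_mul, mul_comm s, zpow_mul, zpow_natCast, h1,
    ← zpow_natCast a, ← zpow_mul, ← zpow_mul, mul_comm t, ← zpow_add₀ ha, ← hbez,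
    Nat.cast_one, zpow_one]

theorem Polynomial.Monic.dvd_of_dvd_C_mul {f t : ℤ[X]} (hf : f.Monic) {c : ℤ} (hc : c ≠ 0)
    (h : f ∣ C c * t) : f ∣ t := by
  rw [← modByMonic_eq_zero_iff_dvd hf] at h ⊢
  rw [← smul_eq_C_mul, smul_modByMonic] at h
  exact (smul_eq_zero.1 h).resolve_left hc

/-- A polynomial that is squarefree modulo a prime exactly dividing `a` does not acquire a power
equal to `a`. -/
theorem not_dvd_pow_sub {ℓ : ℕ} (hℓ : ℓ.Prime) {f : ℤ[X]} (hf : f.Monic)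
    (hdeg : f.natDegree ≠ 0) (hsq : Squarefree (f.map (Int.castRingHom (ZMod ℓ))))
    {a b : ℤ} (hab : a = ℓ * b) (hb : ¬ (ℓ : ℤ) ∣ b) {q : ℕ} (hq : 2 ≤ q) (D : ℕ) (hD : D ≠ 0)
    (g : ℤ[X]) : ¬ f ∣ g ^ q - C ((D : ℤ) ^ q * a) := by
  have := Fact.mk hℓ
  have hℓ0 : (ℓ : ℤ) ≠ 0 := by exact_mod_cast hℓ.ne_zero
  set φ := mapRingHom (Int.castRingHom (ZMod ℓ)) with hφ
  have hcast : ∀ z : ℤ, φ (C z) = 0 ↔ (ℓ : ℤ) ∣ z := fun z => by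
    rw [hφ, coe_mapRingHom, map_C, C_eq_zero, eq_intCast, ZMod.intCast_zmod_eq_zero_iff_dvd]
  induction D using Nat.strong_induction_on generalizing g with
  | _ D ih =>
  intro hdvd
  have hprim : f.map (Int.castRingHom (ZMod ℓ)) ∣ φ g := by
    refine hsq.isRadical q _ ?_
    have h1 := map_dvd φ hdvd
    rw [map_sub, map_pow, (hcast _).2 ⟨(D : ℤ) ^ q * b, by rw [hab]; ring⟩, sub_zero] at h1
    exact h1
  obtain ⟨h', hh'⟩ := hprim
  obtain ⟨h, rfl⟩ := map_surjective _ (ZMod.ringHom_surjective (Int.castRingHom (ZMod ℓ))) h'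
  have hdvd1 : C (ℓ : ℤ) ∣ g - f * h := by
    rw [C_dvd_iff_dvd_coeff]
    intro i
    have h2 : φ (g - f * h) = 0 := by
      rw [map_sub, hh', map_mul, sub_eq_zero]
      rfl
    have h3 := congrArg (fun p => coeff p i) h2
    rwa [hφ, coe_mapRingHom, coeff_map, coeff_zero, eq_intCast,
      ZMod.intCast_zmod_eq_zero_iff_dvd] at h3
  obtain ⟨g₁, hg₁⟩ := hdvd1
  obtain ⟨r, rfl⟩ : ∃ r, q = r + 2 := ⟨q - 2, by omega⟩
  have hd2 : f ∣ C (ℓ : ℤ) * (C (ℓ : ℤ) ^ (r + 1) * g₁ ^ (r + 2) - C ((D : ℤ) ^ (r + 2) * b)) := by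
    have e1 : f ∣ g ^ (r + 2) - (C (ℓ : ℤ) * g₁) ^ (r + 2) := by
      refine dvd_trans ⟨h, ?_⟩ (sub_dvd_pow_sub_pow g (C (ℓ : ℤ) * g₁) (r + 2))
      rw [← hg₁]
      ring
    have e2 := dvd_sub hdvd e1
    convert e2 using 1
    rw [hab]
    simp only [map_mul, map_pow]
    ring
  have hd3 := hf.dvd_of_dvd_C_mul hℓ0 hd2
  have hDℓ : ℓ ∣ D := by
    have h4 := map_dvd φ hd3
    rw [map_sub, map_mul, map_pow, (hcast _).2 dvd_rfl, zero_pow (by omega), zero_mul, zero_sub,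
      dvd_neg] at h4
    have h5 : φ (C ((D : ℤ) ^ (r + 2) * b)) = 0 := by
      by_contra hne
      have h6 := natDegree_le_of_dvd h4 hne
      rw [hφ, coe_mapRingHom, map_C, natDegree_C, hf.natDegree_map] at h6
      omega
    rw [hcast] at h5
    have hpr := Nat.prime_iff_prime_int.1 hℓ
    exact Int.natCast_dvd_natCast.1 (hpr.dvd_of_dvd_pow ((hpr.dvd_or_dvd h5).resolve_right hb))
  obtain ⟨D₁, rfl⟩ := hDℓ
  have hD₁ : D₁ ≠ 0 := by rintro rfl; simp at hD
  refine ih D₁ (lt_mul_of_one_lt_left (Nat.pos_of_ne_zero hD₁) hℓ.one_lt) hD₁ g₁ ?_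
  refine hf.dvd_of_dvd_C_mul (pow_ne_zero (r + 1) hℓ0) ?_
  convert hd3 using 1
  rw [hab]
  simp only [map_mul, map_pow, Nat.cast_mul]
  ring

theorem not_pow_of_adjoin_eq_top {L : Type*} [Field L] [CharZero L] {θ : L}
    (hgen : Algebra.adjoin ℚ {θ} = ⊤) {f : ℤ[X]} (hker : ∀ g : ℤ[X], aeval θ g = 0 → f ∣ g)
    {q : ℕ} {a : ℤ} (hno : ∀ D : ℕ, D ≠ 0 → ∀ g, ¬ f ∣ g ^ q - C ((D : ℤ) ^ q * a)) (β : L) :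
    β ^ q ≠ a := by
  intro h
  have hβ : β ∈ Algebra.adjoin ℚ {θ} := hgen ▸ Algebra.mem_top
  rw [Algebra.adjoin_singleton_eq_range_aeval] at hβ
  obtain ⟨g, rfl⟩ := hβ
  obtain ⟨b, hb, hg⟩ := IsLocalization.integerNormalization_spec (nonZeroDivisors ℤ) g
  have hb0 : b ≠ 0 := nonZeroDivisors.ne_zero hb
  set g' := IsLocalization.integerNormalization (nonZeroDivisors ℤ) g
  refine hno b.natAbs (Int.natAbs_ne_zero.2 hb0) (C b.sign * g') (hker _ ?_)
  have h1 : aeval θ g' = (b : L) * aeval θ g := by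
    rw [← aeval_map_algebraMap ℚ, hg, ← Int.cast_smul_eq_zsmul ℚ, map_smul, Algebra.smul_def]
    simp
  have h2 : ((b.natAbs : ℤ) : L) = b.sign * b := by
    rw [← Int.cast_mul, Int.sign_mul_self_eq_natAbs]
  have h3 : (aeval θ g) ^ q = (a : L) := h
  rw [map_sub, map_pow, map_mul, h1, aeval_C, aeval_C]
  simp only [algebraMap_int_eq, eq_intCast, Int.cast_mul, Int.cast_pow]
  rw [h2, mul_pow, mul_pow, mul_pow, h3]
  ring

end

section
open Set Module NumberField Polynomial
open scoped NNReal

/-- The weights `L₁`, `L₂` come from a number field and a Kummer extension of it. -/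
structure KummerWeights (f : ℤ[X]) (q : ℕ) (a : ℤ) (n : ℕ) (Q : ℝ) (L₁ L₂ : ℕ → ℝ) (Z : ℕ) :
    Prop where
  regular_left : ∃ a₁ r₁ c₁, RieszRegular a₁ L₁ r₁ c₁ Q
  regular_right : ∃ a₂ r₂ c₂, RieszRegular a₂ L₂ r₂ c₂ Q
  le : ∀ m, m ≠ 0 → L₁ m ≤ n * Real.log m
  nonneg_right : ∀ m, 0 ≤ L₂ m
  isPrimePow : ∀ m, L₁ m ≠ 0 → IsPrimePow m
  ne_zero : Z ≠ 0
  modulus_le : (Z : ℝ) ≤ Q * Q * (q * |(a : ℝ)|)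
  prime_le : ∀ p, p.Prime → ¬ p ∣ Z → L₁ p - L₂ p / q ≤ q * rootCount f p * Real.log p
  prime_le_zero : ∀ p, p.Prime → ¬ p ∣ Z → (∃ y : ZMod p, y ^ q = a) → L₁ p - L₂ p / q ≤ 0

variable {F M : Type*} [Field F] [NumberField F] [Field M] [NumberField M] [Algebra F M]

theorem kummerWeights_fieldMangoldt {q : ℕ} (hq : q.Prime) {f : ℤ[X]} (hf : f.Monic) {a : ℤ}
    (ha : a ≠ 0) {θ ζ : 𝓞 F} {α : 𝓞 M} (hθ : aeval θ f = 0) (hζ : IsPrimitiveRoot ζ q)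
    (hα : α ^ q = a) (hirr : Irreducible (X ^ q - C (a : F)))
    (hgenF : Algebra.adjoin ℚ {(θ : F), (ζ : F)} = ⊤) (hgenM : Algebra.adjoin F {(α : M)} = ⊤)
    {B : ℝ≥0} (hB : 1 ≤ B) (hroot : ∀ z : ℂ, aeval z f = 0 → ‖z‖ ≤ B) (haB : |(a : ℝ)| ≤ B) {Q : ℝ}
    (hQ : regularityConst (f.natDegree * (q * q)) (B ^ (f.natDegree + q)) ≤ Q) :
    ∃ Z, KummerWeights f q a (f.natDegree * (q * q)) Q (fieldMangoldt F) (fieldMangoldt M) Z := by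
  have hgenF' : Algebra.adjoin ℚ {(θ : F), (ζ : F), ((1 : 𝓞 F) : F)} = ⊤ :=
    top_unique (hgenF.symm.le.trans (Algebra.adjoin_mono (by
      rintro x (rfl | rfl) <;> simp)))
  have hgenM' : Algebra.adjoin ℚ {((algebraMap (𝓞 F) (𝓞 M) θ : 𝓞 M) : M),
      ((algebraMap (𝓞 F) (𝓞 M) ζ : 𝓞 M) : M), (α : M)} = ⊤ := by
    have h := Algebra.adjoin_eq_top_of_tower hgenF hgenM
    rw [image_pair, insert_union, singleton_union] at h
    exact h
  have hθM : aeval (algebraMap (𝓞 F) (𝓞 M) θ) f = 0 := aeval_map_eq_zero _ hθ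
  have hζM : (algebraMap (𝓞 F) (𝓞 M) ζ) ^ q = 1 := by rw [← map_pow, hζ.pow_eq_one, map_one]
  obtain ⟨hnF, ⟨D, hD0, hD, hDx⟩, cF, hF⟩ := exists_conductor_and_rieszRegular hf hθ hq.ne_zero
    hζ.pow_eq_one (c := 1) (α := 1) (by simp) hgenF' hB hroot (by simpa using hB) hQ
  obtain ⟨-, ⟨D', hD'0, hD', hDx'⟩, cM, hM⟩ := exists_conductor_and_rieszRegular hf hθM hq.ne_zero
    hζM hα hgenM' hB hroot haB hQ
  have hDx1 : ∀ x : 𝓞 F, (D : 𝓞 F) * x ∈ Algebra.adjoin ℤ {θ, ζ} := fun x => by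
    refine Algebra.adjoin_le ?_ (hDx x)
    rintro y (rfl | rfl | rfl)
    · exact Algebra.subset_adjoin (by simp)
    · exact Algebra.subset_adjoin (by simp)
    · exact one_mem _
  have hkey : ∀ p, p.Prime → ¬ p ∣ D * D' * (q * a.natAbs) →
      (idealCount F p - idealCount M p / q ≤ q * rootCount f p ∧
      ((∃ y : ZMod p, y ^ q = a) → idealCount F p - idealCount M p / q ≤ 0)) := by
    intro p hp hpZ
    have := Fact.mk hp
    rw [hp.dvd_mul, hp.dvd_mul, hp.dvd_mul, not_or, not_or, not_or, ← Int.natCast_dvd] at hpZ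
    rw [idealCount_prime hp, idealCount_prime hp]
    exact card_ringHom_sub_le hq hθ hζ hα hirr
      (by rw [Ne, ZMod.natCast_eq_zero_iff]; exact hpZ.2.1)
      (by rw [Ne, ZMod.intCast_zmod_eq_zero_iff_dvd]; exact hpZ.2.2)
      (by rw [Ne, ZMod.natCast_eq_zero_iff]; exact hpZ.1.1)
      (by rw [Ne, ZMod.natCast_eq_zero_iff]; exact hpZ.1.2) hDx1 hDx'
  have hfac : ∀ p : ℕ, p.Prime → fieldMangoldt F p - fieldMangoldt M p / q =
      (idealCount F p - idealCount M p / q) * Real.log p := fun p hp => by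
    rw [fieldMangoldt_prime hp, fieldMangoldt_prime hp]
    ring
  refine ⟨D * D' * (q * a.natAbs), ⟨⟨_, _, _, hF⟩, ⟨_, _, _, hM⟩, fun m hm => ?_,
    fieldMangoldt_nonneg, fun m hm => isPrimePow_of_fieldMangoldt_ne_zero hm, ?_, ?_,
    fun p hp hpZ => ?_, fun p hp hpZ hy => ?_⟩⟩
  · refine (fieldMangoldt_le F m hm).trans (mul_le_mul_of_nonneg_right ?_
      (Real.log_natCast_nonneg m))
    exact_mod_cast hnF
  · exact mul_ne_zero (mul_ne_zero hD0 hD'0) (mul_ne_zero hq.ne_zero (Int.natAbs_ne_zero.2 ha))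
  · push_cast
    rw [Nat.cast_natAbs, Int.cast_abs]
    gcongr
    exact (Nat.cast_nonneg D).trans hD
  · rw [hfac p hp]
    exact mul_le_mul_of_nonneg_right (hkey p hp hpZ).1 (Real.log_natCast_nonneg p)
  · rw [hfac p hp]
    exact mul_nonpos_of_nonpos_of_nonneg ((hkey p hp hpZ).2 hy) (Real.log_natCast_nonneg p)

end

section
open Set Module NumberField Polynomial
open scoped NNReal

theorem finrank_cyclotomic_coprime {L F : Type*} [Field L] [CharZero L] [Field F] [Algebra L F] {q : ℕ}
    (hq : q.Prime) [IsCyclotomicExtension {q} L F] : (finrank L F).Coprime q := by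
  have : NeZero q := ⟨hq.ne_zero⟩
  have : FiniteDimensional L F := IsCyclotomicExtension.finiteDimensional {q} L F
  have hζ := IsCyclotomicExtension.zeta_spec q L F
  refine Nat.coprime_comm.1 ((Nat.Prime.coprime_iff_not_dvd hq).2 fun h => ?_)
  have h0 : 0 < finrank L F := finrank_pos
  have h1 := Nat.le_of_dvd h0 h
  rw [(hζ.powerBasis L).finrank, show (hζ.powerBasis L).dim = (minpoly L
    (IsCyclotomicExtension.zeta q L F)).natDegree from rfl] at h1
  have h2 : (minpoly L (IsCyclotomicExtension.zeta q L F)).natDegree ≤ (cyclotomic q L).natDegree :=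
    natDegree_le_of_dvd (minpoly.dvd _ _ (by
      rw [aeval_def, eval₂_eq_eval_map, map_cyclotomic]
      exact hζ.isRoot_cyclotomic hq.pos)) (cyclotomic_ne_zero q L)
  rw [natDegree_cyclotomic, Nat.totient_prime hq] at h2
  have := hq.two_le
  omega

theorem exists_ringOfIntegers_aeval_eq_zero {K : Type*} [Field K] {f : ℤ[X]} (hf : f.Monic) {x : K}
    (hx : aeval x f = 0) : ∃ y : 𝓞 K, (y : K) = x ∧ aeval y f = 0 := by
  obtain ⟨y, rfl⟩ : ∃ y : 𝓞 K, (y : K) = x :=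
    ⟨⟨x, (mem_integralClosure_iff ℤ K).2 ⟨f, hf, by rwa [← aeval_def]⟩⟩, rfl⟩
  exact ⟨y, rfl, FaithfulSMul.algebraMap_injective (𝓞 K) K
    (by rw [map_zero, ← hx, aeval_algebraMap_apply])⟩

theorem exists_ringOfIntegers_pow_eq {K : Type*} [Field K] {q : ℕ} (hq : q ≠ 0) {x : K} {a : ℤ}
    (hx : x ^ q = a) : ∃ y : 𝓞 K, (y : K) = x ∧ y ^ q = a := by
  obtain ⟨y, hy, h⟩ := exists_ringOfIntegers_aeval_eq_zero (monic_X_pow_sub_C a hq) (x := x)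
    (by rw [map_sub, map_pow, aeval_X, aeval_C, hx, algebraMap_int_eq, eq_intCast, sub_self])
  refine ⟨y, hy, ?_⟩
  rwa [map_sub, map_pow, aeval_X, aeval_C, algebraMap_int_eq, eq_intCast, sub_eq_zero] at h

theorem aeval_int_eq_eval₂ {R : Type*} [CommRing R] [Algebra ℤ R] (x : R) (f : ℤ[X]) :
    aeval x f = eval₂ (Int.castRingHom R) x f :=
  congrArg (fun φ => eval₂ φ x f) (Subsingleton.elim _ _)

theorem exists_kummerWeights_of_adjoin_eq_top {L : Type} [Field L] [NumberField L] {q : ℕ}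
    (hq : q.Prime) {f : ℤ[X]} (hf : f.Monic) {a : ℤ} (ha : a ≠ 0) {θ : L} (hθ : aeval θ f = 0)
    (hgen : Algebra.adjoin ℚ {θ} = ⊤) (hno : ∀ β : L, β ^ q ≠ a)
    {B : ℝ≥0} (hB : 1 ≤ B) (hroot : ∀ z : ℂ, aeval z f = 0 → ‖z‖ ≤ B) (haB : |(a : ℝ)| ≤ B) {Q : ℝ}
    (hQ : regularityConst (f.natDegree * (q * q)) (B ^ (f.natDegree + q)) ≤ Q) :
    ∃ L₁ L₂ Z, KummerWeights f q a (f.natDegree * (q * q)) Q L₁ L₂ Z := by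
  have : NeZero q := ⟨hq.ne_zero⟩
  let F := CyclotomicField q L
  have : NumberField F := IsCyclotomicExtension.numberField {q} L F
  have hnoF : ∀ β : F, β ^ q ≠ (a : F) := fun β => by
    have := not_pow_of_coprime_finrank (F := F) (finrank_cyclotomic_coprime hq)
      (Int.cast_ne_zero.2 ha) hno β
    rwa [map_intCast] at this
  have hirr : Irreducible (X ^ q - C (a : F)) := X_pow_sub_C_irreducible_of_prime hq hnoF
  have := Fact.mk hirr
  let M := AdjoinRoot (X ^ q - C (a : F))
  have : Module.Finite F M := (AdjoinRoot.powerBasis hirr.ne_zero).finite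
  have : NumberField M := NumberField.of_module_finite F M
  have hζ := IsCyclotomicExtension.zeta_spec q L F
  have hθF : aeval (algebraMap L F θ) f = 0 := aeval_map_eq_zero _ hθ
  obtain ⟨θ', hθ'c, hθ'⟩ := exists_ringOfIntegers_aeval_eq_zero hf hθF
  let α : M := AdjoinRoot.root (X ^ q - C (a : F))
  have hα : α ^ q = a := by
    have := AdjoinRoot.eval₂_root (X ^ q - C (a : F))
    rw [eval₂_sub, eval₂_X_pow, eval₂_C, sub_eq_zero] at this
    exact this.trans (map_intCast _ a)
  obtain ⟨α', hα'c, hα'⟩ := exists_ringOfIntegers_pow_eq hq.ne_zero hα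
  obtain ⟨Z, hZ⟩ := kummerWeights_fieldMangoldt (F := F) (M := M) hq hf ha (θ := θ')
    (ζ := hζ.toInteger) hθ' hζ.toInteger_isPrimitiveRoot hα' hirr
    (by
      have h := Algebra.adjoin_eq_top_of_tower hgen
        (IsCyclotomicExtension.adjoin_primitive_root_eq_top hζ)
      rw [image_singleton, singleton_union] at h
      rw [hθ'c]
      exact h)
    (by
      rw [hα'c]
      exact AdjoinRoot.adjoinRoot_eq_top (f := X ^ q - C (a : F))) hB hroot haB hQ
  exact ⟨_, _, Z, hZ⟩

/-- A monic irreducible polynomial that is squarefree modulo a prime exactly dividing `a` has Kummer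
weights. -/
theorem exists_kummerWeights {q : ℕ} (hq : q.Prime) {ℓ : ℕ} (hℓ : ℓ.Prime) {f : ℤ[X]}
    (hf : f.Monic) (hirr : Irreducible f) (hdeg : f.natDegree ≠ 0)
    (hsq : Squarefree (f.map (Int.castRingHom (ZMod ℓ))))
    {a b : ℤ} (hab : a = ℓ * b) (hb : ¬ (ℓ : ℤ) ∣ b)
    {B : ℝ≥0} (hB : 1 ≤ B) (hroot : ∀ z : ℂ, aeval z f = 0 → ‖z‖ ≤ B) (haB : |(a : ℝ)| ≤ B) {Q : ℝ}
    (hQ : regularityConst (f.natDegree * (q * q)) (B ^ (f.natDegree + q)) ≤ Q) :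
    ∃ L₁ L₂ Z, KummerWeights f q a (f.natDegree * (q * q)) Q L₁ L₂ Z := by
  have hirrQ : Irreducible (f.map (algebraMap ℤ ℚ)) :=
    (Monic.irreducible_iff_irreducible_map_fraction_map hf).1 hirr
  have := Fact.mk hirrQ
  have ha : a ≠ 0 := by
    rintro rfl
    rcases mul_eq_zero.1 hab.symm with h | h
    · exact hℓ.ne_zero (by exact_mod_cast h)
    · exact hb (h ▸ dvd_zero _)
  have heval : ∀ g : ℤ[X], eval₂ (Int.castRingHom _) (AdjoinRoot.root (f.map (algebraMap ℤ ℚ))) g =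
      AdjoinRoot.mk (f.map (algebraMap ℤ ℚ)) (g.map (algebraMap ℤ ℚ)) := fun g => by
    rw [← AdjoinRoot.aeval_eq, aeval_def, eval₂_map]
    exact congrArg (fun φ => eval₂ φ _ g) (Subsingleton.elim _ _)
  refine exists_kummerWeights_of_adjoin_eq_top hq hf ha
    (θ := AdjoinRoot.root (f.map (algebraMap ℤ ℚ))) (by
      rw [aeval_int_eq_eval₂, heval, AdjoinRoot.mk_self])
    (AdjoinRoot.adjoinRoot_eq_top (f := f.map (algebraMap ℤ ℚ))) ?_ hB hroot haB hQ
  refine not_pow_of_adjoin_eq_top (AdjoinRoot.adjoinRoot_eq_top (f := f.map (algebraMap ℤ ℚ)))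
    (f := f) (fun g hg => ?_) fun D hD g => not_dvd_pow_sub hℓ hf hdeg hsq hab hb hq.two_le D hD g
  rw [aeval_int_eq_eval₂, heval, AdjoinRoot.mk_eq_zero] at hg
  exact (map_dvd_map (algebraMap ℤ ℚ) (FaithfulSMul.algebraMap_injective ℤ ℚ) hf).1 hg

end

section
open Set Module NumberField Polynomial
open scoped NNReal

theorem card_primeFactors_le_log {W : ℕ} (hW : W ≠ 0) :
    (W.primeFactors.card : ℝ) ≤ 2 * Real.log W := by
  have h1 : 2 ^ W.primeFactors.card ≤ W :=
    (Finset.pow_card_le_prod _ (fun p => p) 2 fun p hp =>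
      (Nat.prime_of_mem_primeFactors hp).two_le).trans
      (Nat.le_of_dvd (Nat.pos_of_ne_zero hW) (Nat.prod_primeFactors_dvd W))
  have h2 : (2 : ℝ) ^ W.primeFactors.card ≤ W := by exact_mod_cast h1
  have h3 := Real.log_le_log (by positivity) h2
  rw [Real.log_pow] at h3
  have := Real.log_two_gt_d9
  nlinarith [(Nat.cast_nonneg W.primeFactors.card : (0 : ℝ) ≤ W.primeFactors.card)]

theorem card_isPrimePow_not_prime_le {N : ℕ} (hN : N ≠ 0) :
    (((Finset.Icc 1 N).filter fun m => IsPrimePow m ∧ ¬ m.Prime).card : ℝ) ≤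
      Real.sqrt N * (2 * Real.log N + 1) := by
  have h : ((Finset.Icc 1 N).filter fun m => IsPrimePow m ∧ ¬ m.Prime) ⊆
      (Finset.Icc 1 (Nat.sqrt N) ×ˢ Finset.range (Nat.log 2 N + 1)).image fun z => z.1 ^ z.2 := by
    intro m hm
    rw [Finset.mem_filter, Finset.mem_Icc] at hm
    obtain ⟨⟨-, hmN⟩, hpp, hnp⟩ := hm
    obtain ⟨p, k, hp, hk, rfl⟩ := (isPrimePow_nat_iff _).1 hpp
    have hk2 : 2 ≤ k := by
      rcases Nat.lt_or_ge k 2 with h | h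
      · obtain rfl : k = 1 := by omega
        exact absurd (by simpa using hp) hnp
      · exact h
    refine Finset.mem_image.2 ⟨(p, k), Finset.mem_product.2 ⟨Finset.mem_Icc.2 ⟨hp.one_le, ?_⟩,
      Finset.mem_range.2 (Nat.lt_succ_of_le ?_)⟩, rfl⟩
    · rw [Nat.le_sqrt, ← sq]
      exact (Nat.pow_le_pow_right hp.pos hk2).trans hmN
    · exact Nat.le_log_of_pow_le one_lt_two ((Nat.pow_le_pow_left hp.two_le k).trans hmN)
  have h1 := (Finset.card_le_card h).trans Finset.card_image_le
  rw [Finset.card_product, Nat.card_Icc, Finset.card_range, Nat.add_sub_cancel] at h1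
  have h2 : ((Nat.log 2 N : ℕ) : ℝ) ≤ 2 * Real.log N := by
    have h3 : (2 : ℝ) ^ Nat.log 2 N ≤ N := by exact_mod_cast Nat.pow_log_le_self 2 hN
    have h4 := Real.log_le_log (by positivity) h3
    rw [Real.log_pow] at h4
    have := Real.log_two_gt_d9
    nlinarith [(Nat.cast_nonneg (Nat.log 2 N) : (0 : ℝ) ≤ Nat.log 2 N)]
  calc _ ≤ ((Nat.sqrt N * (Nat.log 2 N + 1) : ℕ) : ℝ) := by exact_mod_cast h1
    _ ≤ _ := by
      push_cast
      gcongr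
      exact Real.nat_sqrt_le_real_sqrt

theorem exp_error_le {u : ℝ} (hu : 10 ^ 7 ≤ u) :
    Real.exp ((u + 1000) / 2) * (2 * (u + 1000) + 1) + 4 * Real.exp (u / 2) ≤
      Real.exp (u - 1000) / (160 * u * u) := by
  have h1 : Real.exp (u / 4) ≥ (u / 4) ^ 4 / 24 := by
    have := Real.pow_div_factorial_le_exp (u / 4) (by linarith) 4
    simpa [Nat.factorial] using this
  have h2 : Real.exp (u - 1000) = Real.exp (u / 2 + 500) * Real.exp (u / 2 - 1500) := by
    rw [← Real.exp_add]; ring_nf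
  have h3 : Real.exp (u / 4) ≤ Real.exp (u / 2 - 1500) := Real.exp_le_exp.2 (by linarith)
  have h4 : Real.exp (u / 2) ≤ Real.exp (u / 2 + 500) := Real.exp_le_exp.2 (by linarith)
  have h5 : (u + 1000) / 2 = u / 2 + 500 := by ring
  have hu0 : 0 < u := by linarith
  rw [h5, h2, le_div_iff₀ (by positivity)]
  have h6 : 160 * u * u * (4 * u) ≤ Real.exp (u / 2 - 1500) := by
    refine le_trans ?_ (h1.le.trans h3)
    have : u ^ 3 * (10 ^ 7) ≤ u ^ 3 * u := mul_le_mul_of_nonneg_left hu (by positivity)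
    nlinarith [pow_pos hu0 3]
  calc _ ≤ (Real.exp (u / 2 + 500) * (2 * (u + 1000) + 1) + 4 * Real.exp (u / 2 + 500)) *
        (160 * u * u) := by gcongr
    _ = Real.exp (u / 2 + 500) * (160 * u * u * (2 * (u + 1000) + 1 + 4)) := by ring
    _ ≤ Real.exp (u / 2 + 500) * (160 * u * u * (4 * u)) := by
      gcongr
      linarith
    _ ≤ _ := by gcongr

/-- The primes up to `exp (u + 1000)` not dividing `W` for which `a` is not a `q`-th power. -/
noncomputable def nonresiduePrimes (q : ℕ) (a : ℤ) (u : ℝ) (W : ℕ) : Finset ℕ :=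
  open Classical in
  (Finset.Icc 1 ⌊Real.exp (u + 1000)⌋₊).filter fun p =>
    p.Prime ∧ ¬ p ∣ W ∧ ∀ y : ZMod p, y ^ q ≠ a

theorem KummerWeights.sum_rootCount_ge {f : ℤ[X]} {q : ℕ} {a : ℤ} {n : ℕ} {Q : ℝ} {L₁ L₂ : ℕ → ℝ}
    {Z : ℕ} (h : KummerWeights f q a n Q L₁ L₂ Z) (hq : 2 ≤ q) {u : ℝ} (hu : Q ^ 220 ≤ u)
    (hu7 : 10 ^ 7 ≤ u) (hn : n ≤ u) (hZu : Q * Q * (q * |(a : ℝ)|) ≤ u) {W : ℕ} (hW : W ≠ 0)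
    (hWu : Real.log W ≤ Real.exp (u / 2)) :
    Real.exp (u - 1000) / (160 * q * u) ≤
      ∑ p ∈ nonresiduePrimes q a u W, (rootCount f p : ℝ) := by
  classical
  obtain ⟨a₁, r₁, c₁, h₁⟩ := h.regular_left
  obtain ⟨a₂, r₂, c₂, h₂⟩ := h.regular_right
  have hq2 : (2 : ℝ) ≤ q := by exact_mod_cast hq
  have key := sum_fejer_diff_ge h₁ h₂ hq2 hu
  have hu0 : 0 < u := by linarith
  set y := Real.exp (u - 1000) with hy
  have hy0 : 0 < y := Real.exp_pos _
  set N := ⌊Real.exp (u + 1000)⌋₊ with hN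
  have hN0 : N ≠ 0 := by
    rw [hN, Ne, Nat.floor_eq_zero, not_lt]
    exact Real.one_le_exp (by linarith)
  have hNle : (N : ℝ) ≤ Real.exp (u + 1000) := Nat.floor_le (Real.exp_pos _).le
  set S := nonresiduePrimes q a u W with hS
  set T := ((Finset.Icc 1 N).filter fun m => IsPrimePow m ∧ ¬ m.Prime) ∪
    (Z.primeFactors ∪ W.primeFactors) with hT
  have hterm : ∀ m ∈ Finset.Icc ⌈y⌉₊ N,
      (L₁ m - L₂ m / q) * ((m : ℝ) ^ (-(1 + 1 / u)) * fejer (u - Real.log m)) ≤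
      (if m ∈ S then q * rootCount f m * (2 * u) * (2 / y) else 0) +
        if m ∈ T then n * (2 * u) * (2 / y) else 0 := by
    intro m hm
    rw [Finset.mem_Icc, Nat.ceil_le, hN, Nat.le_floor_iff (Real.exp_pos _).le] at hm
    obtain ⟨hym, hmN⟩ := hm
    have hm0 : (0 : ℝ) < m := hy0.trans_le hym
    have hm0' : m ≠ 0 := by rintro rfl; simp at hm0
    have hm1 : (1 : ℝ) ≤ m := by exact_mod_cast Nat.one_le_iff_ne_zero.2 hm0'
    have hlog : Real.log m ≤ 2 * u := by
      have := Real.log_le_log hm0 hmN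
      rw [Real.log_exp] at this
      linarith
    have hlog0 := Real.log_nonneg hm1
    have hw0 : 0 ≤ (m : ℝ) ^ (-(1 + 1 / u)) * fejer (u - Real.log m) :=
      mul_nonneg (by positivity) (fejer_nonneg _)
    have hw : (m : ℝ) ^ (-(1 + 1 / u)) * fejer (u - Real.log m) ≤ 2 / y := by
      have h1 : (m : ℝ) ^ (-(1 + 1 / u)) ≤ 1 / y := by
        calc (m : ℝ) ^ (-(1 + 1 / u)) ≤ (m : ℝ) ^ (-1 : ℝ) :=
              Real.rpow_le_rpow_of_exponent_le hm1 (by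
                have : 0 < 1 / u := by positivity
                linarith)
          _ = 1 / m := by rw [Real.rpow_neg_one, one_div]
          _ ≤ _ := by gcongr
      calc _ ≤ 1 / y * 2 := mul_le_mul h1 (fejer_le_two _) (fejer_nonneg _) (by positivity)
        _ = _ := by ring
    have hS0 : 0 ≤ (if m ∈ S then q * rootCount f m * (2 * u) * (2 / y) else 0 : ℝ) := by
      split_ifs <;> positivity
    have hT0 : 0 ≤ (if m ∈ T then n * (2 * u) * (2 / y) else 0 : ℝ) := by
      split_ifs <;> positivity
    have hL : L₁ m - L₂ m / q ≤ L₁ m := by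
      have := div_nonneg (h.nonneg_right m) (Nat.cast_nonneg q : (0 : ℝ) ≤ q)
      linarith
    by_cases hL0 : L₁ m = 0
    · exact (mul_nonpos_of_nonpos_of_nonneg (hL.trans hL0.le) hw0).trans (by positivity)
    by_cases hmT : m ∈ T
    · rw [if_pos hmT]
      refine le_trans ?_ (le_add_of_nonneg_left hS0)
      refine mul_le_mul (hL.trans ((h.le m hm0').trans ?_)) hw hw0 (by positivity)
      gcongr
    · rw [if_neg hmT, add_zero]
      have hmIcc : m ∈ Finset.Icc 1 N := by
        rw [Finset.mem_Icc, hN, Nat.le_floor_iff (Real.exp_pos _).le]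
        exact ⟨Nat.one_le_iff_ne_zero.2 hm0', hmN⟩
      rw [hT, Finset.mem_union, Finset.mem_union, not_or, not_or, Finset.mem_filter] at hmT
      have hmp : m.Prime := by
        by_contra hnp
        exact hmT.1 ⟨hmIcc, h.isPrimePow m hL0, hnp⟩
      have hmZ : ¬ m ∣ Z := fun hd => hmT.2.1 (Nat.mem_primeFactors.2 ⟨hmp, hd, h.ne_zero⟩)
      have hmW : ¬ m ∣ W := fun hd => hmT.2.2 (Nat.mem_primeFactors.2 ⟨hmp, hd, hW⟩)
      by_cases hres : ∃ y : ZMod m, y ^ q = a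
      · exact (mul_nonpos_of_nonpos_of_nonneg (h.prime_le_zero m hmp hmZ hres) hw0).trans hS0
      · have hmS : m ∈ S := by
          rw [hS, nonresiduePrimes, Finset.mem_filter]
          exact ⟨hmIcc, hmp, hmW, fun y hy => hres ⟨y, hy⟩⟩
        rw [if_pos hmS]
        refine mul_le_mul ((h.prime_le m hmp hmZ).trans ?_) hw hw0 (by positivity)
        gcongr
  have hsum := key.trans (Finset.sum_le_sum hterm)
  rw [Finset.sum_add_distrib, ← Finset.sum_filter, ← Finset.sum_filter, Finset.sum_const,
    nsmul_eq_mul] at hsum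
  have hS1 : ∑ m ∈ (Finset.Icc ⌈y⌉₊ N).filter (· ∈ S), (q * rootCount f m * (2 * u) * (2 / y) : ℝ)
      ≤ 4 * q * u / y * ∑ p ∈ S, (rootCount f p : ℝ) := by
    rw [Finset.mul_sum]
    refine (Finset.sum_le_sum_of_subset_of_nonneg (t := S)
      (fun m hm => (Finset.mem_filter.1 hm).2) fun m _ _ => by positivity).trans
      (Finset.sum_le_sum fun m _ => le_of_eq (by ring))
  have hcard : (((Finset.Icc ⌈y⌉₊ N).filter (· ∈ T)).card : ℝ) ≤ y / (160 * u * u) := by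
    refine le_trans ?_ (exp_error_le hu7)
    have h1 : ((Finset.Icc ⌈y⌉₊ N).filter (· ∈ T)).card ≤
        ((Finset.Icc 1 N).filter fun m => IsPrimePow m ∧ ¬ m.Prime).card +
          (Z.primeFactors.card + W.primeFactors.card) :=
      (Finset.card_le_card fun m hm => (Finset.mem_filter.1 hm).2).trans
        ((Finset.card_union_le _ _).trans (Nat.add_le_add_left (Finset.card_union_le _ _) _))
    have h2 : (((Finset.Icc ⌈y⌉₊ N).filter (· ∈ T)).card : ℝ) ≤
        (((Finset.Icc 1 N).filter fun m => IsPrimePow m ∧ ¬ m.Prime).card : ℝ) +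
          (Z.primeFactors.card + W.primeFactors.card) := by exact_mod_cast h1
    have hN1 : (0 : ℝ) < N := by exact_mod_cast Nat.pos_of_ne_zero hN0
    have hlogN : Real.log N ≤ u + 1000 := by
      have := Real.log_le_log hN1 hNle
      rwa [Real.log_exp] at this
    have h3 : (((Finset.Icc 1 N).filter fun m => IsPrimePow m ∧ ¬ m.Prime).card : ℝ) ≤
        Real.exp ((u + 1000) / 2) * (2 * (u + 1000) + 1) := by
      refine (card_isPrimePow_not_prime_le hN0).trans ?_
      rw [Real.exp_half]
      have : 0 ≤ Real.log N := Real.log_natCast_nonneg N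
      gcongr
    have h4 := card_primeFactors_le_log h.ne_zero
    have h5 := card_primeFactors_le_log hW
    have h6 : Real.log Z ≤ Real.exp (u / 2) := by
      have h7 : (0 : ℝ) < Z := by exact_mod_cast Nat.pos_of_ne_zero h.ne_zero
      have h8 := (Real.log_le_log h7 (h.modulus_le.trans hZu)).trans (Real.log_le_sub_one_of_pos hu0)
      have h9 := Real.quadratic_le_exp_of_nonneg (x := u / 2) (by positivity)
      nlinarith
    linarith
  have hT1 : (((Finset.Icc ⌈y⌉₊ N).filter (· ∈ T)).card : ℝ) * (n * (2 * u) * (2 / y)) ≤ 1 / 40 := by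
    calc _ ≤ y / (160 * u * u) * (u * (2 * u) * (2 / y)) := by gcongr
      _ = 1 / 40 := by field_simp; norm_num
  have hfin : (1 / 40 : ℝ) ≤ 4 * q * u / y * ∑ p ∈ S, (rootCount f p : ℝ) := by linarith
  have hq0 : (0 : ℝ) < q := by linarith
  rw [div_le_iff₀ (by positivity)]
  have h10 : y * (1 / 40) ≤ y * (4 * q * u / y * ∑ p ∈ S, (rootCount f p : ℝ)) := by gcongr
  have h11 : y * (4 * q * u / y * ∑ p ∈ S, (rootCount f p : ℝ)) =
      4 * q * u * ∑ p ∈ S, (rootCount f p : ℝ) := by field_simp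
  linarith

end

section
open Polynomial
open scoped NNReal

theorem Multiset.norm_prod_le_pow {s : Multiset ℂ} {B : ℝ} (h : ∀ z ∈ s, ‖z‖ ≤ B) :
    ‖s.prod‖ ≤ B ^ card s := by
  induction s using Multiset.induction with
  | empty => simp
  | cons z s ih =>
    rw [prod_cons, card_cons, pow_succ', norm_mul]
    have h0 := h z (mem_cons_self z s)
    exact mul_le_mul h0 (ih fun w hw => h w (mem_cons_of_mem hw)) (norm_nonneg _)
      ((norm_nonneg z).trans h0)

theorem abs_resultant_le {f g : ℤ[X]} (hf : f.Monic) (hg : g.Monic) {B : ℝ}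
    (hfB : ∀ z : ℂ, aeval z f = 0 → ‖z‖ ≤ B) (hgB : ∀ z : ℂ, aeval z g = 0 → ‖z‖ ≤ B) :
    |((resultant f g : ℤ) : ℝ)| ≤ (2 * B) ^ (f.natDegree * g.natDegree) := by
  have hsf := IsAlgClosed.splits (f.map (Int.castRingHom ℂ))
  have hsg := IsAlgClosed.splits (g.map (Int.castRingHom ℂ))
  have h1 := resultant_map_map f g f.natDegree g.natDegree (Int.castRingHom ℂ)
  have h2 := resultant_eq_prod_roots_sub (f.map (Int.castRingHom ℂ)) (g.map (Int.castRingHom ℂ))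
    (hf.map _) (hg.map _) hsf hsg
  rw [hf.natDegree_map, hg.natDegree_map, h1, eq_intCast] at h2
  have hroot : ∀ (P : ℤ[X]), (∀ z : ℂ, aeval z P = 0 → ‖z‖ ≤ B) →
      ∀ z ∈ (P.map (Int.castRingHom ℂ)).roots, ‖z‖ ≤ B := fun P hP z hz => hP z (by
    rw [aeval_def, eval₂_eq_eval_map]
    exact isRoot_of_mem_roots hz)
  rw [← Complex.norm_intCast, h2]
  refine (Multiset.norm_prod_le_pow (B := 2 * B) ?_).trans (le_of_eq ?_)
  · intro w hw
    obtain ⟨⟨z₁, z₂⟩, hz, rfl⟩ := Multiset.mem_map.1 hw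
    rw [Multiset.mem_product] at hz
    have := norm_sub_le z₁ z₂
    have := hroot f hfB z₁ hz.1
    have := hroot g hgB z₂ hz.2
    simp only
    linarith
  · rw [Multiset.card_map, Multiset.card_product, ← hsf.natDegree_eq_card_roots,
      ← hsg.natDegree_eq_card_roots, hf.natDegree_map, hg.natDegree_map]

theorem resultant_ne_zero_of_irreducible {f g : ℤ[X]} (hf : f.Monic) (hg : g.Monic)
    (hfi : Irreducible f) (hgi : Irreducible g) (hne : f ≠ g) : resultant f g ≠ 0 := by
  have hfQ := (Monic.irreducible_iff_irreducible_map_fraction_map (K := ℚ) hf).1 hfi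
  have hinj := FaithfulSMul.algebraMap_injective ℤ ℚ
  have hgQ := (Monic.irreducible_iff_irreducible_map_fraction_map (K := ℚ) hg).1 hgi
  have hcop : IsCoprime (f.map (algebraMap ℤ ℚ)) (g.map (algebraMap ℤ ℚ)) := by
    refine (hfQ.coprime_iff_not_dvd).2 fun hdvd => hne ?_
    exact map_injective _ hinj
      (eq_of_monic_of_associated (hf.map _) (hg.map _) (hfQ.associated_of_dvd hgQ hdvd))
  have := resultant_ne_zero _ _ hcop
  rw [hf.natDegree_map, hg.natDegree_map, resultant_map_map] at this
  exact fun h => this (by rw [h, map_zero])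

theorem dvd_resultant_of_common_root {f g : ℤ[X]} (hdeg : f.natDegree ≠ 0) {p : ℕ} {y : ZMod p}
    (hfy : aeval y f = 0) (hgy : aeval y g = 0) : (p : ℤ) ∣ resultant f g := by
  obtain ⟨s, t, -, -, h⟩ := exists_mul_add_mul_eq_C_resultant f g le_rfl le_rfl (Or.inl hdeg)
  have h1 := congrArg (aeval y) h
  rw [map_add, map_mul, map_mul, hfy, hgy, zero_mul, zero_mul, add_zero, aeval_C,
    algebraMap_int_eq, eq_intCast] at h1
  exact (ZMod.intCast_zmod_eq_zero_iff_dvd _ _).1 h1.symm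

/-- Distinct monic irreducible polynomials have no common root modulo primes outside an explicitly
bounded modulus. -/
theorem exists_modulus_of_irreducible {f g : ℤ[X]} (hf : f.Monic) (hg : g.Monic)
    (hfi : Irreducible f) (hgi : Irreducible g) (hne : f ≠ g) {B : ℝ} (hB : 1 ≤ B) {N : ℕ}
    (hfB : ∀ z : ℂ, aeval z f = 0 → ‖z‖ ≤ B) (hgB : ∀ z : ℂ, aeval z g = 0 → ‖z‖ ≤ B)
    (hfN : f.natDegree ≤ N) (hgN : g.natDegree ≤ N) :
    ∃ R : ℕ, R ≠ 0 ∧ (R : ℝ) ≤ (2 * B) ^ (N * N) ∧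
      ∀ p : ℕ, ∀ y : ZMod p, aeval y f = 0 → aeval y g = 0 → p ∣ R := by
  refine ⟨(resultant f g).natAbs,
    Int.natAbs_ne_zero.2 (resultant_ne_zero_of_irreducible hf hg hfi hgi hne), ?_,
    fun p y hfy hgy => Int.natCast_dvd.1 (dvd_resultant_of_common_root ?_ hfy hgy)⟩
  · rw [Nat.cast_natAbs, Int.cast_abs]
    refine (abs_resultant_le hf hg hfB hgB).trans (pow_le_pow_right₀ (by linarith) ?_)
    exact Nat.mul_le_mul hfN hgN
  · exact fun h => hfi.not_isUnit (eq_one_of_monic_natDegree_zero hf h ▸ isUnit_one)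

end

section
open Polynomial
open scoped NNReal

theorem Finset.prod_range_mul_of_periodic {M : Type*} [CommMonoid M] {g : ℕ → M} {l : ℕ}
    (hg : g.Periodic l) (j : ℕ) :
    ∏ i ∈ range (j * l), g i = (∏ i ∈ range l, g i) ^ j := by
  induction j with
  | zero => simp
  | succ j ih =>
    rw [add_mul, one_mul, prod_range_add, ih, pow_succ]
    congr 1
    refine prod_congr rfl fun i _ => ?_
    rw [add_comm]
    exact hg.nat_mul j i

theorem ZMod.prod_X_add_range (ℓ : ℕ) [Fact ℓ.Prime] :
    ∏ i ∈ Finset.range ℓ, (X + C ((i : ZMod ℓ) + 1)) = (X ^ ℓ - X : (ZMod ℓ)[X]) := by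
  have hℓ : ℓ.Prime := Fact.out
  have h1 : ∏ i ∈ Finset.range ℓ, (X + C ((i : ZMod ℓ) + 1)) =
      ∏ z : ZMod ℓ, (X - C z : (ZMod ℓ)[X]) := by
    refine Finset.prod_bij' (fun i _ => -((i : ZMod ℓ) + 1)) (fun z _ => (-z - 1).val)
      (fun _ _ => Finset.mem_univ _) (fun z _ => Finset.mem_range.2 (ZMod.val_lt _)) ?_ ?_ ?_
    · intro i hi
      rw [neg_neg, add_sub_cancel_right, ZMod.val_cast_of_lt (Finset.mem_range.1 hi)]
    · intro z _
      rw [ZMod.natCast_zmod_val]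
      ring
    · intro i _
      rw [C_neg, sub_neg_eq_add]
  have hmonic : (X ^ ℓ - X : (ZMod ℓ)[X]).Monic :=
    monic_X_pow_sub (by rw [degree_X]; exact_mod_cast hℓ.one_lt)
  have hroots : (X ^ ℓ - X : (ZMod ℓ)[X]).roots = Finset.univ.val := by
    have := FiniteField.roots_X_pow_card_sub_X (ZMod ℓ)
    rwa [ZMod.card] at this
  rw [h1, ← prod_multiset_X_sub_C_of_monic_of_roots_card_eq hmonic, hroots]
  · rfl
  · rw [hroots, FiniteField.X_pow_card_sub_X_natDegree_eq _ hℓ.one_lt]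
    simp [ZMod.card]

/-- The polynomial whose roots modulo `p` are the `m` with `F_P(m + k) ≡ F_P(m)`. -/
noncomputable def collisionPoly (P : ℤ[X]) (k : ℕ) : ℤ[X] :=
  ∏ i ∈ Finset.range k, P.comp (X + C ((i : ℤ) + 1)) - 1

theorem aeval_collisionPoly {R : Type*} [CommRing R] (P : ℤ[X]) (k : ℕ) (x : R) :
    aeval x (collisionPoly P k) = ∏ i ∈ Finset.range k, aeval (x + (i + 1)) P - 1 := by
  rw [collisionPoly, map_sub, map_prod, map_one]
  congr 1
  refine Finset.prod_congr rfl fun i _ => ?_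
  rw [aeval_comp]
  simp

theorem monic_prod_comp {P : ℤ[X]} (hP : P.Monic) (k : ℕ) :
    (∏ i ∈ Finset.range k, P.comp (X + C ((i : ℤ) + 1))).Monic :=
  monic_prod_of_monic _ _ fun _ _ => hP.comp_X_add_C _

theorem natDegree_prod_comp {P : ℤ[X]} (hP : P.Monic) (k : ℕ) :
    (∏ i ∈ Finset.range k, P.comp (X + C ((i : ℤ) + 1))).natDegree = k * P.natDegree := by
  rw [natDegree_prod_of_monic _ _ fun _ _ => hP.comp_X_add_C _]
  simp only [natDegree_comp, natDegree_X_add_C, mul_one, Finset.sum_const, Finset.card_range,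
    smul_eq_mul]

theorem monic_collisionPoly {P : ℤ[X]} (hP : P.Monic) {k : ℕ} (hk : k ≠ 0) (hd : P.natDegree ≠ 0) :
    (collisionPoly P k).Monic := by
  refine (monic_prod_comp hP k).sub_of_left ?_
  rw [degree_one, degree_eq_natDegree (monic_prod_comp hP k).ne_zero, natDegree_prod_comp hP]
  exact_mod_cast Nat.pos_of_ne_zero (mul_ne_zero hk hd)

theorem natDegree_collisionPoly_le {P : ℤ[X]} (hP : P.Monic) (k : ℕ) :
    (collisionPoly P k).natDegree ≤ k * P.natDegree := by
  refine (natDegree_sub_le _ _).trans ?_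
  rw [natDegree_prod_comp hP, natDegree_one]
  simp

theorem norm_le_of_aeval_collisionPoly {d : ℕ} (hd : d ≠ 0) {a : ℤ} {k : ℕ} (hk : k ≠ 0) {z : ℂ}
    (hz : aeval z (collisionPoly (X ^ d - C a) k) = 0) : ‖z‖ ≤ k + |(a : ℝ)| + 2 := by
  by_contra! hlt
  rw [aeval_collisionPoly, sub_eq_zero] at hz
  have h1 : ∀ i ∈ Finset.range k, 1 < ‖aeval (z + (i + 1)) (X ^ d - C a : ℤ[X])‖ := by
    intro i hi
    have hi' : ((i : ℝ) + 1) ≤ k := by exact_mod_cast Finset.mem_range.1 hi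
    have h2 : ‖((i : ℂ) + 1)‖ = i + 1 := by
      rw [show ((i : ℂ) + 1) = ((i + 1 : ℕ) : ℂ) by push_cast; rfl, Complex.norm_natCast]
      push_cast; rfl
    have h3 : ‖z‖ ≤ ‖z + (i + 1)‖ + ‖((i : ℂ) + 1)‖ := by
      simpa using norm_sub_le (z + (i + 1)) ((i : ℂ) + 1)
    have h4 : |(a : ℝ)| + 2 ≤ ‖z + (i + 1)‖ := by linarith
    have h0 := abs_nonneg (a : ℝ)
    have h5 : ‖z + (i + 1)‖ ≤ ‖z + (i + 1)‖ ^ d := le_self_pow₀ (by linarith) hd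
    have h6 : ‖(z + (i + 1)) ^ d‖ ≤ ‖(z + (i + 1)) ^ d - a‖ + ‖(a : ℂ)‖ := by
      simpa using norm_add_le ((z + (i + 1)) ^ d - a) (a : ℂ)
    rw [norm_pow, Complex.norm_intCast] at h6
    rw [map_sub, map_pow, aeval_X, aeval_C, algebraMap_int_eq, eq_intCast]
    linarith
  have h2 := congrArg norm hz
  rw [norm_prod, norm_one] at h2
  have h3 : ∏ _i ∈ Finset.range k, (1 : ℝ) <
      ∏ i ∈ Finset.range k, ‖aeval (z + (i + 1)) (X ^ d - C a : ℤ[X])‖ :=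
    Finset.prod_lt_prod_of_nonempty (fun _ _ => one_pos) h1 ⟨0, Finset.mem_range.2
      (Nat.pos_of_ne_zero hk)⟩
  rw [h2, Finset.prod_const_one] at h3
  exact lt_irrefl _ h3

theorem map_collisionPoly {ℓ : ℕ} [Fact ℓ.Prime] {a : ℤ} (ha : (ℓ : ℤ) ∣ a) (d j : ℕ) :
    (collisionPoly (X ^ d - C a) (j * ℓ)).map (Int.castRingHom (ZMod ℓ)) =
      (X ^ ℓ - X) ^ (j * d) - 1 := by
  have ha0 : (a : ZMod ℓ) = 0 := (ZMod.intCast_zmod_eq_zero_iff_dvd a ℓ).2 ha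
  have h1 : (∏ i ∈ Finset.range (j * ℓ), (X ^ d - C a).comp (X + C ((i : ℤ) + 1))).map
      (Int.castRingHom (ZMod ℓ)) =
      ∏ i ∈ Finset.range (j * ℓ), (X + C ((i : ZMod ℓ) + 1)) ^ d := by
    rw [Polynomial.map_prod]
    refine Finset.prod_congr rfl fun i _ => ?_
    rw [map_comp, Polynomial.map_sub, Polynomial.map_pow, map_X, map_C, eq_intCast, ha0, C_0,
      sub_zero, X_pow_comp, Polynomial.map_add, map_X, map_C]
    simp
  rw [collisionPoly, Polynomial.map_sub, Polynomial.map_one, h1, Finset.prod_range_mul_of_periodic,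
    Finset.prod_pow, ZMod.prod_X_add_range, ← pow_mul, mul_comm d j]
  intro i
  simp

theorem separable_map_collisionPoly {ℓ : ℕ} [Fact ℓ.Prime] {a : ℤ} (ha : (ℓ : ℤ) ∣ a) {d j : ℕ}
    (hjd : ¬ ℓ ∣ j * d) :
    ((collisionPoly (X ^ d - C a) (j * ℓ)).map (Int.castRingHom (ZMod ℓ))).Separable := by
  rw [map_collisionPoly ha]
  set n := j * d
  have hn : (n : ZMod ℓ) ≠ 0 := by rwa [Ne, ZMod.natCast_eq_zero_iff]
  have hn1 : n ≠ 0 := by rintro h; rw [h] at hjd; exact hjd (dvd_zero _)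
  obtain ⟨m, hm⟩ := Nat.exists_eq_succ_of_ne_zero hn1
  refine separable_def' _ |>.2 ⟨-1, -C ((n : ZMod ℓ)⁻¹) * (X ^ ℓ - X), ?_⟩
  have hder : derivative ((X ^ ℓ - X : (ZMod ℓ)[X]) ^ n - 1) =
      -(C (n : ZMod ℓ) * (X ^ ℓ - X) ^ (n - 1)) := by
    simp [derivative_pow]
  have hC : C ((n : ZMod ℓ)⁻¹) * C (n : ZMod ℓ) = 1 := by rw [← C_mul, inv_mul_cancel₀ hn, C_1]
  rw [hder, hm, Nat.succ_sub_one, pow_succ, ← hm]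
  linear_combination ((X ^ ℓ - X) ^ m * (X ^ ℓ - X)) * hC

theorem eval_collisionPoly_ne_zero {ℓ : ℕ} [Fact ℓ.Prime] {a : ℤ} (ha : (ℓ : ℤ) ∣ a) {d j : ℕ}
    (hjd : j * d ≠ 0) (t : ℤ) : (collisionPoly (X ^ d - C a) (j * ℓ)).eval t ≠ 0 := by
  intro h
  have h1 := congrArg (eval (t : ZMod ℓ)) (map_collisionPoly ha d j)
  rw [eval_intCast_map, Int.cast_id, h] at h1
  simp [hjd] at h1

end

section
open Polynomial
open scoped NNReal

theorem exists_monic_irreducible_dvd {K : Type*} [CommRing K] [IsDomain K] {P : ℤ[X]}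
    (hP : P.Monic) {x : K} (hx : eval₂ (Int.castRingHom K) x P = 0) :
    ∃ f : ℤ[X], f.Monic ∧ Irreducible f ∧ f ∣ P ∧ eval₂ (Int.castRingHom K) x f = 0 := by
  obtain ⟨s, hs, hsP⟩ := UniqueFactorizationMonoid.exists_prime_factors P hP.ne_zero
  rw [← coe_eval₂RingHom] at hx ⊢
  have h1 : eval₂RingHom (Int.castRingHom K) x s.prod = 0 := by
    obtain ⟨w, hw⟩ := hsP.symm
    rw [← hw, map_mul, hx, zero_mul]
  rw [map_multiset_prod, Multiset.prod_eq_zero_iff, Multiset.mem_map] at h1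
  obtain ⟨g, hgs, hgx⟩ := h1
  have hgP : g ∣ P := (Multiset.dvd_prod hgs).trans hsP.dvd
  have hlead : IsUnit g.leadingCoeff := by
    obtain ⟨t, ht⟩ := hgP
    have := congrArg leadingCoeff ht
    rw [hP.leadingCoeff, leadingCoeff_mul] at this
    exact IsUnit.of_mul_eq_one _ this.symm
  obtain ⟨w, hw⟩ := hlead
  have hass : Associated g (C ((w⁻¹ : ℤˣ) : ℤ) * g) :=
    (associated_unit_mul_left _ _ (isUnit_C.2 (Units.isUnit _))).symm
  refine ⟨C ((w⁻¹ : ℤˣ) : ℤ) * g, ?_, hass.irreducible (hs g hgs).irreducible,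
    hass.symm.dvd.trans hgP, by rw [map_mul, hgx, mul_zero]⟩
  rw [Monic, leadingCoeff_mul, leadingCoeff_C, ← hw, Units.inv_mul]

theorem eval₂_collisionPoly {ℓ : ℕ} [Fact ℓ.Prime] {K : Type*} [Field K] [Algebra (ZMod ℓ) K]
    {a : ℤ} (ha : (ℓ : ℤ) ∣ a) (d j : ℕ) (x : K) :
    eval₂ (Int.castRingHom K) x (collisionPoly (X ^ d - C a) (j * ℓ)) = (x ^ ℓ - x) ^ (j * d) - 1 := by
  have h := congrArg (aeval x) (map_collisionPoly ha d j)
  rw [aeval_def, eval₂_map, RingHom.eq_intCast' ((algebraMap (ZMod ℓ) K).comp _)] at h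
  rw [h]
  simp

theorem exists_irreducible_dvd_collisionPoly {ℓ : ℕ} [Fact ℓ.Prime] {a : ℤ} (ha : (ℓ : ℤ) ∣ a)
    {d j : ℕ} (hjd : ¬ ℓ ∣ j * d) :
    ∃ f : ℤ[X], f.Monic ∧ Irreducible f ∧ f ∣ collisionPoly (X ^ d - C a) (j * ℓ) ∧
      ∃ x : AlgebraicClosure (ZMod ℓ), eval₂ (Int.castRingHom _) x f = 0 ∧
        IsPrimitiveRoot (x ^ ℓ - x) (j * d) := by
  have hℓ : ℓ.Prime := Fact.out
  have hjd0 : j * d ≠ 0 := fun h => hjd (h ▸ dvd_zero _)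
  have : NeZero ((j * d : ℕ) : AlgebraicClosure (ZMod ℓ)) := ⟨by
    rwa [Ne, CharP.cast_eq_zero_iff _ ℓ]⟩
  obtain ⟨ζ, hζ⟩ := HasEnoughRootsOfUnity.exists_primitiveRoot (AlgebraicClosure (ZMod ℓ)) (j * d)
  have hdeg : (X ^ ℓ - X : (AlgebraicClosure (ZMod ℓ))[X]).degree = ℓ := by
    rw [degree_eq_natDegree (FiniteField.X_pow_card_sub_X_ne_zero _ hℓ.one_lt),
      FiniteField.X_pow_card_sub_X_natDegree_eq _ hℓ.one_lt]
  obtain ⟨x, hx⟩ := IsAlgClosed.exists_root (X ^ ℓ - X - C ζ) (by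
    rw [degree_sub_C (by rw [hdeg]; exact_mod_cast hℓ.pos), hdeg]
    exact_mod_cast hℓ.ne_zero)
  have hx' : x ^ ℓ - x = ζ := by
    rw [IsRoot.def, eval_sub, eval_sub, eval_pow, eval_X, eval_C, sub_eq_zero] at hx
    exact hx
  have hmonic : (collisionPoly (X ^ d - C a) (j * ℓ)).Monic :=
    monic_collisionPoly (monic_X_pow_sub_C a (right_ne_zero_of_mul hjd0))
      (mul_ne_zero (left_ne_zero_of_mul hjd0) hℓ.ne_zero)
      (by rw [natDegree_X_pow_sub_C]; exact right_ne_zero_of_mul hjd0)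
  obtain ⟨f, hf, hfi, hfd, hfx⟩ := exists_monic_irreducible_dvd hmonic (x := x)
    (by rw [eval₂_collisionPoly ha, hx', hζ.pow_eq_one, sub_self])
  exact ⟨f, hf, hfi, hfd, x, hfx, hx' ▸ hζ⟩

theorem dvd_of_dvd_collisionPoly {ℓ : ℕ} [Fact ℓ.Prime] {a : ℤ} (ha : (ℓ : ℤ) ∣ a)
    {d i j : ℕ} (hd : d ≠ 0) {f : ℤ[X]} {x : AlgebraicClosure (ZMod ℓ)}
    (hx : eval₂ (Int.castRingHom _) x f = 0) (hprim : IsPrimitiveRoot (x ^ ℓ - x) (j * d))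
    (hdvd : f ∣ collisionPoly (X ^ d - C a) (i * ℓ)) : j ∣ i := by
  obtain ⟨g, hg⟩ := hdvd
  have h1 := congrArg (eval₂ (Int.castRingHom _) x) hg
  rw [eval₂_collisionPoly ha, eval₂_mul, hx, zero_mul, sub_eq_zero] at h1
  exact Nat.dvd_of_mul_dvd_mul_right (Nat.pos_of_ne_zero hd) (hprim.dvd_of_pow_eq_one _ h1)

end

section
open Polynomial

theorem Fprod_add (P : ℤ[X]) (m k : ℕ) :
    Fprod P (m + k) = Fprod P m * ∏ i ∈ Finset.range k, P.eval ((m : ℤ) + (i + 1)) := by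
  induction k with
  | zero => simp
  | succ k ih =>
    rw [Finset.prod_range_succ, ← mul_assoc, ← ih, ← add_assoc, Fprod, Fprod,
      Finset.prod_Icc_succ_top (by omega)]
    push_cast
    rw [add_assoc]

theorem cast_Fprod_add_eq {P : ℤ[X]} {p m k : ℕ}
    (h : aeval (m : ZMod p) (collisionPoly P k) = 0) :
    (Fprod P (m + k) : ZMod p) = Fprod P m := by
  have h1 : ((∏ i ∈ Finset.range k, P.eval ((m : ℤ) + (i + 1)) : ℤ) : ZMod p) = 1 := by
    rw [aeval_collisionPoly, sub_eq_zero] at h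
    rw [← h, Int.cast_prod]
    refine Finset.prod_congr rfl fun i _ => ?_
    rw [aeval_int_eq_eval₂]
    have := eval₂_at_apply (p := P) (Int.castRingHom (ZMod p)) ((m : ℤ) + (i + 1))
    simpa using this.symm
  rw [Fprod_add, Int.cast_mul, h1, mul_one]

theorem Gval_le (P : ℤ[X]) (p : ℕ) : Gval P p ≤ p := by
  have := Finset.card_image_le (s := Finset.Icc 1 p) (f := fun n => ((Fprod P n : ℤ) : ZMod p))
  rw [Nat.card_Icc, Nat.add_sub_cancel] at this
  unfold Gval
  convert this

theorem card_add_Gval_le {P : ℤ[X]} {p : ℕ} {S : Finset ℕ} (hS : S ⊆ Finset.Icc 1 p)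
    (h : ∀ m ∈ S, ∃ k, 1 ≤ k ∧ m + k ≤ p ∧ (Fprod P (m + k) : ZMod p) = Fprod P m) :
    S.card + Gval P p ≤ p := by
  classical
  have key : ∀ r n, 1 ≤ n → n ≤ p → p - n = r →
      ((Fprod P n : ℤ) : ZMod p) ∈ (Finset.Icc 1 p \ S).image fun n => ((Fprod P n : ℤ) : ZMod p) := by
    intro r
    induction r using Nat.strong_induction_on with
    | _ r ih =>
      intro n hn hnp hr
      by_cases hnS : n ∈ S
      · obtain ⟨k, hk, hkp, hF⟩ := h n hnS
        rw [← hF]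
        exact ih (p - (n + k)) (by omega) (n + k) (by omega) hkp rfl
      · exact Finset.mem_image_of_mem (fun n => ((Fprod P n : ℤ) : ZMod p))
          (Finset.mem_sdiff.2 ⟨Finset.mem_Icc.2 ⟨hn, hnp⟩, hnS⟩)
  have h1 : Gval P p ≤ (Finset.Icc 1 p \ S).card := by
    refine le_trans ?_ (Finset.card_image_le (f := fun n => ((Fprod P n : ℤ) : ZMod p)))
    unfold Gval
    refine le_trans (le_of_eq ?_) (Finset.card_le_card (s := (Finset.Icc 1 p).image
      fun n => ((Fprod P n : ℤ) : ZMod p)) fun z hz => ?_)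
    · congr
    · obtain ⟨n, hn, rfl⟩ := Finset.mem_image.1 hz
      rw [Finset.mem_Icc] at hn
      exact key _ n hn.1 hn.2 rfl
  rw [Finset.card_sdiff_of_subset hS, Nat.card_Icc, Nat.add_sub_cancel] at h1
  have h2 := Finset.card_le_card hS
  rw [Nat.card_Icc, Nat.add_sub_cancel] at h2
  omega

theorem sum_rootCount_add_Gval_le {P : ℤ[X]} {p : ℕ} (hp : p ≠ 0) {J : ℕ} {f : ℕ → ℤ[X]}
    {k : ℕ → ℕ} (hk : ∀ i < J, k i ≠ 0) (hdvd : ∀ i < J, f i ∣ collisionPoly P (k i))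
    (hdisj : ∀ i < J, ∀ j < J, i ≠ j → ∀ y : ZMod p, aeval y (f i) = 0 → aeval y (f j) ≠ 0)
    (hneg : ∀ i < J, ∀ s < k i, aeval (-(s : ZMod p)) (f i) ≠ 0) :
    ∑ i ∈ Finset.range J, rootCount (f i) p + Gval P p ≤ p := by
  classical
  have : NeZero p := ⟨hp⟩
  set rep : ZMod p → ℕ := fun y => if y = 0 then p else y.val with hrep
  have hrepcast : ∀ y, (rep y : ZMod p) = y := by
    intro y
    by_cases hy : y = 0
    · simp [hrep, hy]
    · simp [hrep, hy]
  have hrepmem : ∀ y, rep y ∈ Finset.Icc 1 p := by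
    intro y
    rw [Finset.mem_Icc]
    by_cases hy : y = 0
    · simp only [hrep, if_pos hy]
      omega
    · simp only [hrep, if_neg hy]
      exact ⟨Nat.one_le_iff_ne_zero.2 (by rwa [Ne, ZMod.val_eq_zero]), (ZMod.val_lt y).le⟩
  have hinj : Function.Injective rep := fun y z h => by
    rw [← hrepcast y, h, hrepcast]
  set S : Finset ℕ := ((Finset.range J).biUnion fun i =>
    Finset.univ.filter fun y : ZMod p => aeval y (f i) = 0).image rep with hS
  have hcard : S.card = ∑ i ∈ Finset.range J, rootCount (f i) p := by
    rw [hS, Finset.card_image_of_injective _ hinj, Finset.card_biUnion]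
    · refine Finset.sum_congr rfl fun i _ => ?_
      rw [rootCount, Nat.card_eq_fintype_card, Fintype.card_subtype]
    · intro i hi j hj hij
      rw [Function.onFun, Finset.disjoint_left]
      intro y hy hy'
      exact hdisj i (Finset.mem_range.1 hi) j (Finset.mem_range.1 hj) hij y
        (Finset.mem_filter.1 hy).2 (Finset.mem_filter.1 hy').2
  rw [← hcard]
  refine card_add_Gval_le (fun m hm => ?_) fun m hm => ?_
  · obtain ⟨y, -, rfl⟩ := Finset.mem_image.1 hm
    exact hrepmem y
  · obtain ⟨y, hy, rfl⟩ := Finset.mem_image.1 hm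
    obtain ⟨i, hi, hy⟩ := Finset.mem_biUnion.1 hy
    rw [Finset.mem_range] at hi
    have hy0 := (Finset.mem_filter.1 hy).2
    refine ⟨k i, Nat.one_le_iff_ne_zero.2 (hk i hi), ?_, cast_Fprod_add_eq ?_⟩
    · by_contra! hlt
      have hle := (Finset.mem_Icc.1 (hrepmem y)).2
      refine hneg i hi (p - rep y) (by omega) ?_
      rwa [Nat.cast_sub hle, hrepcast, ZMod.natCast_self, zero_sub, neg_neg]
    · obtain ⟨g, hg⟩ := hdvd i hi
      rw [hrepcast, hg, map_mul, hy0, zero_mul]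

theorem not_dvd_add_one_mul {ℓ d : ℕ} (hℓ : ℓ.Prime) (hd : ¬ ℓ ∣ d) (i : ℕ) :
    ¬ ℓ ∣ (1 + ℓ * i) * d := by
  intro h
  rcases hℓ.dvd_mul.1 h with h | h
  · rw [Nat.dvd_add_left (dvd_mul_right _ _)] at h
    exact hℓ.one_lt.ne' (Nat.dvd_one.1 h)
  · exact hd h

theorem collision_index_le {ℓ J i : ℕ} (hℓ : ℓ ≠ 0) (hi : i < J) :
    (1 + ℓ * i) * ℓ ≤ ℓ ^ 2 * J := by
  obtain ⟨r, rfl⟩ := Nat.exists_eq_add_of_lt hi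
  have : 1 ≤ ℓ := Nat.one_le_iff_ne_zero.2 hℓ
  nlinarith [Nat.zero_le (ℓ * ℓ * r)]

theorem exists_irreducible_collision_family {ℓ : ℕ} [Fact ℓ.Prime] {a : ℤ} (ha : (ℓ : ℤ) ∣ a)
    {d : ℕ} (hd : ¬ ℓ ∣ d) (J : ℕ) {B : ℝ} (hB : (ℓ : ℝ) ^ 2 * J + |(a : ℝ)| + 2 ≤ B) :
    ∃ f : ℕ → ℤ[X], ∃ W : ℕ, W ≠ 0 ∧
      (W : ℝ) ≤ (2 * B) ^ ((ℓ ^ 2 * J * d) ^ 2 * (J * (ℓ ^ 2 * J + J))) ∧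
      (∀ i < J, (f i).Monic ∧ Irreducible (f i) ∧ (f i).natDegree ≤ ℓ ^ 2 * J * d ∧
        Squarefree ((f i).map (Int.castRingHom (ZMod ℓ))) ∧
        ∀ z : ℂ, aeval z (f i) = 0 → ‖z‖ ≤ B) ∧
      ∀ p : ℕ, p ≠ 0 → ¬ p ∣ W →
        ∑ i ∈ Finset.range J, rootCount (f i) p + Gval (X ^ d - C a) p ≤ p := by
  have hℓ : ℓ.Prime := Fact.out
  have hd0 : d ≠ 0 := fun h => hd (h ▸ dvd_zero _)
  have hjd := not_dvd_add_one_mul hℓ hd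
  choose f hf hfi hfd x hx hprim using fun i =>
    exists_irreducible_dvd_collisionPoly ha (hjd i)
  have hP : (X ^ d - C a).Monic := monic_X_pow_sub_C a hd0
  have hPd : (X ^ d - C a).natDegree = d := natDegree_X_pow_sub_C
  have hcoll : ∀ i, (collisionPoly (X ^ d - C a) ((1 + ℓ * i) * ℓ)).Monic := fun i =>
    monic_collisionPoly hP (by simp [hℓ.ne_zero]) (by rwa [hPd])
  set N := ℓ ^ 2 * J * d with hN
  set K := ℓ ^ 2 * J with hK
  have hkK : ∀ i < J, (1 + ℓ * i) * ℓ ≤ K := fun i hi => collision_index_le hℓ.ne_zero hi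
  have hB' : (K : ℝ) + |(a : ℝ)| + 2 ≤ B := by
    rw [hK]
    push_cast
    exact hB
  have ha0 := abs_nonneg (a : ℝ)
  have hK0 : (0 : ℝ) ≤ K := Nat.cast_nonneg _
  have hB1 : 1 ≤ B := by linarith
  have hdeg : ∀ i < J, (f i).natDegree ≤ N := fun i hi => by
    refine (natDegree_le_of_dvd (hfd i) (hcoll i).ne_zero).trans
      ((natDegree_collisionPoly_le hP _).trans ?_)
    rw [hPd]
    exact Nat.mul_le_mul_right d (hkK i hi)
  have hroot : ∀ i < J, ∀ z : ℂ, aeval z (f i) = 0 → ‖z‖ ≤ B := fun i hi z hz => by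
    obtain ⟨g, hg⟩ := hfd i
    have h1 : aeval z (collisionPoly (X ^ d - C a) ((1 + ℓ * i) * ℓ)) = 0 := by
      rw [hg, map_mul, hz, zero_mul]
    refine (norm_le_of_aeval_collisionPoly hd0 (by simp [hℓ.ne_zero]) h1).trans (le_trans ?_ hB')
    have : (((1 + ℓ * i) * ℓ : ℕ) : ℝ) ≤ K := by exact_mod_cast hkK i hi
    linarith
  have hne : ∀ i j, i ≠ j → f i ≠ f j := by
    intro i j hij h
    have h1 : (1 + ℓ * i) ∣ (1 + ℓ * j) :=
      dvd_of_dvd_collisionPoly ha hd0 (hx i) (hprim i) (h ▸ hfd j)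
    have h2 : (1 + ℓ * j) ∣ (1 + ℓ * i) :=
      dvd_of_dvd_collisionPoly ha hd0 (hx j) (hprim j) (h ▸ hfd i)
    have h3 := Nat.dvd_antisymm h1 h2
    exact hij (Nat.eq_of_mul_eq_mul_left hℓ.pos (by omega))
  have hneX : ∀ i, ∀ s : ℕ, f i ≠ X - C (-(s : ℤ)) := by
    intro i s h
    obtain ⟨g, hg⟩ := hfd i
    refine eval_collisionPoly_ne_zero ha (fun h => hjd i (h ▸ dvd_zero _)) (-(s : ℤ)) ?_
    rw [hg, eval_mul, h]
    simp
  have hR : ∀ i < J, ∀ s < K, ∃ R : ℕ, R ≠ 0 ∧ (R : ℝ) ≤ (2 * B) ^ (N * N) ∧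
      ∀ p : ℕ, ∀ y : ZMod p, aeval y (f i) = 0 → aeval y (X - C (-(s : ℤ))) = 0 → p ∣ R := by
    intro i hi s hs
    refine exists_modulus_of_irreducible (hf i) (monic_X_sub_C _) (hfi i) (irreducible_X_sub_C _)
      (hneX i s) hB1 (hroot i hi) (fun z hz => ?_) (hdeg i hi) ?_
    · rw [map_sub, aeval_X, aeval_C, sub_eq_zero] at hz
      rw [hz]
      simp only [algebraMap_int_eq, eq_intCast, Int.cast_neg, Int.cast_natCast, norm_neg,
        Complex.norm_natCast]
      have : (s : ℝ) ≤ K := by exact_mod_cast hs.le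
      linarith
    · rw [natDegree_X_sub_C, Nat.one_le_iff_ne_zero, hN]
      exact mul_ne_zero (by omega) hd0
  have hR' : ∀ i < J, ∀ j < J, i ≠ j → ∃ R : ℕ, R ≠ 0 ∧ (R : ℝ) ≤ (2 * B) ^ (N * N) ∧
      ∀ p : ℕ, ∀ y : ZMod p, aeval y (f i) = 0 → aeval y (f j) = 0 → p ∣ R :=
    fun i hi j hj hij => exists_modulus_of_irreducible (hf i) (hf j) (hfi i) (hfi j)
      (hne i j hij) hB1 (hroot i hi) (hroot j hj) (hdeg i hi) (hdeg j hj)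
  have hone : (1 : ℝ) ≤ (2 * B) ^ (N * N) := one_le_pow₀ (by linarith)
  obtain ⟨R, hR⟩ : ∃ R : ℕ → ℕ → ℕ, ∀ i s, R i s ≠ 0 ∧ (R i s : ℝ) ≤ (2 * B) ^ (N * N) ∧
      (i < J → s < K → ∀ p : ℕ, ∀ y : ZMod p, aeval y (f i) = 0 →
        aeval y (X - C (-(s : ℤ))) = 0 → p ∣ R i s) := by
    have : ∀ i s, ∃ R : ℕ, R ≠ 0 ∧ (R : ℝ) ≤ (2 * B) ^ (N * N) ∧
        (i < J → s < K → ∀ p : ℕ, ∀ y : ZMod p, aeval y (f i) = 0 →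
          aeval y (X - C (-(s : ℤ))) = 0 → p ∣ R) := by
      intro i s
      by_cases h : i < J ∧ s < K
      · obtain ⟨R, h1, h2, h3⟩ := hR i h.1 s h.2
        exact ⟨R, h1, h2, fun _ _ => h3⟩
      · exact ⟨1, one_ne_zero, by simpa using hone, fun h1 h2 => absurd ⟨h1, h2⟩ h⟩
    choose R hR using this
    exact ⟨R, hR⟩
  obtain ⟨R', hR'⟩ : ∃ R' : ℕ → ℕ → ℕ, ∀ i j, R' i j ≠ 0 ∧ (R' i j : ℝ) ≤ (2 * B) ^ (N * N) ∧
      (i < J → j < J → i ≠ j → ∀ p : ℕ, ∀ y : ZMod p, aeval y (f i) = 0 → aeval y (f j) = 0 →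
        p ∣ R' i j) := by
    have : ∀ i j, ∃ R : ℕ, R ≠ 0 ∧ (R : ℝ) ≤ (2 * B) ^ (N * N) ∧
        (i < J → j < J → i ≠ j → ∀ p : ℕ, ∀ y : ZMod p, aeval y (f i) = 0 → aeval y (f j) = 0 →
          p ∣ R) := by
      intro i j
      by_cases h : i < J ∧ j < J ∧ i ≠ j
      · obtain ⟨R, h1, h2, h3⟩ := hR' i h.1 j h.2.1 h.2.2
        exact ⟨R, h1, h2, fun _ _ _ => h3⟩
      · exact ⟨1, one_ne_zero, by simpa using hone, fun h1 h2 h3 => absurd ⟨h1, h2, h3⟩ h⟩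
    choose R hR using this
    exact ⟨R, hR⟩
  refine ⟨f, ∏ i ∈ Finset.range J, ((∏ s ∈ Finset.range K, R i s) *
    ∏ j ∈ Finset.range J, R' i j), ?_, ?_, ?_, ?_⟩
  · exact Finset.prod_ne_zero_iff.2 fun i _ => mul_ne_zero
      (Finset.prod_ne_zero_iff.2 fun s _ => (hR i s).1)
      (Finset.prod_ne_zero_iff.2 fun j _ => (hR' i j).1)
  · push_cast
    have h1 : ∀ (T : ℕ → ℕ) (M : ℕ), (∀ s, (T s : ℝ) ≤ (2 * B) ^ (N * N)) →
        ∏ s ∈ Finset.range M, (T s : ℝ) ≤ ((2 * B) ^ (N * N)) ^ M := fun T M hT =>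
      (Finset.prod_le_prod (fun _ _ => Nat.cast_nonneg _) fun s _ => hT s).trans
        (by rw [Finset.prod_const, Finset.card_range])
    refine (Finset.prod_le_prod (fun i _ => by positivity) fun i _ =>
      mul_le_mul (h1 _ K fun s => (hR i s).2.1) (h1 _ J fun s => (hR' i s).2.1)
        (by positivity) (by positivity)).trans (le_of_eq ?_)
    rw [Finset.prod_const, Finset.card_range]
    ring
  · intro i hi
    refine ⟨hf i, hfi i, hdeg i hi, ?_, hroot i hi⟩
    exact ((separable_map_collisionPoly ha (hjd i)).of_dvd
      (Polynomial.map_dvd _ (hfd i))).squarefree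
  · intro p hp hpW
    have hdvd : ∀ i < J, ∀ r, (r ∣ (∏ s ∈ Finset.range K, R i s) * ∏ j ∈ Finset.range J, R' i j) →
        ¬ p ∣ r := fun i hi r hr hpr => hpW ((hpr.trans hr).trans
      (Finset.dvd_prod_of_mem (fun i => (∏ s ∈ Finset.range K, R i s) *
        ∏ j ∈ Finset.range J, R' i j) (Finset.mem_range.2 hi)))
    refine sum_rootCount_add_Gval_le hp (k := fun i => (1 + ℓ * i) * ℓ)
      (fun i _ => by simp [hℓ.ne_zero]) (fun i _ => hfd i) ?_ ?_
    · intro i hi j hj hij y hy hy'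
      exact hdvd i hi (R' i j) (dvd_mul_of_dvd_right
        (Finset.dvd_prod_of_mem (fun j => R' i j) (Finset.mem_range.2 hj)) _)
        ((hR' i j).2.2 hi hj hij p y hy hy')
    · intro i hi s hs hy
      have hsK := hs.trans_le (hkK i hi)
      exact hdvd i hi (R i s) (dvd_mul_of_dvd_left
        (Finset.dvd_prod_of_mem (fun s => R i s) (Finset.mem_range.2 hsK)) _)
        ((hR i s).2.2 hi hsK p _ hy (by simp))
end

section

theorem log_regularityConst_le {n : ℕ} (hn : 1 ≤ n) {A : ℝ} (hA : 1 ≤ A) :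
    Real.log (regularityConst n A) ≤ 5 * (n : ℝ) ^ 3 * (12 * n + 2 * Real.log A) := by
  have hn' : (1 : ℝ) ≤ n := by exact_mod_cast hn
  have hnA : 1 ≤ n * A := one_le_mul_of_one_le_of_one_le hn' hA
  have hlogA := Real.log_nonneg hA
  have h0 := one_le_errorConst n (A := A)
  have h1 : 2 * errorConst n A ≤ (6 * (6 * (n * A) ^ 2)) ^ n := by
    have h3 : (6 : ℝ) ≤ 6 ^ n := le_self_pow₀ (by norm_num) (by omega)
    have h4 : (1 + 5 * (n * A) ^ 2) ^ n ≤ (6 * (n * A) ^ 2) ^ n :=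
      pow_le_pow_left₀ (by positivity) (by nlinarith) n
    rw [errorConst, mul_pow 6, ← mul_assoc]
    norm_num
    exact mul_le_mul h3 h4 (by positivity) (by positivity)
  have h2 : Real.log (6 * (6 * (n * A) ^ 2)) ≤ 12 * n + 2 * Real.log A := by
    have h3 : 6 * (6 * (n * A) ^ 2) = (6 * n * A) ^ 2 := by ring
    have h4 := Real.log_le_sub_one_of_pos (x := 6 * n) (by positivity)
    rw [h3, Real.log_pow, Real.log_mul (by positivity) (by positivity)]
    push_cast
    linarith
  have h5 : Real.log (2 * errorConst n A) ≤ n * (12 * n + 2 * Real.log A) := by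
    refine (Real.log_le_log (by linarith) h1).trans ?_
    rw [Real.log_pow]
    gcongr
  rw [regularityConst, Real.log_pow]
  push_cast
  have h6 : (n : ℝ) * (2 * n + 3) ≤ 5 * n ^ 2 := by nlinarith
  calc _ ≤ 5 * (n : ℝ) ^ 2 * (n * (12 * n + 2 * Real.log A)) :=
        mul_le_mul h6 h5 (Real.log_nonneg (by linarith)) (by positivity)
    _ = _ := by ring

theorem two_le_regularityConst {n : ℕ} (hn : 1 ≤ n) (A : ℝ) : 2 ≤ regularityConst n A := by
  have h0 := one_le_errorConst n (A := A)
  rw [regularityConst]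
  exact (by linarith : 2 ≤ 2 * errorConst n A).trans (le_self_pow₀ (by linarith)
    (mul_ne_zero (by omega) (by omega)))

theorem regularityConst_mono_right (n : ℕ) {A A' : ℝ} (hA : 0 ≤ A) (h : A ≤ A') :
    regularityConst n A ≤ regularityConst n A' := by
  rw [regularityConst, regularityConst, errorConst, errorConst]
  gcongr

theorem regularityConst_scale {n N J : ℕ} {q K B A c u : ℝ} (hn : 1 ≤ n) (hJ : 1 ≤ J) (hB : 1 ≤ B)
    (hq : 0 ≤ q) (hK : 0 ≤ K) (hc : 10 ^ 7 ≤ c) (hnc : n ≤ c * J) (hNq : N + q ≤ c * J)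
    (hBc : B ≤ c * J) (hKc : K + J ≤ c * J) (hA : A ≤ c) (hu : Real.exp (15401 * c ^ 5 * J ^ 5) ≤ u)
    {Q : ℝ} (hQ : 2 ≤ Q) (hlog : Real.log Q ≤ 5 * (n : ℝ) ^ 3 * (12 * n + 2 * ((N + q) * Real.log B))) :
    Q ^ 220 ≤ u ∧ 10 ^ 7 ≤ u ∧ n ≤ u ∧ Q * Q * A ≤ u ∧
      (N : ℝ) ^ 2 * (J * (K + J)) * Real.log (2 * B) ≤ Real.exp (u / 2) := by
  have hJ' : (1 : ℝ) ≤ J := by exact_mod_cast hJ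
  have hc1 : 1 ≤ c := by linarith
  have hcJ : c ≤ c * J := le_mul_of_one_le_right (by linarith) hJ'
  have hJc : (J : ℝ) ≤ c * J := le_mul_of_one_le_left (by linarith) hc1
  set y := c * J with hy
  have hM : 15401 * c ^ 5 * (J : ℝ) ^ 5 = 15401 * y ^ 5 := by rw [hy]; ring
  rw [hM] at hu
  clear_value y
  have hy1 : 1 ≤ y := by linarith
  have hyM : y ≤ y ^ 5 := le_self_pow₀ hy1 (by norm_num)
  have huM : ∀ t ≤ 15401 * y ^ 5, Real.exp t ≤ u := fun t ht => (Real.exp_le_exp.2 ht).trans hu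
  have huM' : ∀ t ≤ 15401 * y ^ 5, t ≤ u := fun t ht =>
    (by linarith [Real.add_one_le_exp t] : t ≤ Real.exp t).trans (huM t ht)
  have hlogB0 := Real.log_nonneg hB
  have hlogB : Real.log B ≤ y := (Real.log_le_sub_one_of_pos (by linarith)).trans (by linarith)
  have hy0 : 0 ≤ y := by linarith
  have hlogQ : Real.log Q ≤ 70 * y ^ 5 := by
    refine hlog.trans ?_
    have h1 : ((N : ℝ) + q) * Real.log B ≤ y * y := mul_le_mul hNq hlogB hlogB0 hy0
    have h2 : (n : ℝ) ^ 3 ≤ y ^ 3 := pow_le_pow_left₀ (Nat.cast_nonneg n) hnc 3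
    have h3 : 12 * (n : ℝ) + 2 * ((N + q) * Real.log B) ≤ 14 * (y * y) := by nlinarith
    calc _ ≤ 5 * y ^ 3 * (14 * (y * y)) := mul_le_mul (by linarith) h3 (by positivity) (by positivity)
      _ = _ := by ring
  have hQpow : ∀ k : ℕ, Q ^ k = Real.exp (k * Real.log Q) := fun k => by
    rw [← Real.log_pow, Real.exp_log (by positivity)]
  refine ⟨?_, hc.trans (huM' c (by linarith)), huM' _ (by linarith), ?_, ?_⟩
  · rw [hQpow]
    exact huM _ (by push_cast; linarith)
  · refine le_trans ?_ (huM (2 * Real.log Q + c) (by linarith))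
    rw [Real.exp_add, ← Nat.cast_two, ← hQpow, pow_two]
    exact mul_le_mul_of_nonneg_left (by linarith [Real.add_one_le_exp c]) (by positivity)
  · have h1 : Real.log (2 * B) ≤ 2 * y :=
      (Real.log_le_sub_one_of_pos (by linarith)).trans (by linarith)
    have hN2 : (N : ℝ) ^ 2 ≤ y ^ 2 := pow_le_pow_left₀ (Nat.cast_nonneg N) (by linarith) 2
    have h2 : (J : ℝ) * (K + J) ≤ y * y := mul_le_mul hJc hKc (by positivity) hy0
    have h3 : (N : ℝ) ^ 2 * (J * (K + J)) * Real.log (2 * B) ≤ y ^ 2 * (y * y) * (2 * y) :=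
      mul_le_mul (mul_le_mul hN2 h2 (by positivity) (by positivity)) h1
        (Real.log_nonneg (by linarith)) (by positivity)
    have h4 : y ^ 2 * (y * y) * (2 * y) = 2 * y ^ 5 := by ring
    have h5 := huM' (4 * y ^ 5) (by linarith [pow_nonneg hy0 5])
    linarith [Real.add_one_le_exp (u / 2)]

end

section
open Polynomial Finset
open scoped Classical NNReal

theorem nonresiduePrimes_subset {q d : ℕ} (hqd : q ∣ d) (a : ℤ) {u : ℝ} {x : ℕ}
    (hx : (x : ℝ) = Real.exp (u + 1000)) (W : ℕ) :
    nonresiduePrimes q a u W ⊆ (Finset.Icc 1 x).filter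
      (fun p : ℕ => p.Prime ∧ ∀ m : ℤ, ¬ ((p : ℤ) ∣ ((X : Polynomial ℤ) ^ d - C a).eval m)) := by
  intro p hp
  rw [nonresiduePrimes, Finset.mem_filter, ← hx, Nat.floor_natCast] at hp
  refine Finset.mem_filter.2 ⟨hp.1, hp.2.1, fun m hm => ?_⟩
  obtain ⟨e, rfl⟩ := hqd
  refine hp.2.2.2 ((m : ZMod p) ^ e) ?_
  rw [← ZMod.intCast_zmod_eq_zero_iff_dvd] at hm
  rw [← sub_eq_zero, ← pow_mul, mul_comm e]
  simpa using hm

theorem sum_sub_Gval_ge {d : ℕ} {a : ℤ} {q ℓ : ℕ} (hq : q.Prime) (hqd : q ∣ d) (hℓ : ℓ.Prime)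
    (hℓd : ¬ ℓ ∣ d) {b : ℤ} (hab : a = ℓ * b) (hb : ¬ (ℓ : ℤ) ∣ b) {J : ℕ} (hJ : 1 ≤ J) {c : ℝ}
    (hc : 10 ^ 7 ≤ c) (hcd : (ℓ : ℝ) ^ 2 * d * (q * q) + q ≤ c)
    (hcB : (ℓ : ℝ) ^ 2 + |(a : ℝ)| + 2 ≤ c) (hca : q * |(a : ℝ)| ≤ c) {u : ℝ}
    (hu : Real.exp (15401 * c ^ 5 * J ^ 5) ≤ u) {x : ℕ} (hx : (x : ℝ) = Real.exp (u + 1000)) :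
    J * (Real.exp (u - 1000) / (160 * q * u)) ≤
      ∑ p ∈ (Finset.Icc 1 x).filter
        (fun p : ℕ => p.Prime ∧ ∀ m : ℤ, ¬ ((p : ℤ) ∣ ((X : Polynomial ℤ) ^ d - C a).eval m)),
      ((p : ℝ) - (Gval ((X : Polynomial ℤ) ^ d - C a) p : ℝ)) := by
  have := Fact.mk hℓ
  have hJ' : (1 : ℝ) ≤ J := by exact_mod_cast hJ
  have hd0 : d ≠ 0 := fun h => hℓd (h ▸ dvd_zero _)
  have hd1 : (1 : ℝ) ≤ d := by exact_mod_cast Nat.one_le_iff_ne_zero.2 hd0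
  have hq2 : (2 : ℝ) ≤ q := by exact_mod_cast hq.two_le
  have hℓ2 : (2 : ℝ) ≤ ℓ := by exact_mod_cast hℓ.two_le
  have ha0 := abs_nonneg (a : ℝ)
  have hc1 : 1 ≤ c := by linarith
  set N := ℓ ^ 2 * J * d with hN
  set n := N * (q * q) with hn
  obtain ⟨B, hBval⟩ : ∃ B : ℝ≥0, (B : ℝ) = (ℓ : ℝ) ^ 2 * J + |(a : ℝ)| + 2 :=
    ⟨⟨(ℓ : ℝ) ^ 2 * J + |(a : ℝ)| + 2, by positivity⟩, rfl⟩
  have hℓJ : 0 ≤ (ℓ : ℝ) ^ 2 * J := by positivity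
  have hB1 : (1 : ℝ) ≤ B := by linarith
  have haB : |(a : ℝ)| ≤ B := by linarith
  set Q := regularityConst n (B ^ (N + q)) with hQ
  have hNval : (N : ℝ) = ℓ ^ 2 * J * d := by rw [hN]; push_cast; ring
  have hnval : (n : ℝ) = N * (q * q) := by rw [hn]; push_cast; ring
  have hq4 : (4 : ℝ) ≤ q * q := by nlinarith
  have hN1 : (1 : ℝ) ≤ N := by
    have : N ≠ 0 := mul_ne_zero (mul_ne_zero (pow_ne_zero _ hℓ.ne_zero) (by omega)) hd0
    exact_mod_cast Nat.one_le_iff_ne_zero.2 this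
  have hn1 : 1 ≤ n := by
    have : (1 : ℝ) ≤ n := by rw [hnval]; nlinarith
    exact_mod_cast this
  have hcJ : c ≤ c * J := le_mul_of_one_le_right (by linarith) hJ'
  have hnqc : (n : ℝ) + q ≤ c * J := by
    calc (n : ℝ) + q ≤ (ℓ ^ 2 * d * (q * q) + q) * J := by
          rw [hnval, hNval]
          linarith [le_mul_of_one_le_right (Nat.cast_nonneg (α := ℝ) q) hJ']
      _ ≤ c * J := by gcongr
  have hNn : (N : ℝ) ≤ n := by
    rw [hnval]
    exact le_mul_of_one_le_right (Nat.cast_nonneg N) (by linarith)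
  have hnc : (n : ℝ) ≤ c * J := by linarith
  have hNc : (N : ℝ) ≤ c * J := by linarith
  have hNqc : (N : ℝ) + q ≤ c * J := by linarith
  have hBc : (B : ℝ) ≤ c * J := by
    calc (B : ℝ) ≤ (ℓ ^ 2 + |(a : ℝ)| + 2) * J := by
          rw [hBval]
          linarith [le_mul_of_one_le_right ha0 hJ']
      _ ≤ c * J := by gcongr
  have hKc : (ℓ : ℝ) ^ 2 * J + J ≤ c * J := by
    rw [← add_one_mul]
    gcongr
    linarith
  have hQ2 : 2 ≤ Q := two_le_regularityConst hn1 _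
  have hlogQ := log_regularityConst_le hn1 (one_le_pow₀ hB1 (n := N + q))
  rw [← hQ, Real.log_pow, Nat.cast_add] at hlogQ
  clear_value Q
  obtain ⟨hQu, hu7, hnu, hZu, hWu'⟩ := regularityConst_scale hn1 hJ hB1 (Nat.cast_nonneg q)
    (by positivity) hc hnc hNqc hBc hKc hca hu hQ2 hlogQ
  obtain ⟨f, W, hW0, hW, hf, hG⟩ := exists_irreducible_collision_family (a := a)
    ⟨b, hab⟩ hℓd J hBval.ge
  have hWu : Real.log W ≤ Real.exp (u / 2) := by
    have hW1 : (0 : ℝ) < W := by exact_mod_cast Nat.pos_of_ne_zero hW0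
    refine (Real.log_le_log hW1 hW).trans (le_trans (le_of_eq ?_) hWu')
    rw [Real.log_pow, hNval]
    push_cast
    ring
  have hkey : ∀ i ∈ Finset.range J, Real.exp (u - 1000) / (160 * q * u) ≤
      ∑ p ∈ nonresiduePrimes q a u W, (rootCount (f i) p : ℝ) := by
    intro i hi
    obtain ⟨hfm, hfi, hfN, hfs, hfr⟩ := hf i (Finset.mem_range.1 hi)
    have hfd : (f i).natDegree ≠ 0 := fun h => hfi.not_isUnit (by
      rw [hfm.natDegree_eq_zero.1 h]
      exact isUnit_one)
    have hdeg : (f i).natDegree * (q * q) ≤ n := Nat.mul_le_mul_right _ hfN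
    obtain ⟨L₁, L₂, Z, hKW⟩ := exists_kummerWeights hq hℓ hfm hfi hfd hfs hab hb (B := B) hB1 hfr
      haB (Q := Q) (by
        refine (regularityConst_mono hdeg (by positivity)).trans ?_
        rw [hQ]
        exact regularityConst_mono_right n (by positivity)
          (pow_le_pow_right₀ hB1 (Nat.add_le_add_right hfN q)))
    exact hKW.sum_rootCount_ge hq.two_le hQu hu7 ((Nat.cast_le.2 hdeg).trans hnu) hZu hW0 hWu
  calc J * (Real.exp (u - 1000) / (160 * q * u))
      = ∑ i ∈ Finset.range J, Real.exp (u - 1000) / (160 * q * u) := by simp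
    _ ≤ ∑ i ∈ Finset.range J, ∑ p ∈ nonresiduePrimes q a u W, (rootCount (f i) p : ℝ) :=
        Finset.sum_le_sum hkey
    _ = ∑ p ∈ nonresiduePrimes q a u W, ∑ i ∈ Finset.range J, (rootCount (f i) p : ℝ) :=
        Finset.sum_comm
    _ ≤ ∑ p ∈ nonresiduePrimes q a u W, ((p : ℝ) - (Gval ((X : ℤ[X]) ^ d - C a) p : ℝ)) := by
        refine Finset.sum_le_sum fun p hp => ?_
        rw [nonresiduePrimes, Finset.mem_filter] at hp
        rw [le_sub_iff_add_le]
        exact_mod_cast hG p hp.2.1.ne_zero hp.2.2.1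
    _ ≤ _ := Finset.sum_le_sum_of_subset_of_nonneg (nonresiduePrimes_subset hqd a hx W)
        fun p _ _ => sub_nonneg.2 (by exact_mod_cast Gval_le _ p)

end

section
open Filter Topology

theorem eventually_scale_le_log (C : ℝ) (hC : 0 ≤ C) : ∀ᶠ x : ℕ in atTop,
    Real.exp 1 ≤ Real.log (Real.log (Real.log x)) ∧ 2000 ≤ Real.log x ∧
      Real.exp (C * (⌊Real.log (Real.log (Real.log x))⌋₊ : ℝ) ^ 5) ≤ Real.log x - 1000 := by
  have h1 : Tendsto (fun x : ℕ => Real.log x) atTop atTop :=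
    Real.tendsto_log_atTop.comp tendsto_natCast_atTop_atTop
  have h2 : Tendsto (fun x : ℕ => Real.log (Real.log x)) atTop atTop :=
    Real.tendsto_log_atTop.comp h1
  have h3 : Tendsto (fun x : ℕ => Real.log (Real.log (Real.log x))) atTop atTop :=
    Real.tendsto_log_atTop.comp h2
  have h4 : ∀ᶠ t : ℝ in atTop, C * t ^ 5 ≤ Real.exp t - 1 := by
    have h := (Real.isLittleO_pow_exp_atTop (n := 5)).bound (c := 1 / (2 * (C + 1))) (by positivity)
    filter_upwards [h, eventually_ge_atTop 2] with t ht ht2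
    rw [Real.norm_of_nonneg (by positivity), Real.norm_of_nonneg (Real.exp_pos t).le,
      div_mul_eq_mul_div, le_div_iff₀ (by positivity)] at ht
    have := Real.add_one_le_exp t
    nlinarith [pow_nonneg (by linarith : 0 ≤ t) 5]
  filter_upwards [h1.eventually_ge_atTop 2000, h2.eventually_gt_atTop 0,
    h3.eventually_ge_atTop (Real.exp 1), h3.eventually h4] with x hx1 hx2 hx3 hx4
  refine ⟨hx3, hx1, ?_⟩
  have ht0 : 0 ≤ Real.log (Real.log (Real.log x)) := (Real.exp_pos 1).le.trans hx3
  rw [Real.exp_log hx2] at hx4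
  have h5 : C * (⌊Real.log (Real.log (Real.log x))⌋₊ : ℝ) ^ 5 ≤ Real.log (Real.log x) - 1 := by
    refine le_trans ?_ hx4
    gcongr
    exact Nat.floor_le ht0
  refine (Real.exp_le_exp.2 h5).trans ?_
  rw [Real.exp_sub, Real.exp_log (by linarith), div_le_iff₀ (Real.exp_pos 1)]
  nlinarith [Real.add_one_le_exp (1 : ℝ)]

theorem eventually_primeCounting_le_two_mul : ∀ᶠ x : ℕ in atTop,
    (Nat.primeCounting x : ℝ) ≤ 2 * x / Real.log x := by
  filter_upwards [tendsto_natCast_atTop_atTop.eventually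
    (Chebyshev.eventually_primeCounting_le (ε := 1 / 2) (by norm_num)),
    eventually_ge_atTop 2] with x hx hx2
  rw [Nat.floor_natCast] at hx
  have hlog : 0 < Real.log x := Real.log_pos (by exact_mod_cast hx2)
  refine hx.trans ?_
  gcongr
  rw [show (4 : ℝ) = 2 ^ 2 by norm_num, Real.log_pow]
  push_cast
  linarith [Real.log_two_lt_d9]

end

theorem exists_prime_factorization_of_squarefree {a : ℤ} (hsf : Squarefree a) (ha1 : a ≠ 1)
    (ham : a ≠ -1) : ∃ ℓ : ℕ, ℓ.Prime ∧ ∃ b : ℤ, a = ℓ * b ∧ ¬ (ℓ : ℤ) ∣ b := by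
  obtain ⟨ℓ, hℓ, hdvd⟩ := Nat.exists_prime_and_dvd (n := a.natAbs) (by
    rw [Ne, Int.natAbs_eq_iff]
    simp [ha1, ham])
  obtain ⟨b, rfl⟩ := Int.natCast_dvd.2 hdvd
  refine ⟨ℓ, hℓ, b, rfl, fun h => ?_⟩
  exact (Nat.prime_iff_prime_int.1 hℓ).not_isUnit (hsf ℓ (mul_dvd_mul_left _ h))

section
open Polynomial Finset
open scoped Classical

/-- **Theorem (missing values on average, binomial case).**
Let `P(x) = x^d − a` with `d ≥ 2`, `gcd(d, a) = 1`, `a` squarefree and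
`a ≠ ±1`. Then for some `c > 0` (depending only on `d` and `a`) and all large
`x`,
`(1/π(x)) · ∑_{p ≤ x, P has no root mod p} (p − G_P(p)) ≥ c · logloglog x / loglogloglog x`. -/
theorem stmt6 (d : ℕ) (hd : 2 ≤ d) (a : ℤ) (hcop : Int.gcd (d : ℤ) a = 1)
    (hsf : Squarefree a) (ha1 : a ≠ 1) (ham : a ≠ -1) :
    ∃ c : ℝ, 0 < c ∧ ∃ x₀ : ℕ, ∀ x : ℕ, x₀ ≤ x →
      c * Real.log (Real.log (Real.log x)) / Real.log (Real.log (Real.log (Real.log x))) ≤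
      (1 / (Nat.primeCounting x : ℝ)) *
        ∑ p ∈ (Finset.Icc 1 x).filter
            (fun p : ℕ => p.Prime ∧ ∀ m : ℤ, ¬ ((p : ℤ) ∣ ((X : Polynomial ℤ) ^ d - C a).eval m)),
          ((p : ℝ) - (Gval ((X : Polynomial ℤ) ^ d - C a) p : ℝ)) := by
  obtain ⟨ℓ, hℓ, b, hab, hb⟩ := exists_prime_factorization_of_squarefree hsf ha1 ham
  obtain ⟨q, hq, hqd⟩ := Nat.exists_prime_and_dvd (n := d) (by omega)
  have hℓd : ¬ ℓ ∣ d := by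
    intro h
    have h1 : (ℓ : ℤ) ∣ Int.gcd (d : ℤ) a :=
      Int.dvd_coe_gcd (Int.natCast_dvd_natCast.2 h) ⟨b, hab⟩
    rw [hcop] at h1
    exact hℓ.one_lt.ne' (Nat.dvd_one.1 (Int.natCast_dvd_natCast.1 h1))
  have hq0 : (0 : ℝ) < q := by exact_mod_cast hq.pos
  have ha0 := abs_nonneg (a : ℝ)
  set c : ℝ := 10 ^ 7 + (ℓ ^ 2 * d * (q * q) + q) + (ℓ ^ 2 + |(a : ℝ)| + 2) + q * |(a : ℝ)| with hc
  have hA : 0 ≤ (ℓ : ℝ) ^ 2 * d * (q * q) + q := by positivity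
  have hB : 0 ≤ (ℓ : ℝ) ^ 2 + |(a : ℝ)| + 2 := by positivity
  have hC : 0 ≤ q * |(a : ℝ)| := by positivity
  have hc0 : 0 ≤ c := by positivity
  obtain ⟨x₀, hx₀⟩ := Filter.eventually_atTop.1
    ((eventually_scale_le_log (15401 * c ^ 5) (by positivity)).and eventually_primeCounting_le_two_mul)
  refine ⟨Real.exp (-2000) / (640 * q), by positivity, x₀, fun x hx => ?_⟩
  obtain ⟨⟨h3, h1, hscale⟩, hpi⟩ := hx₀ x hx
  have hlog0 : 0 < Real.log x := by linarith
  have hx0 : (0 : ℝ) < x := by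
    rcases Nat.eq_zero_or_pos x with rfl | h
    · simp at hlog0
    · exact_mod_cast h
  have hpi0 : (0 : ℝ) < Nat.primeCounting x := by
    rw [Nat.cast_pos, Nat.pos_iff_ne_zero, Ne, Nat.primeCounting_eq_zero_iff]
    intro h
    have : (x : ℝ) ≤ 1 := by exact_mod_cast (by omega : x ≤ 1)
    linarith [Real.log_nonpos hx0.le this]
  set t := Real.log (Real.log (Real.log x)) with ht
  have he : 2 ≤ Real.exp 1 := by linarith [Real.add_one_le_exp (1 : ℝ)]
  have ht0 : 0 < t := by linarith
  have hJt : t / 2 ≤ ⌊t⌋₊ := by linarith [Nat.lt_floor_add_one t]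
  have hJ : 1 ≤ ⌊t⌋₊ := Nat.le_floor (by push_cast; linarith)
  have hxu : (x : ℝ) = Real.exp ((Real.log x - 1000) + 1000) := by
    rw [sub_add_cancel, Real.exp_log hx0]
  have hmain := sum_sub_Gval_ge hq hqd hℓ hℓd hab hb hJ (c := c) (by linarith) (by linarith)
    (by linarith) (by linarith) hscale hxu
  have ht1 : 1 ≤ Real.log t := by
    rw [← Real.log_exp 1]
    exact Real.log_le_log (Real.exp_pos 1) h3
  refine (div_le_self (by positivity) ht1).trans ?_
  rw [one_div_mul_eq_div, le_div_iff₀ hpi0]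
  refine le_trans ?_ hmain
  have hexp : Real.exp (Real.log x - 1000 - 1000) = x * Real.exp (-2000) := by
    rw [sub_sub, sub_eq_add_neg, Real.exp_add, Real.exp_log hx0]
    norm_num
  rw [hexp]
  calc Real.exp (-2000) / (640 * q) * t * (Nat.primeCounting x : ℝ)
      ≤ Real.exp (-2000) / (640 * q) * t * (2 * x / Real.log x) := by gcongr
    _ = t / 2 * (x * Real.exp (-2000) / (160 * q * Real.log x)) := by
        field_simp
        ring
    _ ≤ _ := by
        gcongr
        · have : 0 < Real.log x - 1000 := by linarith
          positivity
        · linarith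
end
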